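/- arXiv:1305.4112 — 2 statements merged into one kernel-verified Lean document; each statement's English description precedes it below -/
import Mathlib

section
/- Let Ω ⊂ ℝ² be a simple domain and μ > 0. Suppose u̲, ū ∈ C⁰(cl Ω) satisfy: u̲ ≤ 0 and ū ≥ 0 on ∂Ω; for every nonnegative φ ∈ C_c^∞(Ω), ∫_Ω (−Δφ) u̲ ≤ μ ∫_Ω e^{u̲} φ and ∫_Ω (−Δφ) ū ≥ μ ∫_Ω e^{ū} φ; and u̲ ≤ ū in Ω. Then there exists u ∈ C²(Ω) ∩ C⁰(cl Ω) with −Δu = μ e^u in Ω, u = 0 on ∂Ω, and u̲ ≤ u ≤ ū in Ω. -/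
open MeasureTheory Real Set Filter

noncomputable section

/-- The Euclidean plane ℝ². -/
abbrev R2 : Type := EuclideanSpace ℝ (Fin 2)

/-- The Laplacian of `u : R2 → ℝ`: the sum of the second derivatives of `u`
along the two coordinate axes. -/
def lap (u : R2 → ℝ) (p : R2) : ℝ :=
  ∑ i : Fin 2, iteratedDeriv 2 (fun t : ℝ => u (p + t • EuclideanSpace.single i (1 : ℝ))) 0

/-- A simple domain: a bounded open simply connected set whose boundary is the support of a
simple rectifiable (i.e. of bounded variation) Jordan curve. -/
def IsSimpleDomain (Ω : Set R2) : Prop :=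
  IsOpen Ω ∧ Bornology.IsBounded Ω ∧ SimplyConnectedSpace Ω ∧
    ∃ γ : ℝ → R2, ContinuousOn γ (Icc 0 1) ∧ γ 0 = γ 1 ∧ InjOn γ (Ico 0 1) ∧
      γ '' Icc 0 1 = frontier Ω ∧ BoundedVariationOn γ (Icc 0 1)

/-- `φ ∈ C_c^∞(Ω)`. -/
def IsTestFun (Ω : Set R2) (φ : R2 → ℝ) : Prop :=
  ContDiff ℝ (⊤ : ℕ∞) φ ∧ HasCompactSupport φ ∧ tsupport φ ⊆ Ω

section Potential

open Metric Topology InnerProductSpace Laplacian ComplexConjugate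

/-- Hurwitz: a locally uniform limit of non-vanishing holomorphic functions which vanishes at a
point vanishes near that point. -/
theorem eventually_eq_zero_of_tendstoLocallyUniformlyOn {ι : Type*} {l : Filter ι} [l.NeBot]
    {F : ι → ℂ → ℂ} {h : ℂ → ℂ} {U : Set ℂ} (hU : IsOpen U)
    (hF : ∀ i, DifferentiableOn ℂ (F i) U) (hF0 : ∀ i, ∀ z ∈ U, F i z ≠ 0)
    (hlim : TendstoLocallyUniformlyOn F h l U) {b : ℂ} (hb : b ∈ U) (hhb : h b = 0) :
    ∀ᶠ z in 𝓝 b, h z = 0 := by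
  have hd : DifferentiableOn ℂ h U := hlim.differentiableOn (Eventually.of_forall hF) hU
  have han : AnalyticAt ℂ h b := hd.analyticAt (hU.mem_nhds hb)
  refine han.eventually_eq_zero_or_eventually_ne_zero.resolve_right fun hne => ?_
  obtain ⟨r, hr, hball⟩ := Metric.mem_nhdsWithin_iff.1 hne
  obtain ⟨r', hr', hball'⟩ := Metric.isOpen_iff.1 hU b hb
  set δ := min r r' / 2 with hδ
  have hδ0 : 0 < δ := by positivity
  have hδr : δ < r := by have := min_le_left r r'; have := lt_min hr hr'; linarith
  have hδr' : δ < r' := by have := min_le_right r r'; have := lt_min hr hr'; linarith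
  have hsub : closedBall b δ ⊆ U := (closedBall_subset_ball hδr').trans hball'
  have hS : sphere b δ ⊆ U := sphere_subset_closedBall.trans hsub
  have hcomp : IsCompact (sphere b δ) := isCompact_sphere b δ
  have hSne : (sphere b δ).Nonempty := NormedSpace.sphere_nonempty.2 hδ0.le
  obtain ⟨x, hxS, hx⟩ := hcomp.exists_isMinOn hSne ((hd.continuousOn.mono hS).norm)
  have hxne : h x ≠ 0 := by
    refine hball ⟨?_, ?_⟩
    · rw [mem_ball, mem_sphere.1 hxS]; exact hδr
    · intro hxb
      rw [mem_singleton_iff.1 hxb, mem_sphere, dist_self] at hxS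
      exact hδ0.ne hxS
  set m := ‖h x‖ with hm
  have hm0 : 0 < m := norm_pos_iff.2 hxne
  have hunif : TendstoUniformlyOn F h l (sphere b δ) :=
    (tendstoLocallyUniformlyOn_iff_forall_isCompact hU).1 hlim _ hS hcomp
  have hpt : Tendsto (fun i => F i b) l (𝓝 (h b)) := hlim.tendsto_at hb
  have h1 := (Metric.tendstoUniformlyOn_iff.1 hunif) (m / 2) (by positivity)
  have h2 : ∀ᶠ i in l, m / 2 ≤ ‖F i b‖ := by
    filter_upwards [h1] with i hi
    have hcont : DiffContOnCl ℂ (fun z => (F i z)⁻¹) (ball b δ) := by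
      refine DifferentiableOn.diffContOnCl ?_
      rw [closure_ball b hδ0.ne']
      exact ((hF i).mono hsub).inv fun z hz => hF0 i z (hsub hz)
    have hle := Complex.norm_le_of_forall_mem_frontier_norm_le (C := (m / 2)⁻¹)
      isBounded_ball hcont (fun z hz => ?_) (subset_closure (mem_ball_self hδ0 : b ∈ ball b δ))
    · rw [norm_inv] at hle
      exact (inv_le_inv₀ (norm_pos_iff.2 (hF0 i b hb)) (by positivity)).1 hle
    · rw [frontier_ball b hδ0.ne'] at hz
      rw [norm_inv]
      refine inv_anti₀ (by positivity) ?_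
      have h3 := hi z hz
      have h4 : m ≤ ‖h z‖ := hx hz
      rw [dist_eq_norm] at h3
      have h5 := norm_sub_norm_le (h z) (F i z)
      linarith
  have h3 : m / 2 ≤ ‖h b‖ := ge_of_tendsto hpt.norm h2
  rw [hhb, norm_zero] at h3
  linarith

/-- Montel: a pointwise limit of holomorphic functions with values in the unit ball is a
locally uniform limit. -/
theorem tendstoLocallyUniformlyOn_of_mapsTo_ball {ι : Type*} {l : Filter ι} [l.NeBot]
    {F : ι → ℂ → ℂ} {h : ℂ → ℂ} {U : Set ℂ} (hU : IsOpen U)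
    (hF : ∀ i, DifferentiableOn ℂ (F i) U) (hF1 : ∀ i, MapsTo (F i) U (ball 0 1))
    (hlim : ∀ z ∈ U, Tendsto (fun i => F i z) l (𝓝 (h z))) :
    TendstoLocallyUniformlyOn F h l U := by
  rw [Metric.tendstoLocallyUniformlyOn_iff]
  intro ε hε x hx
  obtain ⟨r, hr, hball⟩ := Metric.isOpen_iff.1 hU x hx
  have key : ∀ i, ∀ y ∈ ball x r, dist (F i y) (F i x) ≤ 2 / r * dist y x := by
    intro i y hy
    refine Complex.dist_le_div_mul_dist_of_mapsTo_ball ((hF i).mono hball) ?_ hy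
    intro z hz
    have h1 := mem_ball_zero_iff.1 (hF1 i (hball hz))
    have h2 := mem_ball_zero_iff.1 (hF1 i hx)
    rw [mem_closedBall, dist_eq_norm]
    have := norm_sub_le (F i z) (F i x)
    linarith
  have key' : ∀ y ∈ ball x r, dist (h y) (h x) ≤ 2 / r * dist y x := fun y hy =>
    le_of_tendsto ((hlim y (hball hy)).dist (hlim x hx)) (Eventually.of_forall fun i => key i y hy)
  set δ := min r (ε * r / 8) with hδ
  have hδ0 : 0 < δ := by positivity
  refine ⟨ball x δ, mem_nhdsWithin_of_mem_nhds (ball_mem_nhds x hδ0), ?_⟩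
  filter_upwards [(Metric.tendsto_nhds.1 (hlim x hx)) (ε / 4) (by positivity)] with i hi y hy
  have hyr : y ∈ ball x r := ball_subset_ball (min_le_left _ _) hy
  have hd : 2 / r * dist y x ≤ ε / 4 := by
    have h1 : dist y x ≤ ε * r / 8 := (mem_ball.1 hy).le.trans (min_le_right _ _)
    calc 2 / r * dist y x ≤ 2 / r * (ε * r / 8) := by gcongr
      _ = ε / 4 := by field_simp; ring
  have h1 := key i y hyr
  have h2 := key' y hyr
  have h3 := dist_triangle4 (h y) (h x) (F i x) (F i y)
  rw [dist_comm (F i x) (F i y), dist_comm (h x) (F i x)] at h3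
  linarith

/-- The family of injective maps into the disc, normalised at `z₀`, used in the proof of the Riemann
mapping theorem. -/
structure IsDiscEmbedding (U : Set ℂ) (z₀ : ℂ) (h : ℂ → ℂ) : Prop where
  diff : DifferentiableOn ℂ h U
  maps : MapsTo h U (ball 0 1)
  inj : InjOn h U
  deriv_ne : ∀ z ∈ U, deriv h z ≠ 0
  zero : h z₀ = 0

theorem exists_isDiscEmbedding_maximal {U : Set ℂ} (hU : IsOpen U) (hb : Bornology.IsBounded U)
    (hc : IsPreconnected U) {z₀ : ℂ} (hz₀ : z₀ ∈ U) :
    ∃ h, IsDiscEmbedding U z₀ h ∧ ∀ k, IsDiscEmbedding U z₀ k → ‖deriv k z₀‖ ≤ ‖deriv h z₀‖ := by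
  obtain ⟨r, hr, hball⟩ := Metric.isOpen_iff.1 hU z₀ hz₀
  obtain ⟨R, hR, hUR⟩ := hb.subset_ball_lt 0 z₀
  set S : Set ℝ := {s | ∃ h, IsDiscEmbedding U z₀ h ∧ ‖deriv h z₀‖ = s} with hS
  have hder0 : ∀ z, deriv (fun z => (z - z₀) / (R : ℂ)) z = 1 / R := by
    intro z
    simp
  have hR' : (R : ℂ) ≠ 0 := by exact_mod_cast hR.ne'
  have h0 : IsDiscEmbedding U z₀ (fun z => (z - z₀) / (R : ℂ)) := by
    refine ⟨by fun_prop, ?_, ?_, ?_, by simp⟩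
    · intro z hz
      have := mem_ball.1 (hUR hz)
      rw [dist_eq_norm] at this
      rw [mem_ball_zero_iff, norm_div, Complex.norm_real, Real.norm_of_nonneg hR.le,
        div_lt_one hR]
      exact this
    · intro a _ b _ hab
      have := (div_left_inj' hR').1 hab
      linear_combination this
    · intro z _
      rw [hder0]
      exact one_div_ne_zero hR'
  have hSne : S.Nonempty := ⟨_, _, h0, rfl⟩
  have hSb : BddAbove S := by
    refine ⟨1 / r, ?_⟩
    rintro s ⟨h, hh, rfl⟩
    refine Complex.norm_deriv_le_div_of_mapsTo_ball (hh.diff.mono hball) ?_ hr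
    intro z hz
    rw [hh.zero]
    exact ball_subset_closedBall (hh.maps (hball hz))
  obtain ⟨s, -, hslim, hsS⟩ := exists_seq_tendsto_sSup hSne hSb
  choose F hF hFs using hsS
  set l : Filter ℕ := ((hyperfilter ℕ : Ultrafilter ℕ) : Filter ℕ) with hl
  have hlle : l ≤ atTop := Nat.hyperfilter_le_atTop
  have hex : ∀ z, ∃ y, z ∈ U → Tendsto (fun i => F i z) l (𝓝 y) := by
    intro z
    by_cases hz : z ∈ U
    · obtain ⟨y, -, hy⟩ := (isCompact_closedBall (0 : ℂ) 1).ultrafilter_le_nhds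
        ((hyperfilter ℕ : Ultrafilter ℕ).map (fun i => F i z)) (by
          rw [le_principal_iff]
          exact Eventually.of_forall (f := l) fun i => ball_subset_closedBall ((hF i).maps hz))
      exact ⟨y, fun _ => hy⟩
    · exact ⟨0, fun h => absurd h hz⟩
  choose h hh using hex
  have hlim : TendstoLocallyUniformlyOn F h l U :=
    tendstoLocallyUniformlyOn_of_mapsTo_ball hU (fun i => (hF i).diff) (fun i => (hF i).maps)
      (fun z hz => hh z hz)
  have hd : DifferentiableOn ℂ h U :=
    hlim.differentiableOn (Eventually.of_forall fun i => (hF i).diff) hU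
  have hlim' : TendstoLocallyUniformlyOn (deriv ∘ F) (deriv h) l U :=
    hlim.deriv (Eventually.of_forall fun i => (hF i).diff) hU
  have hsup : ‖deriv h z₀‖ = sSup S := by
    refine tendsto_nhds_unique (hlim'.tendsto_at hz₀).norm ?_
    simp only [Function.comp_apply, hFs]
    exact hslim.mono_left hlle
  have hpos : 0 < ‖deriv h z₀‖ := by
    rw [hsup]
    refine lt_of_lt_of_le ?_ (le_csSup hSb ⟨_, h0, rfl⟩)
    rw [hder0]
    exact norm_pos_iff.2 (one_div_ne_zero hR')
  have hnonconst : ∀ b ∈ U, ∀ c, ¬ ∀ᶠ z in 𝓝 b, h z = c := by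
    intro b hbU c hbc
    have heq : EqOn h (fun _ => c) U :=
      (hd.analyticOnNhd hU).eqOn_of_preconnected_of_eventuallyEq
        (analyticOnNhd_const) hc hbU hbc
    have : deriv h z₀ = 0 := by
      rw [Filter.EventuallyEq.deriv_eq (heq.eventuallyEq_of_mem (hU.mem_nhds hz₀))]
      simp
    rw [this, norm_zero] at hpos
    exact lt_irrefl _ hpos
  refine ⟨h, ⟨hd, ?_, ?_, ?_, ?_⟩, ?_⟩
  · have hcl : MapsTo h U (closedBall 0 1) := fun z hz =>
      isClosed_closedBall.mem_of_tendsto (hh z hz)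
        (Eventually.of_forall fun i => ball_subset_closedBall ((hF i).maps hz))
    have hopen : IsOpen (h '' U) := by
      rcases (hd.analyticOnNhd hU).is_constant_or_isOpen hc with ⟨w, hw⟩ | ho
      · exact absurd (eventually_of_mem (hU.mem_nhds hz₀) hw) (hnonconst z₀ hz₀ w)
      · exact ho U subset_rfl hU
    intro z hz
    have := interior_maximal (hcl.image_subset) hopen (mem_image_of_mem h hz)
    rwa [interior_closedBall _ one_ne_zero] at this
  · intro a ha b hbU hab
    by_contra hne
    have hU' : IsOpen (U \ {a}) := hU.sdiff isClosed_singleton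
    have hb' : b ∈ U \ {a} := ⟨hbU, fun h => hne (mem_singleton_iff.1 h).symm⟩
    have hlimsub : TendstoLocallyUniformlyOn (fun i z => F i z - F i a) (fun z => h z - h a) l
        (U \ {a}) := by
      have h1 := hlim.mono (sdiff_subset (t := {a}))
      have h2 : TendstoUniformlyOn (fun i (_ : ℂ) => F i a) (fun _ => h a) l (U \ {a}) := by
        rw [Metric.tendstoUniformlyOn_iff]
        intro ε hε
        filter_upwards [Metric.tendsto_nhds.1 (hh a ha) ε hε] with i hi x _
        rw [dist_comm]; exact hi
      exact h1.sub h2.tendstoLocallyUniformlyOn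
    refine hnonconst b hbU (h a) ?_
    have := eventually_eq_zero_of_tendstoLocallyUniformlyOn hU'
      (fun i => (((hF i).diff.mono sdiff_subset).sub_const _)) ?_ hlimsub hb'
      (by simp [hab])
    · filter_upwards [this] with z hz using sub_eq_zero.1 hz
    · intro i z hz h0
      exact hz.2 ((hF i).inj hz.1 ha (sub_eq_zero.1 h0))
  · intro z hz h0
    have := eventually_eq_zero_of_tendstoLocallyUniformlyOn hU
      (fun i => (hF i).diff.deriv hU) (fun i => (hF i).deriv_ne) hlim' hz h0
    obtain ⟨ε, hε, hεs⟩ := Metric.eventually_nhds_iff_ball.1 (this.and (hU.mem_nhds hz))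
    refine hnonconst z hz (h z) ?_
    filter_upwards [ball_mem_nhds z hε] with y hy
    exact (convex_ball z ε).is_const_of_fderivWithin_eq_zero (𝕜 := ℂ)
      (hd.mono fun w hw => (hεs w hw).2)
      (fun w hw => by
        rw [fderivWithin_of_isOpen isOpen_ball hw]
        ext
        simp [(hεs w hw).1]) hy (mem_ball_self hε)
  · exact tendsto_nhds_unique (hh z₀ hz₀) (by simp [fun i => (hF i).zero])
  · intro k hk
    rw [hsup]
    exact le_csSup hSb ⟨k, hk, rfl⟩

/-- The automorphism of the unit disc sending `a` to `0`. -/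
def mobius (a z : ℂ) : ℂ := (z - a) / (1 - conj a * z)

theorem one_sub_conj_mul_ne_zero {a z : ℂ} (ha : ‖a‖ < 1) (hz : ‖z‖ ≤ 1) : 1 - conj a * z ≠ 0 := by
  intro h
  have h1 : conj a * z = 1 := (sub_eq_zero.1 h).symm
  have h2 : ‖a‖ * ‖z‖ = 1 := by rw [← Complex.norm_conj a, ← norm_mul, h1, norm_one]
  nlinarith [norm_nonneg a, norm_nonneg z]

theorem sq_norm_sub_sq_norm_eq (a z : ℂ) :
    ‖1 - conj a * z‖ ^ 2 - ‖z - a‖ ^ 2 = (1 - ‖a‖ ^ 2) * (1 - ‖z‖ ^ 2) := by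
  simp only [← Complex.normSq_eq_norm_sq, Complex.normSq_apply]
  simp
  ring

theorem norm_mobius_lt_one {a z : ℂ} (ha : ‖a‖ < 1) (hz : ‖z‖ < 1) : ‖mobius a z‖ < 1 := by
  have h0 := norm_pos_iff.2 (one_sub_conj_mul_ne_zero ha hz.le)
  rw [mobius, norm_div, div_lt_one h0]
  have h1 := sq_norm_sub_sq_norm_eq a z
  have h2 : 0 < (1 - ‖a‖ ^ 2) * (1 - ‖z‖ ^ 2) := by
    have := norm_nonneg a
    have := norm_nonneg z
    apply mul_pos <;> nlinarith
  refine lt_of_pow_lt_pow_left₀ 2 h0.le ?_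
  linarith

theorem mobius_neg_mobius {a z : ℂ} (ha : ‖a‖ < 1) (hz : ‖z‖ < 1) :
    mobius (-a) (mobius a z) = z := by
  have h0 := one_sub_conj_mul_ne_zero ha hz.le
  have h1 : 1 - conj a * a ≠ 0 := one_sub_conj_mul_ne_zero ha ha.le
  have h2 : 1 - conj (-a) * ((z - a) / (1 - conj a * z)) = (1 - conj a * a) / (1 - conj a * z) := by
    rw [eq_div_iff h0, sub_mul, mul_assoc, div_mul_cancel₀ _ h0, map_neg]
    ring
  rw [mobius, mobius, h2, div_eq_iff (div_ne_zero h1 h0), ← mul_div_assoc, sub_neg_eq_add,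
    eq_div_iff h0, add_mul, div_mul_cancel₀ _ h0]
  ring

theorem hasDerivAt_mobius {a z : ℂ} (ha : ‖a‖ < 1) (hz : ‖z‖ < 1) :
    HasDerivAt (mobius a) ((1 - conj a * a) / (1 - conj a * z) ^ 2) z := by
  have h0 := one_sub_conj_mul_ne_zero ha hz.le
  have h := ((hasDerivAt_id z).sub_const a).div (((hasDerivAt_id z).const_mul (conj a)).const_sub 1)
    h0
  refine h.congr_deriv ?_
  simp
  ring

theorem norm_one_sub_conj_mul_self {a : ℂ} (ha : ‖a‖ < 1) : ‖1 - conj a * a‖ = 1 - ‖a‖ ^ 2 := by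
  have : 1 - conj a * a = ((1 - ‖a‖ ^ 2 : ℝ) : ℂ) := by
    rw [mul_comm, Complex.mul_conj, Complex.normSq_eq_norm_sq]
    push_cast
    ring
  rw [this, Complex.norm_real, Real.norm_of_nonneg]
  nlinarith [norm_nonneg a]

/-- Postcomposition with a disc automorphism preserves injective holomorphic maps to the disc. -/
theorem deriv_mobius_comp {U : Set ℂ} (hU : IsOpen U) {h : ℂ → ℂ} (hd : DifferentiableOn ℂ h U)
    (hm : MapsTo h U (ball 0 1)) {a : ℂ} (ha : ‖a‖ < 1) {z : ℂ} (hz : z ∈ U) :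
    HasDerivAt (fun z => mobius a (h z))
      ((1 - conj a * a) / (1 - conj a * h z) ^ 2 * deriv h z) z :=
  (hasDerivAt_mobius ha (mem_ball_zero_iff.1 (hm hz))).comp z
    (hd.differentiableAt (hU.mem_nhds hz)).hasDerivAt

theorem surjOn_of_isDiscEmbedding_maximal {U : Set ℂ} (hU : IsOpen U) (hs : IsSimplyConnected U)
    {z₀ : ℂ} (hz₀ : z₀ ∈ U) {h : ℂ → ℂ} (hh : IsDiscEmbedding U z₀ h)
    (hmax : ∀ k, IsDiscEmbedding U z₀ k → ‖deriv k z₀‖ ≤ ‖deriv h z₀‖) :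
    SurjOn h U (ball 0 1) := by
  intro a ha
  by_contra hna
  have ha1 : ‖a‖ < 1 := mem_ball_zero_iff.1 ha
  have ha0 : a ≠ 0 := by
    rintro rfl
    exact hna ⟨z₀, hz₀, hh.zero⟩
  set w : ℂ → ℂ := fun z => mobius a (h z) with hw
  have hwd : ∀ z ∈ U, HasDerivAt w ((1 - conj a * a) / (1 - conj a * h z) ^ 2 * deriv h z) z :=
    fun z hz => deriv_mobius_comp hU hh.diff hh.maps ha1 hz
  have hw1 : ∀ z ∈ U, ‖w z‖ < 1 := fun z hz =>
    norm_mobius_lt_one ha1 (mem_ball_zero_iff.1 (hh.maps hz))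
  have hw0 : ∀ z ∈ U, w z ≠ 0 := by
    intro z hz h0
    have h1 : h z - a = 0 := by
      rcases div_eq_zero_iff.1 h0 with h | h
      · exact h
      · exact absurd h (one_sub_conj_mul_ne_zero ha1 (mem_ball_zero_iff.1 (hh.maps hz)).le)
    exact hna ⟨z, hz, sub_eq_zero.1 h1⟩
  have hwinj : InjOn w U := by
    intro x hx y hy hxy
    apply hh.inj hx hy
    rw [← mobius_neg_mobius ha1 (mem_ball_zero_iff.1 (hh.maps hx)),
      ← mobius_neg_mobius ha1 (mem_ball_zero_iff.1 (hh.maps hy))]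
    exact congrArg _ hxy
  have hwc : ContinuousOn w U := fun z hz => (hwd z hz).continuousAt.continuousWithinAt
  obtain ⟨g, hgc, hgw⟩ := Complex.exists_continuousOn_pow_eq hs hU hwc
    (by rintro ⟨z, hz, h0⟩; exact hw0 z hz h0) (two_ne_zero)
  have hg0 : ∀ z ∈ U, g z ≠ 0 := by
    intro z hz h0
    apply hw0 z hz
    rw [← hgw, h0]
    simp
  have hgd : ∀ z ∈ U, HasDerivAt g (deriv w z / (2 * g z)) z := by
    intro z hz
    have h2 : HasDerivAt (fun x : ℂ => x ^ 2) (2 * g z) (g z) := by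
      simpa using hasDerivAt_pow 2 (g z)
    have h3 := h2.of_comp_left (hgc.continuousAt (hU.mem_nhds hz)) (hwd z hz)
      (mul_ne_zero two_ne_zero (hg0 z hz)) (Eventually.of_forall hgw)
    rwa [(hwd z hz).deriv]
  have hgD : DifferentiableOn ℂ g U := fun z hz =>
    (hgd z hz).differentiableAt.differentiableWithinAt
  have hg1 : MapsTo g U (ball 0 1) := by
    intro z hz
    have h1 := hw1 z hz
    rw [← hgw, norm_pow] at h1
    rw [mem_ball_zero_iff]
    nlinarith [norm_nonneg (g z)]
  have hginj : InjOn g U := by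
    intro x hx y hy hxy
    apply hwinj hx hy
    rw [← hgw, ← hgw, hxy]
  have hb1 : ‖g z₀‖ < 1 := mem_ball_zero_iff.1 (hg1 hz₀)
  have hab : ‖g z₀‖ ^ 2 = ‖a‖ := by
    rw [← norm_pow, hgw, hw]
    simp [mobius, hh.zero]
  have hb0 : 0 < ‖g z₀‖ := norm_pos_iff.2 (hg0 z₀ hz₀)
  have hkd : ∀ z ∈ U, HasDerivAt (fun z => mobius (g z₀) (g z))
      ((1 - conj (g z₀) * g z₀) / (1 - conj (g z₀) * g z) ^ 2 * deriv g z) z :=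
    fun z hz => deriv_mobius_comp hU hgD hg1 hb1 hz
  have hk : IsDiscEmbedding U z₀ (fun z => mobius (g z₀) (g z)) := by
    refine ⟨fun z hz => (hkd z hz).differentiableAt.differentiableWithinAt, ?_, ?_, ?_, ?_⟩
    · intro z hz
      exact mem_ball_zero_iff.2 (norm_mobius_lt_one hb1 (mem_ball_zero_iff.1 (hg1 hz)))
    · intro x hx y hy hxy
      apply hginj hx hy
      rw [← mobius_neg_mobius hb1 (mem_ball_zero_iff.1 (hg1 hx)),
        ← mobius_neg_mobius hb1 (mem_ball_zero_iff.1 (hg1 hy))]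
      exact congrArg _ hxy
    · intro z hz
      rw [(hkd z hz).deriv, (hgd z hz).deriv, (hwd z hz).deriv]
      have n1 := one_sub_conj_mul_ne_zero hb1 hb1.le
      have n2 := one_sub_conj_mul_ne_zero hb1 (mem_ball_zero_iff.1 (hg1 hz)).le
      have n3 := one_sub_conj_mul_ne_zero ha1 ha1.le
      have n4 := one_sub_conj_mul_ne_zero ha1 (mem_ball_zero_iff.1 (hh.maps hz)).le
      exact mul_ne_zero (div_ne_zero n1 (pow_ne_zero 2 n2)) (div_ne_zero (mul_ne_zero
        (div_ne_zero n3 (pow_ne_zero 2 n4)) (hh.deriv_ne z hz))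
        (mul_ne_zero two_ne_zero (hg0 z hz)))
    · simp [mobius]
  have hle := hmax _ hk
  have hpos : 0 < ‖deriv h z₀‖ := norm_pos_iff.2 (hh.deriv_ne z₀ hz₀)
  rw [(hkd z₀ hz₀).deriv, (hgd z₀ hz₀).deriv, (hwd z₀ hz₀).deriv, hh.zero] at hle
  simp only [mul_zero, sub_zero, one_pow, div_one, norm_mul, norm_div, norm_pow,
    norm_one_sub_conj_mul_self hb1, norm_one_sub_conj_mul_self ha1, Complex.norm_ofNat] at hle
  rw [← hab] at hle
  set β := ‖g z₀‖ with hβ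
  have hβ1 : 0 < 1 - β ^ 2 := by nlinarith
  have h5 : (1 - β ^ 2) / (1 - β ^ 2) ^ 2 * ((1 - (β ^ 2) ^ 2) * ‖deriv h z₀‖ / (2 * β))
      = (1 + β ^ 2) / (2 * β) * ‖deriv h z₀‖ := by
    field_simp
    ring
  rw [h5] at hle
  have h6 : (1 + β ^ 2) / (2 * β) ≤ 1 := by
    by_contra hcon
    push Not at hcon
    nlinarith
  rw [div_le_one (by positivity)] at h6
  nlinarith [sq_pos_of_pos (sub_pos.2 hb1)]

/-- A pair of mutually inverse holomorphic maps between `U` and the unit disc. -/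
structure IsRiemannPair (U : Set ℂ) (f ψ : ℂ → ℂ) : Prop where
  diff : DifferentiableOn ℂ f U
  diff_inv : DifferentiableOn ℂ ψ (ball 0 1)
  maps : MapsTo f U (ball 0 1)
  maps_inv : MapsTo ψ (ball 0 1) U
  left_inv : ∀ z ∈ U, ψ (f z) = z
  right_inv : ∀ ζ ∈ ball (0 : ℂ) 1, f (ψ ζ) = ζ

/-- The **Riemann mapping theorem** for bounded domains. -/
theorem exists_isRiemannPair {U : Set ℂ} (hU : IsOpen U) (hb : Bornology.IsBounded U)
    (hs : IsSimplyConnected U) : ∃ f ψ, IsRiemannPair U f ψ := by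
  obtain ⟨z₀, hz₀⟩ := hs.nonempty
  obtain ⟨h, hh, hmax⟩ := exists_isDiscEmbedding_maximal hU hb
    hs.isPathConnected.isConnected.isPreconnected hz₀
  have hsurj := surjOn_of_isDiscEmbedding_maximal hU hs hz₀ hh hmax
  have hbij : InvOn (Function.invFunOn h U) h U (ball 0 1) :=
    BijOn.invOn_invFunOn ⟨hh.maps, hh.inj, hsurj⟩
  have hmaps : MapsTo (Function.invFunOn h U) (ball 0 1) U := hsurj.mapsTo_invFunOn
  refine ⟨h, Function.invFunOn h U, hh.diff, ?_, hh.maps, hmaps, hbij.1, hbij.2⟩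
  intro ζ hζ
  set z := Function.invFunOn h U ζ with hz
  have hzU : z ∈ U := hmaps hζ
  have hhz : h z = ζ := hbij.2 hζ
  have hst : HasStrictDerivAt h (deriv h z) z :=
    (hh.diff.analyticAt (hU.mem_nhds hzU)).hasStrictDerivAt
  have hcont : ContinuousAt (Function.invFunOn h U) ζ := by
    rw [ContinuousAt, ← hz, ← hhz, ← hst.map_nhds_eq (hh.deriv_ne z hzU), tendsto_map'_iff]
    refine tendsto_id.congr' ?_
    filter_upwards [hU.mem_nhds hzU] with y hy using (hbij.1 hy).symm
  have := HasStrictDerivAt.of_local_left_inverse hcont hst (hh.deriv_ne z hzU)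
    (eventually_of_mem (isOpen_ball.mem_nhds hζ) fun y hy => hbij.2 hy)
  exact this.hasDerivAt.differentiableAt.differentiableWithinAt

/-- A bounded measurable density on `ℂ` supported in a ball. -/
structure IsBddDensity (q : ℂ → ℝ) (M R : ℝ) : Prop where
  meas : AEStronglyMeasurable q
  bound : ∀ z, ‖q z‖ ≤ M
  supp : ∀ z, R ≤ ‖z‖ → q z = 0

lemma integrableOn_inv_norm (R : ℝ) : IntegrableOn (fun z : ℂ => ‖z‖⁻¹) (ball 0 R) := by
  have h := integrableOn_fun_norm_addHaar (E := ℂ) volume (f := fun y : ℝ => y⁻¹) (r := R)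
  rw [h]
  have : IntegrableOn (fun _ : ℝ => (1 : ℝ)) (Ioo 0 R) := by simp
  refine this.congr_fun (fun y hy => ?_) measurableSet_Ioo
  have : y ≠ 0 := hy.1.ne'
  simp [Complex.finrank_real_complex, this]

section Kernel

variable {E : Type*} [NormedAddCommGroup E] [NormedSpace ℝ E] {k : ℂ → E} {q : ℂ → ℝ} {M R A : ℝ}
  {a : ℂ}

lemma IsBddDensity.smul_indicator_eq (hq : IsBddDensity q M R) (hA : R + ‖a‖ ≤ A) (ζ : ℂ) :
    q ζ • k (a - ζ) = q ζ • (ball (0 : ℂ) A).indicator k (a - ζ) := by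
  rcases lt_or_ge ‖ζ‖ R with h | h
  · rw [indicator_of_mem]
    rw [mem_ball_zero_iff]
    linarith [norm_sub_le a ζ]
  · simp [hq.supp ζ h]

lemma IsBddDensity.integrable_smul (hq : IsBddDensity q M R)
    (hk : ∀ A, IntegrableOn k (ball 0 A)) (a : ℂ) :
    Integrable (fun ζ => q ζ • k (a - ζ)) := by
  have h1 := ((integrable_indicator_iff (measurableSet_ball)).2 (hk (R + ‖a‖))).comp_sub_left a
  simp_rw [hq.smul_indicator_eq (k := k) (le_refl (R + ‖a‖))]
  exact h1.bdd_smul M hq.meas (Eventually.of_forall hq.bound)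

lemma IsBddDensity.norm_integral_smul_le (hq : IsBddDensity q M R)
    (hk : ∀ A, IntegrableOn k (ball 0 A)) (hA : R + ‖a‖ ≤ A) :
    ‖∫ ζ, q ζ • k (a - ζ)‖ ≤ M * ∫ z in ball 0 A, ‖k z‖ := by
  have h1 := ((integrable_indicator_iff (measurableSet_ball)).2 (hk A)).comp_sub_left a
  simp_rw [hq.smul_indicator_eq (k := k) hA]
  calc _ ≤ ∫ ζ, M * ‖(ball (0 : ℂ) A).indicator k (a - ζ)‖ := by
        refine norm_integral_le_of_norm_le (h1.norm.const_mul M) (Eventually.of_forall fun ζ => ?_)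
        rw [norm_smul]
        exact mul_le_mul_of_nonneg_right (hq.bound ζ) (norm_nonneg _)
    _ = M * ∫ z in ball 0 A, ‖k z‖ := by
        rw [integral_const_mul,
          integral_sub_left_eq_self (fun z => ‖(ball (0 : ℂ) A).indicator k z‖) volume a,
          ← integral_indicator measurableSet_ball]
        simp_rw [norm_indicator_eq_indicator_norm]

end Kernel

/-- The gradient of `½ log (‖z‖² + η²)`, as a continuous linear form. -/
def newtonGrad (η : ℝ) (z : ℂ) : ℂ →L[ℝ] ℝ := (‖z‖ ^ 2 + η ^ 2)⁻¹ • innerSL ℝ z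

lemma norm_newtonGrad_le (η : ℝ) (z : ℂ) : ‖newtonGrad η z‖ ≤ ‖z‖⁻¹ := by
  rw [newtonGrad, norm_smul, innerSL_apply_norm, norm_inv, Real.norm_of_nonneg (by positivity)]
  rcases eq_or_ne z 0 with rfl | hz
  · simp
  · have : 0 < ‖z‖ := norm_pos_iff.2 hz
    rw [inv_mul_le_iff₀ (by positivity)]
    field_simp
    nlinarith [sq_nonneg η]

lemma norm_newtonGrad_le_inv {η : ℝ} (hη : 0 < η) (z : ℂ) : ‖newtonGrad η z‖ ≤ η⁻¹ := by
  rw [newtonGrad, norm_smul, innerSL_apply_norm, norm_inv, Real.norm_of_nonneg (by positivity),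
    inv_mul_le_iff₀ (by positivity)]
  field_simp
  nlinarith [sq_nonneg (‖z‖ - η), norm_nonneg z]

lemma continuous_newtonGrad {η : ℝ} (hη : 0 < η) : Continuous (newtonGrad η) := by
  unfold newtonGrad
  have h : Continuous fun z : ℂ => (‖z‖ ^ 2 + η ^ 2)⁻¹ :=
    Continuous.inv₀ (by fun_prop) fun z => by positivity
  exact h.smul (innerSL ℝ).continuous

lemma measurable_newtonGrad (η : ℝ) : Measurable (newtonGrad η) := by
  unfold newtonGrad
  have : Measurable fun z : ℂ => innerSL ℝ z := (innerSL ℝ (E := ℂ)).continuous.measurable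
  fun_prop

lemma integrableOn_newtonGrad (η R : ℝ) : IntegrableOn (newtonGrad η) (ball 0 R) :=
  (integrableOn_inv_norm R).mono' (measurable_newtonGrad η).aestronglyMeasurable
    (Eventually.of_forall (norm_newtonGrad_le η))

lemma tendsto_newtonGrad (z : ℂ) :
    Tendsto (fun η => newtonGrad η z) (𝓝[>] 0) (𝓝 (newtonGrad 0 z)) := by
  rcases eq_or_ne z 0 with rfl | hz
  · simp [newtonGrad]
  · have : ‖z‖ ^ 2 + 0 ^ 2 ≠ 0 := by simpa using hz
    have h : ContinuousAt (fun η : ℝ => newtonGrad η z) 0 := by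
      unfold newtonGrad
      have h : ContinuousAt (fun η : ℝ => (‖z‖ ^ 2 + η ^ 2)⁻¹) 0 :=
        ContinuousAt.inv₀ (by fun_prop) this
      exact h.smul continuousAt_const
    exact h.tendsto.mono_left nhdsWithin_le_nhds

lemma tendsto_integral_newtonGrad_sub (A : ℝ) :
    Tendsto (fun η => ∫ z in ball 0 A, ‖newtonGrad η z - newtonGrad 0 z‖) (𝓝[>] 0) (𝓝 0) := by
  have h : Tendsto (fun η => ∫ z in ball 0 A, ‖newtonGrad η z - newtonGrad 0 z‖) (𝓝[>] 0)
      (𝓝 (∫ z in ball (0 : ℂ) A, (0 : ℝ))) := by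
    refine tendsto_integral_filter_of_dominated_convergence (fun z : ℂ => 2 * ‖z‖⁻¹)
      (Eventually.of_forall fun η => ?_) (Eventually.of_forall fun η => Eventually.of_forall
        fun z => ?_) ((integrableOn_inv_norm A).const_mul 2) (Eventually.of_forall fun z => ?_)
    · exact ((measurable_newtonGrad η).sub (measurable_newtonGrad 0)).norm.aestronglyMeasurable
    · rw [norm_norm]
      linarith [norm_sub_le (newtonGrad η z) (newtonGrad 0 z), norm_newtonGrad_le η z,
        norm_newtonGrad_le 0 z]
    · simpa using ((tendsto_newtonGrad z).sub_const (newtonGrad 0 z)).norm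
  simpa using h

/-- The regularised logarithm `½ log (‖z‖² + η²)`. -/
def regLog (η : ℝ) (z : ℂ) : ℝ := Real.log (‖z‖ ^ 2 + η ^ 2) / 2

lemma regLog_zero (z : ℂ) : regLog 0 z = Real.log ‖z‖ := by
  simp [regLog, Real.log_pow]

lemma hasFDerivAt_regLog {η : ℝ} (hη : 0 < η) (z : ℂ) :
    HasFDerivAt (regLog η) (newtonGrad η z) z := by
  have h1 : HasFDerivAt (fun z : ℂ => ‖z‖ ^ 2 + η ^ 2) ((2 : ℝ) • innerSL ℝ z) z := by
    have := (hasStrictFDerivAt_norm_sq (F := ℂ) z).hasFDerivAt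
    rw [ofNat_smul_eq_nsmul ℝ 2]
    exact this.add_const (η ^ 2)
  have h2 := (h1.log (by positivity)).mul_const (2⁻¹ : ℝ)
  have e : (fun z : ℂ => Real.log (‖z‖ ^ 2 + η ^ 2) * (2⁻¹ : ℝ)) = regLog η := by
    ext z; simp [regLog, div_eq_mul_inv]
  rw [e] at h2
  have e' : newtonGrad η z =
      (2⁻¹ : ℝ) • (‖z‖ ^ 2 + η ^ 2)⁻¹ • (2 : ℝ) • innerSL ℝ z := by
    simp only [newtonGrad, smul_smul]
    congr 1
    ring
  rw [e']
  exact h2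

lemma norm_regLog_le {η : ℝ} (hη : η ^ 2 ≤ 1) {z : ℂ} (hz : z ≠ 0) :
    ‖regLog η z‖ ≤ ‖z‖⁻¹ + (‖z‖ ^ 2 + 1) := by
  have hz : 0 < ‖z‖ := norm_pos_iff.2 hz
  rw [Real.norm_eq_abs, abs_le, regLog]
  constructor
  · have h1 : Real.log (‖z‖ ^ 2) ≤ Real.log (‖z‖ ^ 2 + η ^ 2) :=
      Real.log_le_log (by positivity) (by nlinarith)
    have h2 := Real.log_le_sub_one_of_pos (inv_pos.2 hz)
    rw [Real.log_inv] at h2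
    rw [Real.log_pow] at h1
    push_cast at h1
    have : 0 ≤ ‖z‖ ^ 2 := by positivity
    linarith
  · have h1 := Real.log_le_sub_one_of_pos (show 0 < ‖z‖ ^ 2 + η ^ 2 by positivity)
    have : 0 < ‖z‖⁻¹ := inv_pos.2 hz
    nlinarith

lemma integrableOn_regLog_bound (A : ℝ) :
    IntegrableOn (fun z : ℂ => ‖z‖⁻¹ + (‖z‖ ^ 2 + 1)) (ball 0 A) := by
  refine (integrableOn_inv_norm A).add ?_
  have : Continuous fun z : ℂ => ‖z‖ ^ 2 + 1 := by fun_prop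
  exact (this.continuousOn.integrableOn_compact (isCompact_closedBall 0 A)).mono_set
    ball_subset_closedBall

lemma measurable_regLog (η : ℝ) : Measurable (regLog η) := by
  unfold regLog
  fun_prop

lemma integrableOn_regLog {η : ℝ} (hη : η ^ 2 ≤ 1) (A : ℝ) :
    IntegrableOn (regLog η) (ball 0 A) := by
  refine (integrableOn_regLog_bound A).mono' (measurable_regLog η).aestronglyMeasurable ?_
  have : ∀ᵐ z : ℂ, z ≠ 0 := by simp [ae_iff]
  filter_upwards [ae_restrict_of_ae this] with z hz using norm_regLog_le hη hz

lemma tendsto_regLog {z : ℂ} (hz : z ≠ 0) :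
    Tendsto (fun η => regLog η z) (𝓝[>] 0) (𝓝 (regLog 0 z)) := by
  have : ‖z‖ ^ 2 + 0 ^ 2 ≠ 0 := by simpa using hz
  have h : ContinuousAt (fun η : ℝ => regLog η z) 0 := by
    unfold regLog
    have h : ContinuousAt (fun η : ℝ => Real.log (‖z‖ ^ 2 + η ^ 2)) 0 :=
      ContinuousAt.log (by fun_prop) this
    exact h.div_const 2
  exact h.tendsto.mono_left nhdsWithin_le_nhds

/-- The logarithmic potential of a density `q`. -/
def logPotential (q : ℂ → ℝ) (a : ℂ) : ℝ := ∫ ζ, q ζ * Real.log ‖a - ζ‖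

/-- The gradient of the logarithmic potential of a density `q`. -/
def logPotentialGrad (q : ℂ → ℝ) (a : ℂ) : ℂ →L[ℝ] ℝ := ∫ ζ, q ζ • newtonGrad 0 (a - ζ)

section
variable {q : ℂ → ℝ} {M R : ℝ}

lemma IsBddDensity.integrable (hq : IsBddDensity q M R) : Integrable q := by
  have : Integrable (fun ζ => q ζ • (1 : ℝ)) :=
    hq.integrable_smul (k := fun _ => (1 : ℝ)) (fun A => integrableOn_const) 0
  simpa using this

lemma IsBddDensity.hasFDerivAt_regLog_integral (hq : IsBddDensity q M R) {η : ℝ} (hη : 0 < η)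
    (hη1 : η ^ 2 ≤ 1) (a : ℂ) :
    HasFDerivAt (fun a => ∫ ζ, q ζ • regLog η (a - ζ)) (∫ ζ, q ζ • newtonGrad η (a - ζ)) a := by
  refine hasFDerivAt_integral_of_dominated_of_fderiv_le (𝕜 := ℝ) (s := univ)
    (F' := fun a ζ => q ζ • newtonGrad η (a - ζ)) (bound := fun ζ => ‖q ζ‖ * η⁻¹)
    univ_mem (Eventually.of_forall fun x => ?_) ?_ ?_ ?_ ?_ ?_
  · exact hq.meas.smul ((measurable_regLog η).comp (measurable_const.sub
      measurable_id)).aestronglyMeasurable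
  · exact hq.integrable_smul (fun A => integrableOn_regLog hη1 A) a
  · exact (hq.integrable_smul (fun A => integrableOn_newtonGrad η A) a).aestronglyMeasurable
  · refine Eventually.of_forall fun ζ x _ => ?_
    rw [norm_smul]
    gcongr
    exact norm_newtonGrad_le_inv hη _
  · exact hq.integrable.norm.mul_const _
  · refine Eventually.of_forall fun ζ x _ => ?_
    have := (hasFDerivAt_regLog hη (x - ζ)).comp x ((hasFDerivAt_id x).sub_const ζ)
    exact this.const_smul (q ζ)

lemma IsBddDensity.continuous_newtonGrad_integral (hq : IsBddDensity q M R) {η : ℝ} (hη : 0 < η) :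
    Continuous fun a => ∫ ζ, q ζ • newtonGrad η (a - ζ) := by
  refine continuous_of_dominated (bound := fun ζ => ‖q ζ‖ * η⁻¹) (fun a => ?_) (fun a => ?_) ?_ ?_
  · exact (hq.integrable_smul (fun A => integrableOn_newtonGrad η A) a).aestronglyMeasurable
  · refine Eventually.of_forall fun ζ => ?_
    rw [norm_smul]
    gcongr
    exact norm_newtonGrad_le_inv hη _
  · exact hq.integrable.norm.mul_const _
  · refine Eventually.of_forall fun ζ => ?_
    exact ((continuous_newtonGrad hη).comp (continuous_id.sub continuous_const)).const_smul (q ζ)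

lemma IsBddDensity.tendstoLocallyUniformlyOn_newtonGrad (hq : IsBddDensity q M R) :
    TendstoLocallyUniformly (fun η a => ∫ ζ, q ζ • newtonGrad η (a - ζ)) (logPotentialGrad q)
      (𝓝[>] 0) := by
  rw [Metric.tendstoLocallyUniformly_iff]
  intro ε hε a
  refine ⟨ball a 1, ball_mem_nhds a one_pos, ?_⟩
  set A := R + (‖a‖ + 1) with hA
  have h := (tendsto_integral_newtonGrad_sub A).const_mul M
  rw [mul_zero] at h
  filter_upwards [h.eventually (gt_mem_nhds hε)] with η hη b hb
  have hb' : R + ‖b‖ ≤ A := by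
    have : ‖b - a‖ < 1 := by simpa [dist_eq_norm] using hb
    have := norm_le_norm_add_norm_sub' b a
    linarith [norm_sub_rev b a]
  have hi : ∀ A, IntegrableOn (fun z => newtonGrad η z - newtonGrad 0 z) (ball 0 A) := fun A =>
    (integrableOn_newtonGrad η A).sub (integrableOn_newtonGrad 0 A)
  refine lt_of_le_of_lt ?_ hη
  rw [dist_comm, dist_eq_norm, logPotentialGrad, ← integral_sub
    (hq.integrable_smul (fun A => integrableOn_newtonGrad η A) b)
    (hq.integrable_smul (fun A => integrableOn_newtonGrad 0 A) b)]
  simp_rw [← smul_sub]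
  exact hq.norm_integral_smul_le hi hb'

lemma IsBddDensity.continuous_logPotentialGrad (hq : IsBddDensity q M R) :
    Continuous (logPotentialGrad q) := by
  refine hq.tendstoLocallyUniformlyOn_newtonGrad.continuous (Eventually.frequently ?_)
  filter_upwards [self_mem_nhdsWithin] with η hη using hq.continuous_newtonGrad_integral hη

lemma IsBddDensity.tendsto_logPotential (hq : IsBddDensity q M R) (a : ℂ) :
    Tendsto (fun η => ∫ ζ, q ζ • regLog η (a - ζ)) (𝓝[>] 0) (𝓝 (logPotential q a)) := by
  have e : logPotential q a = ∫ ζ, q ζ • regLog 0 (a - ζ) := by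
    simp [logPotential, regLog_zero]
  have h0 : ∀ᵐ ζ : ℂ, ζ ≠ a := by simp [ae_iff]
  have hev : ∀ᶠ η : ℝ in 𝓝[>] 0, η ^ 2 ≤ 1 := by
    filter_upwards [Ioo_mem_nhdsGT (zero_lt_one (α := ℝ))] with η hη
    nlinarith [hη.1, hη.2]
  rw [e]
  refine tendsto_integral_filter_of_dominated_convergence
    (fun ζ => ‖q ζ • (‖a - ζ‖⁻¹ + (‖a - ζ‖ ^ 2 + 1))‖) (Eventually.of_forall fun η => ?_)
    ?_ ?_ ?_
  · exact hq.meas.smul ((measurable_regLog η).comp (measurable_const.sub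
      measurable_id)).aestronglyMeasurable
  · filter_upwards [hev] with η hη
    filter_upwards [h0] with ζ hζ
    rw [norm_smul, norm_smul]
    gcongr
    exact (norm_regLog_le hη (sub_ne_zero.2 hζ.symm)).trans (le_abs_self _)
  · exact (hq.integrable_smul (fun A => integrableOn_regLog_bound A) a).norm
  · filter_upwards [h0] with ζ hζ
    exact (tendsto_regLog (sub_ne_zero.2 hζ.symm)).const_smul (q ζ)

lemma IsBddDensity.hasFDerivAt_logPotential (hq : IsBddDensity q M R) (a : ℂ) :
    HasFDerivAt (logPotential q) (logPotentialGrad q a) a := by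
  have hl := hq.tendstoLocallyUniformlyOn_newtonGrad
  have hev : ∀ᶠ η : ℝ in 𝓝[>] 0, 0 < η ∧ η ^ 2 ≤ 1 := by
    filter_upwards [Ioo_mem_nhdsGT (zero_lt_one (α := ℝ))] with η hη
    exact ⟨hη.1, by nlinarith [hη.1, hη.2]⟩
  refine hasFDerivAt_of_tendstoUniformlyOnFilter (l := 𝓝[>] (0 : ℝ))
    (f := fun η a => ∫ ζ, q ζ • regLog η (a - ζ))
    (f' := fun η a => ∫ ζ, q ζ • newtonGrad η (a - ζ)) ?_ ?_ ?_
  · exact tendstoLocallyUniformly_iff_filter.1 hl a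
  · filter_upwards [(hev.prod_inl (𝓝 a))] with p hp
    exact hq.hasFDerivAt_regLog_integral hp.1 hp.2 p.2
  · exact Eventually.of_forall fun y => hq.tendsto_logPotential y

lemma IsBddDensity.contDiff_logPotential (hq : IsBddDensity q M R) :
    ContDiff ℝ 1 (logPotential q) := by
  rw [contDiff_one_iff_fderiv]
  refine ⟨fun a => (hq.hasFDerivAt_logPotential a).differentiableAt, ?_⟩
  rw [show fderiv ℝ (logPotential q) = logPotentialGrad q from
    funext fun a => (hq.hasFDerivAt_logPotential a).fderiv]
  exact hq.continuous_logPotentialGrad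

end

lemma laplacian_apply_eq_fderiv (u : ℂ → ℝ) (a : ℂ) :
    Δ u a = fderiv ℝ (fderiv ℝ u) a 1 1 + fderiv ℝ (fderiv ℝ u) a Complex.I Complex.I := by
  rw [laplacian_eq_iteratedFDeriv_complexPlane]
  simp [iteratedFDeriv_two_apply]

lemma exists_isBddDensity {q : ℂ → ℝ} (hq : Continuous q) (hc : HasCompactSupport q) :
    ∃ M R, IsBddDensity q M R := by
  obtain ⟨M, hM⟩ := hq.bounded_above_of_compact_support hc
  obtain ⟨R, hR⟩ := hc.isCompact.isBounded.subset_ball 0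
  refine ⟨M, R, hq.aestronglyMeasurable, hM, fun z hz => ?_⟩
  refine image_eq_zero_of_notMem_tsupport fun h => ?_
  have := hR h
  rw [mem_ball_zero_iff] at this
  linarith

lemma locallyIntegrable_log_norm : LocallyIntegrable (fun z : ℂ => Real.log ‖z‖) := by
  intro z
  refine ⟨ball 0 (‖z‖ + 1), isOpen_ball.mem_nhds (by simp), ?_⟩
  have := integrableOn_regLog (η := 0) (by simp) (‖z‖ + 1)
  simpa only [regLog_zero, funext regLog_zero] using this

lemma logPotential_eq_convolution (q : ℂ → ℝ) :
    logPotential q = convolution (fun z : ℂ => Real.log ‖z‖) q (ContinuousLinearMap.mul ℝ ℝ)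
      volume := by
  ext a
  rw [logPotential, convolution,
    ← integral_sub_left_eq_self (fun t => ContinuousLinearMap.mul ℝ ℝ (Real.log ‖t‖) (q (a - t)))
      volume a]
  simp [mul_comm]

section
variable {q : ℂ → ℝ}

lemma fderiv_logPotential_apply (hq : ContDiff ℝ 1 q) (hc : HasCompactSupport q) (a v : ℂ) :
    fderiv ℝ (logPotential q) a v = logPotential (fun ζ => fderiv ℝ q ζ v) a := by
  have h := hc.hasFDerivAt_convolution_right (ContinuousLinearMap.mul ℝ ℝ)
    locallyIntegrable_log_norm hq a
  rw [logPotential_eq_convolution, h.fderiv,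
    convolution_precompR_apply _ locallyIntegrable_log_norm (hc.fderiv ℝ)
      (hq.continuous_fderiv one_ne_zero), logPotential_eq_convolution]

lemma exists_isBddDensity_fderiv (hq : ContDiff ℝ 1 q) (hc : HasCompactSupport q) (v : ℂ) :
    ∃ M R, IsBddDensity (fun ζ => fderiv ℝ q ζ v) M R :=
  exists_isBddDensity ((hq.continuous_fderiv one_ne_zero).clm_apply continuous_const)
    (hc.fderiv_apply ℝ v)

lemma contDiff_two_logPotential (hq : ContDiff ℝ 1 q) (hc : HasCompactSupport q) :
    ContDiff ℝ 2 (logPotential q) := by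
  obtain ⟨M, R, hd⟩ := exists_isBddDensity hq.continuous hc
  rw [show (2 : WithTop ℕ∞) = 1 + 1 by norm_num, contDiff_succ_iff_fderiv]
  refine ⟨fun a => (hd.hasFDerivAt_logPotential a).differentiableAt, by simp, ?_⟩
  rw [contDiff_clm_apply_iff]
  intro v
  obtain ⟨M, R, hd⟩ := exists_isBddDensity_fderiv hq hc v
  simp_rw [fderiv_logPotential_apply hq hc]
  exact hd.contDiff_logPotential

lemma fderiv_fderiv_logPotential (hq : ContDiff ℝ 1 q) (hc : HasCompactSupport q) (a v w : ℂ) :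
    fderiv ℝ (fderiv ℝ (logPotential q)) a w v =
      ∫ ζ, fderiv ℝ q ζ v * newtonGrad 0 (a - ζ) w := by
  obtain ⟨M, R, hd⟩ := exists_isBddDensity_fderiv hq hc v
  have h1 : DifferentiableAt ℝ (fderiv ℝ (logPotential q)) a :=
    ((contDiff_two_logPotential hq hc).fderiv_right (m := 1) (by norm_num)).differentiable
      one_ne_zero a
  have h2 : fderiv ℝ (fun x => fderiv ℝ (logPotential q) x v) a w =
      fderiv ℝ (fderiv ℝ (logPotential q)) a w v := by
    rw [fderiv_clm_apply h1 (differentiableAt_const v)]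
    simp
  rw [← h2]
  simp_rw [fderiv_logPotential_apply hq hc]
  rw [(hd.hasFDerivAt_logPotential a).fderiv, logPotentialGrad,
    ContinuousLinearMap.integral_apply (hd.integrable_smul (integrableOn_newtonGrad 0) a)]
  simp

lemma laplacian_logPotential_eq_integral (hq : ContDiff ℝ 1 q) (hc : HasCompactSupport q)
    (a : ℂ) :
    Δ (logPotential q) a = ∫ y : ℂ, (‖y‖ ^ 2)⁻¹ * fderiv ℝ q (a - y) y := by
  have hinteg : ∀ v, Integrable fun ζ => fderiv ℝ q ζ v * newtonGrad 0 (a - ζ) v := by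
    intro v
    obtain ⟨M, R, hd⟩ := exists_isBddDensity_fderiv hq hc v
    have := (hd.integrable_smul (integrableOn_newtonGrad 0) a).apply_continuousLinearMap v
    simpa using this
  rw [laplacian_apply_eq_fderiv, fderiv_fderiv_logPotential hq hc,
    fderiv_fderiv_logPotential hq hc, ← integral_add (hinteg 1) (hinteg Complex.I),
    ← integral_sub_left_eq_self _ volume a]
  refine integral_congr_ae (Eventually.of_forall fun y => ?_)
  have hy : fderiv ℝ q (a - y) y =
      y.re * fderiv ℝ q (a - y) 1 + y.im * fderiv ℝ q (a - y) Complex.I := by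
    conv_lhs => rw [show y = y.re • (1 : ℂ) + y.im • Complex.I by simp [Complex.re_add_im]]
    rw [map_add, map_smul, map_smul]
    simp [Complex.re_add_im]
  simp only [hy, newtonGrad]
  simp [Complex.inner]
  ring

lemma integral_inv_sq_mul_fderiv (hq : ContDiff ℝ 1 q) (hc : HasCompactSupport q) (a : ℂ) :
    ∫ y : ℂ, (‖y‖ ^ 2)⁻¹ * fderiv ℝ q (a - y) y = 2 * π * q a := by
  set e : ℝ → ℂ := fun θ => (Real.cos θ + Real.sin θ * Complex.I : ℂ) with he
  have hen : ∀ θ, ‖e θ‖ = 1 := fun θ => by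
    have := Complex.norm_exp_ofReal_mul_I θ
    rwa [Complex.exp_mul_I, ← Complex.ofReal_cos, ← Complex.ofReal_sin] at this
  have hec : Continuous e := by fun_prop
  set F : ℝ × ℝ → ℝ := fun p => fderiv ℝ q (a - p.1 * e p.2) (e p.2) with hF
  have hFc : Continuous F := by
    have h1 : Continuous fun p : ℝ × ℝ => a - p.1 * e p.2 := by fun_prop
    exact ((hq.continuous_fderiv one_ne_zero).comp h1).clm_apply (hec.comp continuous_snd)
  obtain ⟨R, hR⟩ := (hc.fderiv ℝ).isCompact.isBounded.subset_ball a
  have hF0 : ∀ p : ℝ × ℝ, R ≤ p.1 → F p = 0 := by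
    intro p hp
    have : fderiv ℝ q (a - p.1 * e p.2) = 0 := by
      refine image_eq_zero_of_notMem_tsupport fun h => ?_
      have := hR h
      rw [mem_ball, dist_eq_norm] at this
      simp [hen] at this
      linarith [le_abs_self p.1]
    simp [hF, this]
  have hFi : IntegrableOn F (Ioi 0 ×ˢ Ioo (-π) π) := by
    have h1 : IntegrableOn F (Icc 0 R ×ˢ Icc (-π) π) :=
      hFc.continuousOn.integrableOn_compact (isCompact_Icc.prod isCompact_Icc)
    refine h1.of_forall_sdiff_eq_zero (measurableSet_Ioi.prod measurableSet_Ioo) ?_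
    rintro ⟨r, θ⟩ ⟨⟨hr, hθ⟩, hn⟩
    refine hF0 _ ?_
    by_contra! hlt
    exact hn ⟨⟨le_of_lt hr, hlt.le⟩, Ioo_subset_Icc_self hθ⟩
  rw [← Complex.integral_comp_polarCoord_symm]
  have h1 : ∫ p in polarCoord.target, p.1 • ((‖Complex.polarCoord.symm p‖ ^ 2)⁻¹ *
      fderiv ℝ q (a - Complex.polarCoord.symm p) (Complex.polarCoord.symm p)) =
      ∫ p in Ioi 0 ×ˢ Ioo (-π) π, F p := by
    refine setIntegral_congr_fun (measurableSet_Ioi.prod measurableSet_Ioo) fun p hp => ?_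
    have hp0 : 0 < p.1 := hp.1
    have h2 : Complex.polarCoord.symm p = p.1 • e p.2 := by simp [he, mul_add]
    simp only [h2]
    rw [map_smul, norm_smul, hen, Real.norm_of_nonneg hp0.le]
    simp only [hF, smul_eq_mul, Complex.real_smul]
    field_simp
  rw [Measure.volume_eq_prod] at hFi h1
  rw [Measure.volume_eq_prod, h1, ← setIntegral_prod_swap,
    setIntegral_prod (fun z : ℝ × ℝ => F z.swap) hFi.swap]
  have h3 : ∀ θ, ∫ r in Ioi (0 : ℝ), F (r, θ) = q a := by
    intro θ
    set p : ℝ → ℝ := fun r => -q (a - r * e θ) with hp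
    have hline : ∀ r : ℝ, HasDerivAt (fun r : ℝ => a - r * e θ) (-e θ) r := fun r => by
      simpa using ((Complex.ofRealCLM.hasDerivAt (x := r)).mul_const (e θ)).const_sub a
    have hd : ∀ r, HasDerivAt p (F (r, θ)) r := by
      intro r
      have : HasDerivAt p (-(fderiv ℝ q (a - r * e θ) (-e θ))) r :=
        ((hq.differentiable one_ne_zero (a - r * e θ)).hasFDerivAt.comp_hasDerivAt r
          (hline r)).neg
      rwa [map_neg, neg_neg] at this
    obtain ⟨R', hR'⟩ := hc.isCompact.isBounded.subset_ball a
    have hlim : Tendsto p atTop (𝓝 0) := by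
      refine tendsto_const_nhds.congr' ?_
      filter_upwards [eventually_ge_atTop R'] with r hr
      have h0 : q (a - r * e θ) = 0 := by
        refine image_eq_zero_of_notMem_tsupport fun h => ?_
        have := hR' h
        rw [mem_ball, dist_eq_norm] at this
        simp [hen] at this
        linarith [le_abs_self r]
      simp [hp, h0]
    have hi : IntegrableOn (fun r => F (r, θ)) (Ioi 0) := by
      have hcont : Continuous fun r => F (r, θ) := by fun_prop
      refine (hcont.continuousOn.integrableOn_compact (isCompact_Icc (a := 0) (b := R))
        ).of_forall_sdiff_eq_zero measurableSet_Ioi ?_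
      rintro r ⟨hr, hn⟩
      refine hF0 _ ?_
      by_contra! hlt
      exact hn ⟨le_of_lt hr, hlt.le⟩
    rw [integral_Ioi_of_hasDerivAt_of_tendsto' (fun r _ => hd r) hi hlim]
    simp [hp]
  simp only [Prod.swap_prod_mk, h3]
  rw [setIntegral_const, Real.volume_real_Ioo_of_le (by linarith [pi_pos]), smul_eq_mul]
  ring

lemma laplacian_logPotential (hq : ContDiff ℝ 1 q) (hc : HasCompactSupport q) (a : ℂ) :
    Δ (logPotential q) a = 2 * π * q a := by
  rw [laplacian_logPotential_eq_integral hq hc, integral_inv_sq_mul_fderiv hq hc]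

end

section LogFamily

variable {q : ℂ → ℝ} {c : ℂ → ℂ} {M : ℝ} {a₀ a : ℂ}

lemma norm_mul_sub_lt_one (hM : 0 < M) (hc : ∀ ζ, ‖c ζ‖ ≤ M) {r : ℝ} (ha : a ∈ ball a₀ r)
    (ζ : ℂ) : ‖c ζ * (a - a₀)‖ ≤ M * r := by
  rw [mem_ball, dist_eq_norm] at ha
  rw [norm_mul]
  exact mul_le_mul (hc ζ) ha.le (norm_nonneg _) hM.le

lemma integrable_mul_log_one_sub (hq : Integrable q) (hcm : Measurable c) (hM : 0 < M)
    (hc : ∀ ζ, ‖c ζ‖ ≤ M) (ha : a ∈ ball a₀ M⁻¹) :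
    Integrable fun ζ => (q ζ : ℂ) * Complex.log (1 - c ζ * (a - a₀)) := by
  obtain ⟨r, hr, hrM⟩ := exists_between (mem_ball.1 ha)
  have hlt : M * r < 1 := by
    rw [lt_inv_comm₀ (dist_nonneg.trans_lt hr) hM] at hrM
    have := mul_lt_mul_of_pos_right hrM (dist_nonneg.trans_lt hr)
    rwa [inv_mul_cancel₀ (dist_nonneg.trans_lt hr).ne'] at this
  have hr0 : 0 < r := dist_nonneg.trans_lt hr
  refine hq.ofReal.mul_bdd (c := (M * r) ^ 2 * (1 - M * r)⁻¹ / 2 + M * r) ?_ ?_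
  · exact (Measurable.clog (by fun_prop)).aestronglyMeasurable
  · refine Eventually.of_forall fun ζ => ?_
    have h1 := norm_mul_sub_lt_one hM hc (mem_ball.2 hr) ζ
    have h2 := Complex.norm_log_one_add_le (z := -(c ζ * (a - a₀))) (by
      rw [norm_neg]; exact h1.trans_lt hlt)
    rw [← sub_eq_add_neg, norm_neg] at h2
    refine h2.trans ?_
    have : 0 < 1 - M * r := by linarith
    gcongr
    exact inv_nonneg.2 (by linarith)

lemma harmonicAt_integral_log_one_sub (hq : Integrable q) (hcm : Measurable c) (hM : 0 < M)
    (hc : ∀ ζ, ‖c ζ‖ ≤ M) (ha : a ∈ ball a₀ M⁻¹) :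
    HarmonicAt (fun a => ∫ ζ, q ζ * Real.log ‖1 - c ζ * (a - a₀)‖) a := by
  set F : ℂ → ℂ := fun a => ∫ ζ, (q ζ : ℂ) * Complex.log (1 - c ζ * (a - a₀)) with hF
  have hd : DifferentiableOn ℂ F (ball a₀ M⁻¹) := by
    intro b hb
    refine DifferentiableAt.differentiableWithinAt ?_
    obtain ⟨r, hr, hrM⟩ := exists_between (mem_ball.1 hb)
    have hr0 : 0 < r := dist_nonneg.trans_lt hr
    have hlt : M * r < 1 := by
      rw [lt_inv_comm₀ hr0 hM] at hrM
      have := mul_lt_mul_of_pos_right hrM hr0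
      rwa [inv_mul_cancel₀ hr0.ne'] at this
    refine (hasDerivAt_integral_of_dominated_loc_of_deriv_le (𝕜 := ℂ) (s := ball a₀ r)
      (F' := fun x ζ => (q ζ : ℂ) * (-c ζ / (1 - c ζ * (x - a₀))))
      (bound := fun ζ => ‖q ζ‖ * (M / (1 - M * r)))
      (isOpen_ball.mem_nhds (mem_ball.2 hr)) ?_
      (integrable_mul_log_one_sub hq hcm hM hc hb) ?_ ?_ (hq.norm.mul_const _)
      ?_).2.differentiableAt
    · filter_upwards [isOpen_ball.mem_nhds hb] with x hx
      exact (integrable_mul_log_one_sub hq hcm hM hc hx).aestronglyMeasurable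
    · exact hq.ofReal.aestronglyMeasurable.mul
        (Measurable.aestronglyMeasurable (by fun_prop))
    · refine Eventually.of_forall fun ζ x hx => ?_
      have h1 := norm_mul_sub_lt_one hM hc hx ζ
      rw [norm_mul, Complex.norm_real, norm_div, norm_neg]
      have h2 : 1 - M * r ≤ ‖1 - c ζ * (x - a₀)‖ := by
        have := norm_sub_norm_le (1 : ℂ) (c ζ * (x - a₀))
        rw [norm_one] at this
        linarith
      have : 0 < 1 - M * r := by linarith
      gcongr
      exact hc ζ
    · refine Eventually.of_forall fun ζ x hx => ?_
      have h1 := (norm_mul_sub_lt_one hM hc hx ζ).trans_lt hlt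
      have hs : 1 - c ζ * (x - a₀) ∈ Complex.slitPlane := by
        rw [sub_eq_add_neg]
        exact Complex.mem_slitPlane_of_norm_lt_one (by rwa [norm_neg])
      have h2 : HasDerivAt (fun x => 1 - c ζ * (x - a₀)) (-c ζ) x := by
        simpa using (((hasDerivAt_id x).sub_const a₀).const_mul (c ζ)).const_sub 1
      exact (h2.clog hs).const_mul _
  have h := (hd.analyticAt (isOpen_ball.mem_nhds ha)).harmonicAt_re
  refine (harmonicAt_congr_nhds ?_).1 h
  filter_upwards [isOpen_ball.mem_nhds ha] with x hx
  have := integral_re (integrable_mul_log_one_sub hq hcm hM hc hx)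
  simp only [RCLike.re_to_complex] at this
  rw [hF, ← this]
  simp [Complex.log_re]

lemma integrable_mul_log_norm_one_sub (hq : Integrable q) (hcm : Measurable c) (hM : 0 < M)
    (hc : ∀ ζ, ‖c ζ‖ ≤ M) (ha : a ∈ ball a₀ M⁻¹) :
    Integrable fun ζ => q ζ * Real.log ‖1 - c ζ * (a - a₀)‖ := by
  have := (integrable_mul_log_one_sub hq hcm hM hc ha).re
  simpa [Complex.log_re] using this

end LogFamily

/-- An integrable density supported in the unit disc and locally bounded there. -/
structure IsDiscDensity (q : ℂ → ℝ) : Prop where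
  integrable : Integrable q
  supp : ∀ z ∉ ball (0 : ℂ) 1, q z = 0
  locBdd : ∀ r < 1, ∃ M, ∀ z ∈ closedBall (0 : ℂ) r, ‖q z‖ ≤ M

/-- Green's function of the unit disc, up to the factor `2π`. -/
def discGreen (a ζ : ℂ) : ℝ := Real.log ‖1 - conj ζ * a‖ - Real.log ‖a - ζ‖

/-- The Green potential of a density on the unit disc, up to the factor `2π`. -/
def discPotential (q : ℂ → ℝ) (a : ℂ) : ℝ := ∫ ζ, q ζ * discGreen a ζ

lemma IsDiscDensity.exists_decomposition {q : ℂ → ℝ} (hq : IsDiscDensity q) {a₀ : ℂ}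
    (ha₀ : a₀ ∈ ball (0 : ℂ) 1) :
    ∃ (χ : ContDiffBump a₀) (h : ℂ → ℝ), tsupport χ ⊆ ball 0 1 ∧ HarmonicAt h a₀ ∧
      (∃ M R, IsBddDensity (fun z => χ z * q z) M R) ∧
      discPotential q =ᶠ[𝓝 a₀] fun a => h a - logPotential (fun z => χ z * q z) a := by
  obtain ⟨δ, hδ, hδ1⟩ : ∃ δ, 0 < δ ∧ ‖a₀‖ + 2 * δ < 1 :=
    ⟨(1 - ‖a₀‖) / 3, by rw [mem_ball_zero_iff] at ha₀; linarith, by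
      rw [mem_ball_zero_iff] at ha₀; linarith⟩
  let χ : ContDiffBump a₀ := ⟨δ, 2 * δ, hδ, by linarith⟩
  have hsub : closedBall a₀ (2 * δ) ⊆ closedBall 0 (‖a₀‖ + 2 * δ) := by
    intro z hz
    rw [mem_closedBall, dist_eq_norm] at hz
    rw [mem_closedBall_zero_iff]
    linarith [norm_le_norm_add_norm_sub' z a₀]
  have hts : tsupport χ = closedBall a₀ (2 * δ) := χ.tsupport_eq
  obtain ⟨M, hM⟩ := hq.locBdd _ hδ1
  have hq1 : IsBddDensity (fun z => χ z * q z) (max M 0) (‖a₀‖ + 2 * δ + 1) := by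
    refine ⟨χ.continuous.aestronglyMeasurable.mul hq.integrable.aestronglyMeasurable,
      fun z => ?_, fun z hz => ?_⟩
    · by_cases hz : z ∈ closedBall a₀ (2 * δ)
      · rw [norm_mul, Real.norm_of_nonneg χ.nonneg]
        refine (mul_le_of_le_one_left (norm_nonneg _) χ.le_one).trans ((hM z (hsub hz)).trans
          (le_max_left _ _))
      · rw [← hts] at hz
        rw [image_eq_zero_of_notMem_tsupport hz]
        simp
    · have : z ∉ tsupport χ := by
        rw [hts]
        intro h
        have := hsub h
        rw [mem_closedBall_zero_iff] at this
        linarith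
      rw [image_eq_zero_of_notMem_tsupport this, zero_mul]
  set q₂ : ℂ → ℝ := fun z => q z - χ z * q z with hq₂
  have hq₂i : Integrable q₂ := hq.integrable.sub hq1.integrable
  have hq₂0 : ∀ z ∈ ball a₀ δ, q₂ z = 0 := fun z hz => by
    simp [hq₂, χ.one_of_mem_closedBall (ball_subset_closedBall hz)]
  have hq₂1 : ∀ z ∉ ball (0 : ℂ) 1, q₂ z = 0 := fun z hz => by simp [hq₂, hq.supp z hz]
  set c₁ : ℂ → ℂ := (ball (0 : ℂ) 1).indicator fun ζ => conj ζ with hc₁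
  set c₂ : ℂ → ℂ := (ball a₀ δ)ᶜ.indicator fun ζ => (ζ - a₀)⁻¹ with hc₂
  have hc₁m : Measurable c₁ :=
    (Complex.continuous_conj.measurable).indicator measurableSet_ball
  have hc₂m : Measurable c₂ := Measurable.indicator (by fun_prop) measurableSet_ball.compl
  have hc₁b : ∀ ζ, ‖c₁ ζ‖ ≤ 1 := fun ζ => by
    rw [hc₁]
    by_cases h : ζ ∈ ball (0 : ℂ) 1
    · rw [indicator_of_mem h, RCLike.norm_conj]
      exact (mem_ball_zero_iff.1 h).le
    · rw [indicator_of_notMem h]; simp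
  have hc₂b : ∀ ζ, ‖c₂ ζ‖ ≤ δ⁻¹ := fun ζ => by
    rw [hc₂]
    by_cases h : ζ ∈ (ball a₀ δ)ᶜ
    · rw [indicator_of_mem h, norm_inv]
      simp [dist_eq_norm] at h
      exact inv_anti₀ hδ h
    · rw [indicator_of_notMem h]; simp [hδ.le]
  have hball : a₀ ∈ ball (0 : ℂ) (1 : ℝ)⁻¹ := by simpa using ha₀
  have hball₂ : a₀ ∈ ball a₀ (δ⁻¹)⁻¹ := by simpa using hδ
  have hconst : Integrable fun ζ => q₂ ζ * Real.log ‖a₀ - ζ‖ := by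
    refine (hq₂i.norm.mul_const (|Real.log δ| + Real.log 2)).mono'
      (hq₂i.aestronglyMeasurable.mul (Measurable.aestronglyMeasurable (by fun_prop)))
      (Eventually.of_forall fun ζ => ?_)
    by_cases h1 : ζ ∈ ball a₀ δ
    · simp [hq₂0 ζ h1]
    by_cases h2 : ζ ∈ ball (0 : ℂ) 1
    · rw [norm_mul]
      gcongr
      rw [mem_ball, dist_comm, dist_eq_norm, not_lt] at h1
      rw [mem_ball_zero_iff] at h2 ha₀
      have h3 : ‖a₀ - ζ‖ ≤ 2 := by linarith [norm_sub_le a₀ ζ]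
      rw [Real.norm_eq_abs, abs_le]
      have h4 := Real.log_le_log hδ h1
      have h5 := Real.log_le_log (hδ.trans_le h1) h3
      have h6 := Real.log_nonneg one_le_two
      constructor <;> linarith [neg_abs_le (Real.log δ), abs_nonneg (Real.log δ)]
    · simp [hq₂1 ζ h2]
  refine ⟨χ, fun a => (∫ ζ, q ζ * Real.log ‖1 - c₁ ζ * (a - 0)‖) -
    ((∫ ζ, q₂ ζ * Real.log ‖a₀ - ζ‖) + ∫ ζ, q₂ ζ * Real.log ‖1 - c₂ ζ * (a - a₀)‖), ?_, ?_,
    ⟨_, _, hq1⟩, ?_⟩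
  · rw [hts]
    refine hsub.trans fun z hz => ?_
    rw [mem_closedBall_zero_iff] at hz
    rw [mem_ball_zero_iff]
    linarith
  · exact (harmonicAt_integral_log_one_sub hq.integrable hc₁m one_pos hc₁b hball).sub
      ((harmonicAt_const _).add
        (harmonicAt_integral_log_one_sub hq₂i hc₂m (inv_pos.2 hδ) hc₂b hball₂))
  · filter_upwards [isOpen_ball.mem_nhds hball, isOpen_ball.mem_nhds hball₂] with a ha1 ha2
    have i1 := integrable_mul_log_norm_one_sub hq.integrable hc₁m one_pos hc₁b ha1
    have i2 := integrable_mul_log_norm_one_sub hq₂i hc₂m (inv_pos.2 hδ) hc₂b ha2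
    have i3 : Integrable fun ζ => χ ζ * q ζ * Real.log ‖a - ζ‖ := by
      have := hq1.integrable_smul (integrableOn_regLog (η := 0) (by simp)) a
      simpa [regLog_zero] using this
    have i4 : Integrable fun ζ => q₂ ζ * Real.log ‖a₀ - ζ‖ +
        q₂ ζ * Real.log ‖1 - c₂ ζ * (a - a₀)‖ := hconst.add i2
    have i5 : Integrable fun ζ => q ζ * Real.log ‖1 - c₁ ζ * (a - 0)‖ -
        (q₂ ζ * Real.log ‖a₀ - ζ‖ + q₂ ζ * Real.log ‖1 - c₂ ζ * (a - a₀)‖) := i1.sub i4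
    rw [← integral_add hconst i2, ← integral_sub i1 i4, logPotential, ← integral_sub i5 i3,
      discPotential]
    refine integral_congr_ae (Eventually.of_forall fun ζ => ?_)
    have e1 : q ζ * Real.log ‖1 - conj ζ * a‖ = q ζ * Real.log ‖1 - c₁ ζ * (a - 0)‖ := by
      by_cases h : ζ ∈ ball (0 : ℂ) 1
      · rw [hc₁, indicator_of_mem h, sub_zero]
      · simp [hq.supp ζ h]
    have e2 : q₂ ζ * Real.log ‖a - ζ‖ =
        q₂ ζ * Real.log ‖a₀ - ζ‖ + q₂ ζ * Real.log ‖1 - c₂ ζ * (a - a₀)‖ := by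
      by_cases h : ζ ∈ ball a₀ δ
      · simp [hq₂0 ζ h]
      · rw [hc₂, indicator_of_mem (by exact h), ← mul_add]
        have hne : ζ - a₀ ≠ 0 := by
          intro h0
          rw [sub_eq_zero] at h0
          exact h (by simpa [h0] using hδ)
        rw [inv_inv] at ha2
        have hne' : a - ζ ≠ 0 := by
          intro h0
          rw [sub_eq_zero] at h0
          exact h (h0 ▸ ha2)
        have e : a - ζ = (a₀ - ζ) * (1 - (ζ - a₀)⁻¹ * (a - a₀)) := by
          field_simp
          ring
        have hne2 : a₀ - ζ ≠ 0 := by rw [← neg_sub]; exact neg_ne_zero.2 hne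
        have hne3 : (1 - (ζ - a₀)⁻¹ * (a - a₀)) ≠ 0 := by
          intro h0
          rw [h0, mul_zero] at e
          exact hne' e
        rw [e, norm_mul, Real.log_mul (norm_ne_zero_iff.2 hne2) (norm_ne_zero_iff.2 hne3)]
    have e3 : q₂ ζ = q ζ - χ ζ * q ζ := rfl
    simp only [discGreen]
    rw [mul_sub, e1, ← e2, e3]
    ring

lemma IsDiscDensity.contDiffAt_discPotential {q : ℂ → ℝ} (hq : IsDiscDensity q) {a : ℂ}
    (ha : a ∈ ball (0 : ℂ) 1) : ContDiffAt ℝ 1 (discPotential q) a := by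
  obtain ⟨χ, h, -, hh, ⟨M, R, hd⟩, he⟩ := hq.exists_decomposition ha
  exact ((hh.1.of_le (by norm_num)).sub hd.contDiff_logPotential.contDiffAt).congr_of_eventuallyEq he

lemma IsDiscDensity.contDiffAt_two_discPotential {q : ℂ → ℝ} (hq : IsDiscDensity q)
    (hc : ContDiffOn ℝ 1 q (ball 0 1)) {a : ℂ} (ha : a ∈ ball (0 : ℂ) 1) :
    ContDiffAt ℝ 2 (discPotential q) a ∧ Δ (discPotential q) a = -(2 * π * q a) := by
  obtain ⟨χ, h, hts, hh, -, he⟩ := hq.exists_decomposition ha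
  have hts' : tsupport (fun z => χ z * q z) ⊆ tsupport χ := tsupport_mul_subset_left
  have h1 : ContDiff ℝ 1 fun z => χ z * q z := by
    rw [contDiff_iff_contDiffAt]
    intro z
    by_cases hz : z ∈ tsupport fun z => χ z * q z
    swap
    · exact (contDiffAt_const (c := (0 : ℝ))).congr_of_eventuallyEq
        (notMem_tsupport_iff_eventuallyEq.1 hz)
    exact χ.contDiff.contDiffAt.mul
      (hc.contDiffAt (isOpen_ball.mem_nhds (hts (hts' hz))))
  have h2 : HasCompactSupport fun z => χ z * q z := χ.hasCompactSupport.mul_right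
  have h3 := (contDiff_two_logPotential h1 h2).contDiffAt (x := a)
  refine ⟨(hh.1.sub h3).congr_of_eventuallyEq he, ?_⟩
  rw [(laplacian_congr_nhds he).self_of_nhds]
  have h4 := hh.1.laplacian_sub h3
  rw [hh.2.self_of_nhds, laplacian_logPotential h1 h2] at h4
  refine h4.trans ?_
  simp [χ.one_of_mem_closedBall (mem_closedBall_self χ.rIn_pos.le)]

section HolomorphicChange

/-- The Laplacian transforms under a holomorphic change of variables by the conformal factor. -/
lemma laplacian_comp_holomorphic {V : ℂ → ℝ} {f : ℂ → ℂ} {z : ℂ} (hf : AnalyticAt ℂ f z)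
    (hV : ContDiffAt ℝ 2 V (f z)) :
    Δ (V ∘ f) z = ‖deriv f z‖ ^ 2 * Δ V (f z) := by
  have hfd : ∀ᶠ x in 𝓝 z, HasFDerivAt f (ContinuousLinearMap.mul ℝ ℂ (deriv f x)) x := by
    filter_upwards [hf.eventually_analyticAt] with x hx
    have h := hx.differentiableAt.hasDerivAt.complexToReal_fderiv
    have he : deriv f x • (1 : ℂ →L[ℝ] ℂ) = ContinuousLinearMap.mul ℝ ℂ (deriv f x) := by
      ext; simp
    rwa [he] at h
  have hVd : ∀ᶠ x in 𝓝 z, DifferentiableAt ℝ V (f x) := by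
    have h1 : ∀ᶠ y in 𝓝 (f z), ContDiffAt ℝ 2 V y := hV.eventually (by simp)
    filter_upwards [hf.continuousAt.eventually h1] with x hx
    exact hx.differentiableAt (by simp)
  have hfst : ∀ v : ℂ, (fun x => fderiv ℝ (V ∘ f) x v)
      =ᶠ[𝓝 z] fun x => fderiv ℝ V (f x) (deriv f x * v) := by
    intro v
    filter_upwards [hfd, hVd] with x h1 h2
    rw [(h2.hasFDerivAt.comp x h1).fderiv]
    simp
  have hfdd : HasFDerivAt (fderiv ℝ V) (fderiv ℝ (fderiv ℝ V) (f z)) (f z) :=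
    ((hV.fderiv_right (m := 1) (by norm_num)).differentiableAt (by simp)).hasFDerivAt
  have hd2 : HasFDerivAt (deriv f) (ContinuousLinearMap.mul ℝ ℂ (deriv (deriv f) z)) z := by
    have h := hf.deriv.differentiableAt.hasDerivAt.complexToReal_fderiv
    have he : deriv (deriv f) z • (1 : ℂ →L[ℝ] ℂ)
        = ContinuousLinearMap.mul ℝ ℂ (deriv (deriv f) z) := by
      ext; simp
    rwa [he] at h
  have hcomp : ContDiffAt ℝ 2 (V ∘ f) z := hV.comp z (hf.contDiffAt.restrict_scalars ℝ)
  have hcompd : DifferentiableAt ℝ (fderiv ℝ (V ∘ f)) z :=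
    (hcomp.fderiv_right (m := 1) (by norm_num)).differentiableAt (by simp)
  have hsnd : ∀ v : ℂ, fderiv ℝ (fderiv ℝ (V ∘ f)) z v v
      = fderiv ℝ V (f z) (deriv (deriv f) z * v * v)
        + fderiv ℝ (fderiv ℝ V) (f z) (deriv f z * v) (deriv f z * v) := by
    intro v
    have h1 : fderiv ℝ (fun x => fderiv ℝ (V ∘ f) x v) z v
        = fderiv ℝ (fderiv ℝ (V ∘ f)) z v v := by
      have := (hcompd.hasFDerivAt.clm_apply (hasFDerivAt_const v z)).fderiv
      rw [this]; simp
    have h2 := (hfdd.comp z hfd.self_of_nhds).clm_apply (hd2.mul_const v)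
    rw [← h1, (hfst v).fderiv_eq]
    have h3 := h2.fderiv
    simp only [Function.comp_apply] at h3
    rw [h3]
    simp [mul_comm]
  rw [laplacian_apply_eq_fderiv, laplacian_apply_eq_fderiv, hsnd, hsnd]
  generalize fderiv ℝ (fderiv ℝ V) (f z) = B
  have e1 : deriv f z * 1 = (deriv f z).re • (1 : ℂ) + (deriv f z).im • Complex.I := by
    apply Complex.ext <;> simp
  have e2 : deriv f z * Complex.I = (deriv f z).re • Complex.I - (deriv f z).im • (1 : ℂ) := by
    apply Complex.ext <;> simp
  have e3 : deriv (deriv f) z * Complex.I * Complex.I = -(deriv (deriv f) z * 1 * 1) := by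
    rw [mul_assoc, Complex.I_mul_I]; ring
  rw [e1, e2, e3, ← Complex.normSq_eq_norm_sq, Complex.normSq_apply]
  simp only [map_add, map_sub, map_neg, map_smul, add_apply,
    sub_apply, smul_apply, smul_eq_mul]
  ring

lemma abs_det_mul_complex (c : ℂ) : |(ContinuousLinearMap.mul ℝ ℂ c).det| = ‖c‖ ^ 2 := by
  have h : (ContinuousLinearMap.mul ℝ ℂ c).det = Algebra.norm ℝ c := by
    rw [Algebra.norm_apply]; rfl
  rw [h, Algebra.norm_complex_apply, abs_of_nonneg (Complex.normSq_nonneg c),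
    Complex.normSq_eq_norm_sq]

end HolomorphicChange

section DiscGreen

variable {U : Set ℂ} {f ψ : ℂ → ℂ} {a c z w : ℂ}

lemma discGreen_comm (a c : ℂ) : discGreen a c = discGreen c a := by
  have h : ‖1 - conj c * a‖ = ‖1 - conj a * c‖ := by
    rw [← Complex.norm_conj (1 - conj c * a)]
    simp [mul_comm]
  rw [discGreen, discGreen, h, norm_sub_rev a c]

lemma discGreen_eq_neg_log_mobius (ha : ‖a‖ < 1) (hc : ‖c‖ < 1) (hac : a ≠ c) :
    discGreen a c = -Real.log ‖mobius c a‖ := by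
  rw [discGreen, mobius, norm_div, Real.log_div]
  · ring
  · exact norm_ne_zero_iff.2 (sub_ne_zero.2 hac)
  · exact norm_ne_zero_iff.2 (one_sub_conj_mul_ne_zero hc ha.le)

lemma discGreen_nonneg (ha : ‖a‖ < 1) (hc : ‖c‖ < 1) (hac : a ≠ c) : 0 ≤ discGreen a c := by
  rw [discGreen_eq_neg_log_mobius ha hc hac]
  have := Real.log_nonpos (norm_nonneg _) (norm_mobius_lt_one hc ha).le
  linarith

lemma IsRiemannPair.norm_lt_one (h : IsRiemannPair U f ψ) (hz : z ∈ U) : ‖f z‖ < 1 := by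
  simpa using h.maps hz

lemma IsRiemannPair.apply_ne (h : IsRiemannPair U f ψ) (hz : z ∈ U) (hw : w ∈ U) (hzw : z ≠ w) :
    f z ≠ f w := fun he => hzw (by rw [← h.left_inv z hz, he, h.left_inv w hw])

lemma differentiableOn_mobius_neg (hc : ‖c‖ < 1) :
    DifferentiableOn ℂ (mobius (-c)) (ball 0 1) := fun x hx =>
  (hasDerivAt_mobius (a := -c) (by simpa using hc)
    (by simpa using hx)).differentiableAt.differentiableWithinAt

lemma IsRiemannPair.discGreen_le (h : IsRiemannPair U f ψ) {R : ℝ}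
    (hR : ∀ x ∈ U, ∀ y ∈ U, dist x y < R) (hz : z ∈ U) (hw : w ∈ U) (hzw : z ≠ w) :
    discGreen (f z) (f w) ≤ R * ‖z - w‖⁻¹ := by
  have hz1 := h.norm_lt_one hz
  have hw1 := h.norm_lt_one hw
  have hR0 : 0 < R := dist_nonneg.trans_lt (hR z hz w hw)
  have hdist : 0 < ‖z - w‖ := norm_pos_iff.2 (sub_ne_zero.2 hzw)
  set m := mobius (f w) (f z) with hm
  have hm1 : ‖m‖ < 1 := norm_mobius_lt_one hw1 hz1
  have hmaps : MapsTo (mobius (-f w)) (ball 0 1) (ball 0 1) := fun x hx => by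
    have := norm_mobius_lt_one (a := -f w) (z := x) (by simpa using hw1) (by simpa using hx)
    simpa using this
  have hd : DifferentiableOn ℂ (ψ ∘ mobius (-f w)) (ball 0 1) :=
    h.diff_inv.comp (differentiableOn_mobius_neg hw1) hmaps
  have h0 : (ψ ∘ mobius (-f w)) 0 = w := by simp [mobius, h.left_inv w hw]
  have h1 : (ψ ∘ mobius (-f w)) m = z := by
    simp [hm, mobius_neg_mobius hw1 hz1, h.left_inv z hz]
  have hle : ‖z - w‖ ≤ R * ‖m‖ := by
    have := Complex.dist_le_div_mul_dist_of_mapsTo_ball (R₂ := R) hd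
      (fun x hx => by
        rw [h0]; exact ball_subset_closedBall (mem_ball.2 (hR _ (h.maps_inv (hmaps hx)) w hw)))
      (z := m) (by simpa using hm1)
    rw [h0, h1] at this
    simpa [dist_eq_norm] using this
  have hm0 : 0 < ‖m‖ := by
    by_contra hneg
    have : ‖m‖ = 0 := le_antisymm (not_lt.1 hneg) (norm_nonneg _)
    rw [this] at hle; linarith
  rw [discGreen_eq_neg_log_mobius hz1 hw1 (h.apply_ne hz hw hzw), ← Real.log_inv]
  have hinv : ‖m‖⁻¹ ≤ R * ‖z - w‖⁻¹ := by
    rw [inv_le_iff_one_le_mul₀ hm0]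
    field_simp
    linarith
  have := Real.log_le_sub_one_of_pos (inv_pos.2 hm0)
  linarith

lemma tendsto_discGreen_zero {ι : Type*} {l : Filter ι} {a : ι → ℂ} (hc : ‖c‖ < 1)
    (ha : ∀ᶠ i in l, ‖a i‖ < 1) (hl : Tendsto (fun i => ‖a i‖) l (𝓝 1)) :
    Tendsto (fun i => discGreen (a i) c) l (𝓝 0) := by
  have hne : ∀ᶠ i in l, ‖c‖ < ‖a i‖ := hl.eventually_const_lt hc
  have hsq : Tendsto (fun i => ‖mobius c (a i)‖ ^ 2) l (𝓝 1) := by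
    have hup : Tendsto (fun i => 1 - (1 - ‖a i‖ ^ 2) / (1 - ‖c‖) ^ 2) l (𝓝 1) := by
      have := (((hl.pow 2).const_sub 1).div_const ((1 - ‖c‖) ^ 2)).const_sub 1
      simpa using this
    refine tendsto_of_tendsto_of_tendsto_of_le_of_le' hup tendsto_const_nhds ?_ ?_
    · filter_upwards [ha] with i hi
      have hD : 1 - ‖c‖ ≤ ‖1 - conj c * a i‖ := by
        have := norm_sub_norm_le (1 : ℂ) (conj c * a i)
        rw [norm_one, norm_mul, Complex.norm_conj] at this
        have := mul_le_of_le_one_right (norm_nonneg c) hi.le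
        linarith
      have hpos : 0 < 1 - ‖c‖ := by linarith
      have hD2 : (1 - ‖c‖) ^ 2 ≤ ‖1 - conj c * a i‖ ^ 2 := by gcongr
      have hid := sq_norm_sub_sq_norm_eq c (a i)
      have hDpos : 0 < ‖1 - conj c * a i‖ ^ 2 := (by positivity : 0 < (1 - ‖c‖) ^ 2).trans_le hD2
      have heq : ‖mobius c (a i)‖ ^ 2
          = 1 - (1 - ‖c‖ ^ 2) * (1 - ‖a i‖ ^ 2) / ‖1 - conj c * a i‖ ^ 2 := by
        rw [mobius, norm_div, div_pow, ← hid, sub_div, div_self hDpos.ne']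
        ring
      rw [heq]
      have ha2 : 0 ≤ 1 - ‖a i‖ ^ 2 := by nlinarith [norm_nonneg (a i)]
      have hc2 : 1 - ‖c‖ ^ 2 ≤ 1 := by nlinarith [norm_nonneg c]
      have : (1 - ‖c‖ ^ 2) * (1 - ‖a i‖ ^ 2) / ‖1 - conj c * a i‖ ^ 2
          ≤ (1 - ‖a i‖ ^ 2) / (1 - ‖c‖) ^ 2 := by
        apply div_le_div₀ ha2 _ (by positivity) hD2
        nlinarith
      linarith
    · filter_upwards [ha] with i hi
      have := norm_mobius_lt_one hc hi
      nlinarith [norm_nonneg (mobius c (a i))]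
  have hlog : Tendsto (fun i => -(Real.log (‖mobius c (a i)‖ ^ 2) / 2)) l (𝓝 0) := by
    have := ((hsq.log one_ne_zero).div_const 2).neg
    simpa using this
  refine hlog.congr' ?_
  filter_upwards [ha, hne] with i hi hni
  rw [discGreen_eq_neg_log_mobius hi hc (fun h => by rw [h] at hni; exact lt_irrefl _ hni),
    Real.log_pow]
  push_cast
  ring

/-- A Riemann map is proper: it sends boundary points to the unit circle. -/
lemma IsRiemannPair.tendsto_norm (h : IsRiemannPair U f ψ) {p : ℂ} (hp : p ∉ U) :
    Tendsto (fun z => ‖f z‖) (𝓝[U] p) (𝓝 1) := by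
  rw [Metric.tendsto_nhds]
  intro ε hε
  have hK : IsCompact (ψ '' closedBall 0 (1 - min ε 1 / 2)) := by
    refine (isCompact_closedBall _ _).image_of_continuousOn (h.diff_inv.continuousOn.mono ?_)
    refine closedBall_subset_ball ?_
    have : 0 < min ε 1 := lt_min hε one_pos
    linarith
  have hpK : p ∉ ψ '' closedBall 0 (1 - min ε 1 / 2) := by
    rintro ⟨x, hx, rfl⟩
    refine hp (h.maps_inv (closedBall_subset_ball ?_ hx))
    have : 0 < min ε 1 := lt_min hε one_pos
    linarith
  filter_upwards [mem_nhdsWithin_of_mem_nhds (hK.isClosed.isOpen_compl.mem_nhds hpK),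
    self_mem_nhdsWithin] with z hzK hzU
  have h1 := h.norm_lt_one hzU
  have h2 : 1 - min ε 1 / 2 < ‖f z‖ := by
    by_contra hcon
    exact hzK ⟨f z, by simpa using not_lt.1 hcon, h.left_inv z hzU⟩
  rw [Real.dist_eq, abs_lt]
  have h3 : min ε 1 ≤ ε := min_le_left _ _
  constructor <;> linarith

end DiscGreen

section GreenKernel

open Classical in
/-- The Green kernel of `U` obtained by transporting that of the disc along `f`. -/
def greenKernel (U : Set ℂ) (f : ℂ → ℂ) (z w : ℂ) : ℝ :=
  if z ∈ U ∧ w ∈ U ∧ z ≠ w then (2 * π)⁻¹ * discGreen (f z) (f w) else 0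

/-- An integrable radial function that dominates the Green kernel. -/
def greenBound (R : ℝ) : ℂ → ℝ := (ball (0 : ℂ) R).indicator fun y => R * ‖y‖⁻¹

lemma integrable_greenBound (R : ℝ) : Integrable (greenBound R) :=
  (integrable_indicator_iff measurableSet_ball).2 ((integrableOn_inv_norm R).const_mul R)

variable {U : Set ℂ} {f ψ : ℂ → ℂ} {z w : ℂ}

lemma greenKernel_comm (U : Set ℂ) (f : ℂ → ℂ) (z w : ℂ) :
    greenKernel U f z w = greenKernel U f w z := by
  rw [greenKernel, greenKernel, discGreen_comm]
  congr 1
  simp only [eq_iff_iff, ne_comm (a := z)]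
  tauto

lemma greenKernel_of_mem (hz : z ∈ U) (hw : w ∈ U) (hzw : z ≠ w) :
    greenKernel U f z w = (2 * π)⁻¹ * discGreen (f z) (f w) := if_pos ⟨hz, hw, hzw⟩

lemma greenKernel_of_notMem_left (hz : z ∉ U) : greenKernel U f z w = 0 :=
  if_neg fun h => hz h.1

lemma greenKernel_of_notMem_right (hw : w ∉ U) : greenKernel U f z w = 0 :=
  if_neg fun h => hw h.2.1

lemma IsRiemannPair.greenKernel_nonneg (h : IsRiemannPair U f ψ) (z w : ℂ) :
    0 ≤ greenKernel U f z w := by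
  rw [greenKernel]
  split_ifs with hc
  · exact mul_nonneg (by positivity) (discGreen_nonneg (h.norm_lt_one hc.1) (h.norm_lt_one hc.2.1)
      (h.apply_ne hc.1 hc.2.1 hc.2.2))
  · exact le_rfl

lemma IsRiemannPair.greenKernel_le (h : IsRiemannPair U f ψ) {R : ℝ}
    (hR : ∀ x ∈ U, ∀ y ∈ U, dist x y < R) (z w : ℂ) :
    greenKernel U f z w ≤ greenBound R (z - w) := by
  rw [greenKernel]
  split_ifs with hc
  · have hmem : z - w ∈ ball (0 : ℂ) R := by
      simpa [dist_eq_norm] using hR z hc.1 w hc.2.1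
    rw [greenBound, indicator_of_mem hmem]
    have h1 := h.discGreen_le hR hc.1 hc.2.1 hc.2.2
    have h2 := discGreen_nonneg (h.norm_lt_one hc.1) (h.norm_lt_one hc.2.1)
      (h.apply_ne hc.1 hc.2.1 hc.2.2)
    have h3 : (2 * π)⁻¹ ≤ 1 := inv_le_one_of_one_le₀ (by linarith [Real.pi_gt_three])
    exact (mul_le_of_le_one_left h2 h3).trans h1
  · refine indicator_nonneg (fun y hy => ?_) _
    have : 0 < R := pos_of_mem_ball hy
    positivity

lemma IsRiemannPair.measurable_greenKernel (h : IsRiemannPair U f ψ) (hU : IsOpen U) :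
    Measurable fun p : ℂ × ℂ => greenKernel U f p.1 p.2 := by
  classical
  have hm : Measurable (U.piecewise f 0) := by
    refine ContinuousOn.measurable_piecewise h.diff.continuousOn continuousOn_const hU.measurableSet
  have heq : (fun p : ℂ × ℂ => greenKernel U f p.1 p.2) = fun p =>
      if p.1 ∈ U ∧ p.2 ∈ U ∧ p.1 ≠ p.2 then
        (2 * π)⁻¹ * discGreen (U.piecewise f 0 p.1) (U.piecewise f 0 p.2) else 0 := by
    funext p
    rw [greenKernel]
    split_ifs with hc
    · rw [piecewise_eq_of_mem _ _ _ hc.1, piecewise_eq_of_mem _ _ _ hc.2.1]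
    · rfl
  rw [heq]
  refine Measurable.ite ?_ ?_ measurable_const
  · have h1 : MeasurableSet {p : ℂ × ℂ | p.1 ∈ U} := measurable_fst hU.measurableSet
    have h2 : MeasurableSet {p : ℂ × ℂ | p.2 ∈ U} := measurable_snd hU.measurableSet
    have h3 : MeasurableSet {p : ℂ × ℂ | p.1 ≠ p.2} :=
      (measurableSet_eq_fun measurable_fst measurable_snd).compl
    exact h1.inter (h2.inter h3)
  · have hd : Measurable fun p : ℂ × ℂ => discGreen p.1 p.2 := by
      unfold discGreen
      have : Measurable fun p : ℂ × ℂ => conj p.2 :=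
        Complex.continuous_conj.measurable.comp measurable_snd
      fun_prop
    exact (hd.comp ((hm.comp measurable_fst).prodMk (hm.comp measurable_snd))).const_mul _

lemma IsRiemannPair.tendsto_greenKernel (h : IsRiemannPair U f ψ) {p : ℂ} (hp : p ∉ U) (w : ℂ) :
    Tendsto (fun z => greenKernel U f z w) (𝓝[U] p) (𝓝 0) := by
  by_cases hw : w ∈ U
  · have h1 := (tendsto_discGreen_zero (h.norm_lt_one hw)
      (eventually_of_mem self_mem_nhdsWithin fun z hz => h.norm_lt_one hz)
      (h.tendsto_norm hp)).const_mul (2 * π)⁻¹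
    rw [mul_zero] at h1
    refine h1.congr' ?_
    have hne : ∀ᶠ z in 𝓝[U] p, z ≠ w :=
      mem_nhdsWithin_of_mem_nhds (isOpen_ne.mem_nhds (fun he => hp (he ▸ hw)))
    filter_upwards [self_mem_nhdsWithin, hne] with z hz hzw
    rw [greenKernel_of_mem hz hw hzw]
  · simp only [greenKernel_of_notMem_right hw]
    exact tendsto_const_nhds

/-- The Green operator of `U`: the solution of `-Δu = g` in `U`, `u = 0` off `U`. -/
def greenOp (U : Set ℂ) (f : ℂ → ℂ) (g : ℂ → ℝ) (z : ℂ) : ℝ := ∫ w, greenKernel U f z w * g w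

lemma greenOp_of_notMem {g : ℂ → ℝ} (hz : z ∉ U) : greenOp U f g z = 0 := by
  simp [greenOp, greenKernel_of_notMem_left hz]

variable {g : ℂ → ℝ} {C : ℝ}

lemma IsRiemannPair.integrable_greenKernel (h : IsRiemannPair U f ψ) (hU : IsOpen U)
    (hb : Bornology.IsBounded U) (z : ℂ) : Integrable fun w => greenKernel U f z w := by
  obtain ⟨R, hR⟩ : ∃ R, ∀ x ∈ U, ∀ y ∈ U, dist x y < R := by
    obtain ⟨R, hR⟩ := isBounded_iff.1 hb
    exact ⟨R + 1, fun x hx y hy => by linarith [hR hx hy]⟩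
  refine ((integrable_greenBound R).comp_sub_left z).mono'
    ((h.measurable_greenKernel hU).comp measurable_prodMk_left).aestronglyMeasurable
    (Eventually.of_forall fun w => ?_)
  rw [Real.norm_of_nonneg (h.greenKernel_nonneg z w)]
  exact h.greenKernel_le hR z w

lemma IsRiemannPair.integrable_greenKernel_mul (h : IsRiemannPair U f ψ) (hU : IsOpen U)
    (hb : Bornology.IsBounded U) (hg : Measurable g) (hC : ∀ w, ‖g w‖ ≤ C) (z : ℂ) :
    Integrable fun w => greenKernel U f z w * g w :=
  (h.integrable_greenKernel hU hb z).mul_bdd hg.aestronglyMeasurable (Eventually.of_forall hC)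

lemma IsRiemannPair.exists_integral_greenKernel_le (h : IsRiemannPair U f ψ) (hU : IsOpen U)
    (hb : Bornology.IsBounded U) : ∃ B, ∀ z, ∫ w, greenKernel U f z w ≤ B := by
  obtain ⟨R, hR⟩ : ∃ R, ∀ x ∈ U, ∀ y ∈ U, dist x y < R := by
    obtain ⟨R, hR⟩ := isBounded_iff.1 hb
    exact ⟨R + 1, fun x hx y hy => by linarith [hR hx hy]⟩
  refine ⟨∫ y, greenBound R y, fun z => ?_⟩
  rw [← integral_sub_left_eq_self (greenBound R) volume z]
  exact integral_mono (h.integrable_greenKernel hU hb z)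
    ((integrable_greenBound R).comp_sub_left z) (h.greenKernel_le hR z)

lemma IsRiemannPair.norm_greenOp_le (h : IsRiemannPair U f ψ) (hU : IsOpen U)
    (hb : Bornology.IsBounded U) (hC : ∀ w, ‖g w‖ ≤ C) (z : ℂ) :
    ‖greenOp U f g z‖ ≤ C * ∫ w, greenKernel U f z w := by
  rw [← integral_const_mul]
  refine norm_integral_le_of_norm_le ((h.integrable_greenKernel hU hb z).const_mul C)
    (Eventually.of_forall fun w => ?_)
  rw [norm_mul, Real.norm_of_nonneg (h.greenKernel_nonneg z w), mul_comm]
  exact mul_le_mul_of_nonneg_right (hC w) (h.greenKernel_nonneg z w)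

lemma IsRiemannPair.greenOp_mono (h : IsRiemannPair U f ψ) (hU : IsOpen U)
    (hb : Bornology.IsBounded U) {g' : ℂ → ℝ} (hg : Measurable g) (hC : ∀ w, ‖g w‖ ≤ C)
    (hg' : Measurable g') (hC' : ∀ w, ‖g' w‖ ≤ C) (hle : ∀ w, g w ≤ g' w) (z : ℂ) :
    greenOp U f g z ≤ greenOp U f g' z :=
  integral_mono (h.integrable_greenKernel_mul hU hb hg hC z)
    (h.integrable_greenKernel_mul hU hb hg' hC' z) fun w =>
      mul_le_mul_of_nonneg_left (hle w) (h.greenKernel_nonneg z w)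

lemma tendsto_integral_sub_min {k : ℂ → ℝ} (hk : Integrable k) (h0 : ∀ y, 0 ≤ k y) :
    Tendsto (fun n : ℕ => ∫ y, (k y - min (k y) n)) atTop (𝓝 0) := by
  have hlim : ∀ y, Tendsto (fun n : ℕ => k y - min (k y) n) atTop (𝓝 0) := fun y => by
    refine tendsto_const_nhds.congr' ?_
    filter_upwards [eventually_ge_atTop ⌈k y⌉₊] with n hn
    rw [min_eq_left ((Nat.le_ceil _).trans (by exact_mod_cast hn)), sub_self]
  have := tendsto_integral_of_dominated_convergence (F := fun (n : ℕ) y => k y - min (k y) n)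
    (f := fun _ => (0 : ℝ)) (μ := volume) k
    (fun n => hk.aestronglyMeasurable.sub (hk.aestronglyMeasurable.inf aestronglyMeasurable_const))
    hk (fun n => Eventually.of_forall fun y => ?_) (Eventually.of_forall hlim)
  · simpa using this
  · have h1 : 0 ≤ min (k y) n := le_min (h0 y) (Nat.cast_nonneg n)
    rw [Real.norm_of_nonneg (by linarith [min_le_left (k y) (n : ℝ)])]
    linarith

lemma IsRiemannPair.tendsto_integral_greenKernel (h : IsRiemannPair U f ψ) (hU : IsOpen U)
    (hb : Bornology.IsBounded U) {p : ℂ} (hp : p ∉ U) :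
    Tendsto (fun z => ∫ w, greenKernel U f z w) (𝓝[U] p) (𝓝 0) := by
  obtain ⟨R, hR⟩ : ∃ R, ∀ x ∈ U, ∀ y ∈ U, dist x y < R := by
    obtain ⟨R, hR⟩ := isBounded_iff.1 hb
    exact ⟨R + 1, fun x hx y hy => by linarith [hR hx hy]⟩
  have hk := integrable_greenBound R
  have hk0 : ∀ y, 0 ≤ greenBound R y := fun y => indicator_nonneg (fun y hy => by
    have : 0 < R := pos_of_mem_ball hy
    positivity) _
  have hmeas : ∀ z, AEStronglyMeasurable (fun w => greenKernel U f z w) volume := fun z =>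
    (h.integrable_greenKernel hU hb z).aestronglyMeasurable
  have htrunc : ∀ n : ℕ, Tendsto (fun z => ∫ w, min (greenKernel U f z w) n) (𝓝[U] p) (𝓝 0) := by
    intro n
    have := tendsto_integral_filter_of_dominated_convergence (μ := volume) (l := 𝓝[U] p)
      (F := fun z w => min (greenKernel U f z w) n) (f := fun _ => (0 : ℝ))
      (U.indicator fun _ => (n : ℝ))
      (Eventually.of_forall fun z => (hmeas z).inf aestronglyMeasurable_const)
      (Eventually.of_forall fun z => Eventually.of_forall fun w => ?_)
      ((integrable_indicator_iff hU.measurableSet).2 (integrableOn_const hb.measure_lt_top.ne))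
      (Eventually.of_forall fun w => ?_)
    · simpa using this
    · have h0 := h.greenKernel_nonneg z w
      rw [Real.norm_of_nonneg (le_min h0 (Nat.cast_nonneg n))]
      by_cases hw : w ∈ U
      · rw [indicator_of_mem hw]; exact min_le_right _ _
      · rw [indicator_of_notMem hw, greenKernel_of_notMem_right hw]; exact min_le_left _ _
    · have := (h.tendsto_greenKernel hp w).min (tendsto_const_nhds (x := (n : ℝ)))
      simpa using this
  rw [Metric.tendsto_nhds]
  intro ε hε
  obtain ⟨n, hn⟩ := ((tendsto_integral_sub_min hk hk0).eventually_lt_const (half_pos hε)).exists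
  filter_upwards [(htrunc n).eventually_lt_const (half_pos hε)] with z hz
  have hinteg := h.integrable_greenKernel hU hb z
  have hkz := hk.comp_sub_left z
  have hmin : ∀ k : ℂ → ℝ, Integrable k → (∀ y, 0 ≤ k y) → Integrable fun y => min (k y) n :=
    fun k hk hk0 => hk.mono' (hk.aestronglyMeasurable.inf aestronglyMeasurable_const)
      (Eventually.of_forall fun y => by
        rw [Real.norm_of_nonneg (le_min (hk0 y) (Nat.cast_nonneg n))]; exact min_le_left _ _)
  have hsplit : ∫ w, greenKernel U f z w ≤ (∫ w, min (greenKernel U f z w) n)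
      + ∫ w, (greenBound R (z - w) - min (greenBound R (z - w)) n) := by
    have hsub : Integrable fun w => greenBound R (z - w) - min (greenBound R (z - w)) n :=
      hkz.sub (hmin _ hkz fun w => hk0 _)
    rw [← integral_add (hmin _ hinteg (h.greenKernel_nonneg z)) hsub]
    refine integral_mono hinteg ((hmin _ hinteg (h.greenKernel_nonneg z)).add hsub) fun w => ?_
    have hle := h.greenKernel_le hR z w
    simp only
    rcases le_total (greenKernel U f z w) n with h1 | h1
    · rw [min_eq_left h1]
      linarith [min_le_left (greenBound R (z - w)) (n : ℝ)]
    · rw [min_eq_right h1, min_eq_right (h1.trans hle)]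
      linarith
  rw [integral_sub_left_eq_self (fun y => greenBound R y - min (greenBound R y) n)] at hsplit
  rw [Real.dist_eq, sub_zero, abs_of_nonneg (integral_nonneg (h.greenKernel_nonneg z))]
  linarith

lemma IsRiemannPair.continuousAt_greenOp_of_notMem (h : IsRiemannPair U f ψ) (hU : IsOpen U)
    (hb : Bornology.IsBounded U) (hC : ∀ w, ‖g w‖ ≤ C) {p : ℂ} (hp : p ∉ U) :
    ContinuousAt (greenOp U f g) p := by
  rw [ContinuousAt, greenOp_of_notMem hp, ← nhdsWithin_univ, ← union_compl_self U,
    nhdsWithin_union, tendsto_sup]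
  constructor
  · refine squeeze_zero_norm (fun z => h.norm_greenOp_le hU hb hC z) ?_
    simpa using (h.tendsto_integral_greenKernel hU hb hp).const_mul C
  · refine tendsto_const_nhds.congr' ?_
    filter_upwards [self_mem_nhdsWithin] with z hz
    rw [greenOp_of_notMem hz]

end GreenKernel

section GreenRegularity

variable {U : Set ℂ} {f ψ : ℂ → ℂ} {z : ℂ} {g : ℂ → ℝ} {C : ℝ}

/-- The pullback to the disc of a density on `U`. -/
def pullbackDensity (ψ : ℂ → ℂ) (g : ℂ → ℝ) : ℂ → ℝ :=
  (ball (0 : ℂ) 1).indicator fun ζ => ‖deriv ψ ζ‖ ^ 2 * g (ψ ζ)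

lemma IsRiemannPair.image_ball (h : IsRiemannPair U f ψ) : ψ '' ball 0 1 = U := by
  refine Subset.antisymm (image_subset_iff.2 h.maps_inv) fun z hz => ?_
  exact ⟨f z, h.maps hz, h.left_inv z hz⟩

lemma IsRiemannPair.hasFDerivWithinAt (h : IsRiemannPair U f ψ) {ζ : ℂ} (hζ : ζ ∈ ball (0 : ℂ) 1) :
    HasFDerivWithinAt ψ (ContinuousLinearMap.mul ℝ ℂ (deriv ψ ζ)) (ball 0 1) ζ := by
  have h1 := ((h.diff_inv ζ hζ).differentiableAt
    (isOpen_ball.mem_nhds hζ)).hasDerivAt.complexToReal_fderiv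
  have he : deriv ψ ζ • (1 : ℂ →L[ℝ] ℂ) = ContinuousLinearMap.mul ℝ ℂ (deriv ψ ζ) := by
    ext; simp
  rw [he] at h1
  exact h1.hasFDerivWithinAt

lemma IsRiemannPair.injOn_inv (h : IsRiemannPair U f ψ) : InjOn ψ (ball 0 1) := fun x hx y hy hxy => by
  rw [← h.right_inv x hx, hxy, h.right_inv y hy]

lemma IsRiemannPair.continuousOn_deriv_inv (h : IsRiemannPair U f ψ) :
    ContinuousOn (deriv ψ) (ball 0 1) :=
  (h.diff_inv.deriv isOpen_ball).continuousOn

lemma IsRiemannPair.isDiscDensity_pullback (h : IsRiemannPair U f ψ)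
    (hb : Bornology.IsBounded U) (hg : Measurable g) (hC : ∀ w, ‖g w‖ ≤ C) :
    IsDiscDensity (pullbackDensity ψ g) where
  integrable := by
    have hgU : IntegrableOn g U :=
      Measure.integrableOn_of_bounded hb.measure_lt_top.ne hg.aestronglyMeasurable
        (Eventually.of_forall hC)
    rw [← h.image_ball, integrableOn_image_iff_integrableOn_abs_det_fderiv_smul volume
      measurableSet_ball (fun x hx => h.hasFDerivWithinAt hx) h.injOn_inv] at hgU
    simp only [abs_det_mul_complex] at hgU
    exact (integrable_indicator_iff measurableSet_ball).2 hgU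
  supp z hz := indicator_of_notMem hz _
  locBdd r hr := by
    obtain ⟨M, hM⟩ := (isCompact_closedBall (0 : ℂ) r).exists_bound_of_continuousOn
      (h.continuousOn_deriv_inv.mono (closedBall_subset_ball hr))
    refine ⟨M ^ 2 * C, fun z hz => ?_⟩
    rw [pullbackDensity, indicator_of_mem (closedBall_subset_ball hr hz), norm_mul, norm_pow,
      norm_norm]
    have := hM z hz
    gcongr
    exact hC _

lemma IsRiemannPair.greenOp_eq (h : IsRiemannPair U f ψ) (hU : IsOpen U) (g : ℂ → ℝ) (hz : z ∈ U) :
    greenOp U f g z = (2 * π)⁻¹ * discPotential (pullbackDensity ψ g) (f z) := by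
  have h1 : greenOp U f g z = ∫ w in U, (2 * π)⁻¹ * (discGreen (f z) (f w) * g w) := by
    rw [greenOp, ← integral_indicator hU.measurableSet]
    refine integral_congr_ae ?_
    have hne : ∀ᵐ w : ℂ, w ≠ z := by simp [ae_iff]
    filter_upwards [hne] with w hw
    by_cases hwU : w ∈ U
    · rw [indicator_of_mem hwU, greenKernel_of_mem hz hwU hw.symm, mul_assoc]
    · rw [indicator_of_notMem hwU, greenKernel_of_notMem_right hwU, zero_mul]
  rw [h1, integral_const_mul, discPotential]
  congr 1
  nth_rewrite 1 [← h.image_ball]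
  rw [integral_image_eq_integral_abs_det_fderiv_smul volume
      measurableSet_ball (fun x hx => h.hasFDerivWithinAt hx) h.injOn_inv,
    ← integral_indicator measurableSet_ball]
  congr 1
  funext ζ
  by_cases hζ : ζ ∈ ball (0 : ℂ) 1
  · rw [pullbackDensity, indicator_of_mem hζ, indicator_of_mem hζ, abs_det_mul_complex,
      h.right_inv ζ hζ, smul_eq_mul]
    ring
  · rw [pullbackDensity, indicator_of_notMem hζ, indicator_of_notMem hζ, zero_mul]

lemma IsRiemannPair.greenOp_eventuallyEq (h : IsRiemannPair U f ψ) (hU : IsOpen U) (g : ℂ → ℝ)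
    (hz : z ∈ U) :
    greenOp U f g =ᶠ[𝓝 z] ((2 * π)⁻¹ • discPotential (pullbackDensity ψ g)) ∘ f := by
  filter_upwards [hU.mem_nhds hz] with x hx
  simp [h.greenOp_eq hU g hx]

lemma IsRiemannPair.analyticAt (h : IsRiemannPair U f ψ) (hU : IsOpen U) (hz : z ∈ U) :
    AnalyticAt ℂ f z := h.diff.analyticAt (hU.mem_nhds hz)

lemma IsRiemannPair.contDiffAt_greenOp (h : IsRiemannPair U f ψ) (hU : IsOpen U)
    (hb : Bornology.IsBounded U) (hg : Measurable g) (hC : ∀ w, ‖g w‖ ≤ C) (hz : z ∈ U) :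
    ContDiffAt ℝ 1 (greenOp U f g) z := by
  refine ContDiffAt.congr_of_eventuallyEq ?_ (h.greenOp_eventuallyEq hU g hz)
  refine ContDiffAt.comp z ?_ ((h.analyticAt hU hz).contDiffAt.restrict_scalars ℝ)
  exact ((h.isDiscDensity_pullback hb hg hC).contDiffAt_discPotential (h.maps hz)).const_smul (2 * π)⁻¹

/-- The Green operator inverts `-Δ` on `C¹` densities. -/
lemma IsRiemannPair.laplacian_greenOp (h : IsRiemannPair U f ψ) (hU : IsOpen U)
    (hb : Bornology.IsBounded U) (hg : Measurable g) (hC : ∀ w, ‖g w‖ ≤ C)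
    (hg1 : ContDiffOn ℝ 1 g U) (hz : z ∈ U) :
    ContDiffAt ℝ 2 (greenOp U f g) z ∧ Δ (greenOp U f g) z = -g z := by
  have hψ : ContDiffOn ℝ 1 ψ (ball 0 1) := fun x hx =>
    ((h.diff_inv.analyticAt (isOpen_ball.mem_nhds hx)).contDiffAt.restrict_scalars
      ℝ).contDiffWithinAt
  have hψ' : ContDiffOn ℝ 1 (deriv ψ) (ball 0 1) := fun x hx =>
    ((h.diff_inv.analyticAt (isOpen_ball.mem_nhds hx)).deriv.contDiffAt.restrict_scalars
      ℝ).contDiffWithinAt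
  have hq1 : ContDiffOn ℝ 1 (pullbackDensity ψ g) (ball 0 1) := by
    refine ContDiffOn.congr ((hψ'.norm_sq ℝ).mul (hg1.comp hψ h.maps_inv)) fun x hx => ?_
    rw [pullbackDensity, indicator_of_mem hx]
    rfl
  obtain ⟨hD2, hΔ⟩ := (h.isDiscDensity_pullback hb hg hC).contDiffAt_two_discPotential hq1
    (h.maps hz)
  have hV : ContDiffAt ℝ 2 ((2 * π)⁻¹ • discPotential (pullbackDensity ψ g)) (f z) :=
    hD2.const_smul (2 * π)⁻¹
  have hfa := h.analyticAt hU hz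
  refine ⟨(hV.comp z (hfa.contDiffAt.restrict_scalars ℝ)).congr_of_eventuallyEq
    (h.greenOp_eventuallyEq hU g hz), ?_⟩
  rw [(laplacian_congr_nhds (h.greenOp_eventuallyEq hU g hz)).self_of_nhds,
    laplacian_comp_holomorphic hfa hV, laplacian_smul _ hD2, hΔ, pullbackDensity,
    indicator_of_mem (h.maps hz), h.left_inv z hz, smul_eq_mul]
  have hprod : deriv ψ (f z) * deriv f z = 1 := by
    have h1 : HasDerivAt (ψ ∘ f) (deriv ψ (f z) * deriv f z) z :=
      ((h.diff_inv _ (h.maps hz)).differentiableAt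
        (isOpen_ball.mem_nhds (h.maps hz))).hasDerivAt.comp z hfa.differentiableAt.hasDerivAt
    have h2 : HasDerivAt (ψ ∘ f) 1 z :=
      (hasDerivAt_id z).congr_of_eventuallyEq (by
        filter_upwards [hU.mem_nhds hz] with x hx
        exact h.left_inv x hx)
    exact h1.unique h2
  have hnorm : ‖deriv f z‖ ^ 2 * ‖deriv ψ (f z)‖ ^ 2 = 1 := by
    rw [← mul_pow, ← norm_mul, mul_comm, hprod]; simp
  have hpi : (2 * π)⁻¹ * (2 * π) = 1 := inv_mul_cancel₀ (by positivity)
  linear_combination (-g z) * hnorm - ‖deriv f z‖ ^ 2 * ‖deriv ψ (f z)‖ ^ 2 * g z * hpi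

lemma IsRiemannPair.continuous_greenOp (h : IsRiemannPair U f ψ) (hU : IsOpen U)
    (hb : Bornology.IsBounded U) (hg : Measurable g) (hC : ∀ w, ‖g w‖ ≤ C) :
    Continuous (greenOp U f g) := by
  rw [continuous_iff_continuousAt]
  intro p
  by_cases hp : p ∈ U
  · exact (h.contDiffAt_greenOp hU hb hg hC hp).continuousAt
  · exact h.continuousAt_greenOp_of_notMem hU hb hC hp

end GreenRegularity

section SecondDerivativeAlongLines

variable {E : Type*} [NormedAddCommGroup E] [NormedSpace ℝ E] {u : E → ℝ} {p v : E}

lemma eventually_hasDerivAt_line (hu : ContDiffAt ℝ 2 u p) (v : E) :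
    ∀ᶠ t : ℝ in 𝓝 0, HasDerivAt (fun t : ℝ => u (p + t • v)) (fderiv ℝ u (p + t • v) v) t := by
  have hc : ContinuousAt (fun t : ℝ => p + t • v) 0 := by fun_prop
  have h1 : ∀ᶠ y in 𝓝 ((fun t : ℝ => p + t • v) 0), ContDiffAt ℝ 2 u y := by
    simpa using hu.eventually (by simp)
  filter_upwards [hc.eventually h1] with t ht
  have h2 : HasDerivAt (fun t : ℝ => p + t • v) v t := by
    simpa using ((hasDerivAt_id t).smul_const v).const_add p
  exact (ht.differentiableAt (by simp)).hasFDerivAt.comp_hasDerivAt t h2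

lemma deriv_deriv_line (hu : ContDiffAt ℝ 2 u p) (v : E) :
    deriv (deriv fun t : ℝ => u (p + t • v)) 0 = fderiv ℝ (fderiv ℝ u) p v v := by
  have h1 : deriv (fun t : ℝ => u (p + t • v)) =ᶠ[𝓝 0] fun t => fderiv ℝ u (p + t • v) v := by
    filter_upwards [eventually_hasDerivAt_line hu v] with t ht using ht.deriv
  have h2 : HasDerivAt (fun t : ℝ => p + t • v) v 0 := by
    simpa using ((hasDerivAt_id (0 : ℝ)).smul_const v).const_add p
  have h3 : HasFDerivAt (fderiv ℝ u) (fderiv ℝ (fderiv ℝ u) p) (p + (0 : ℝ) • v) := by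
    rw [zero_smul, add_zero]
    exact ((hu.fderiv_right (m := 1) (by norm_num)).differentiableAt (by simp)).hasFDerivAt
  have h4 : HasFDerivAt (fun y => fderiv ℝ u y v)
      ((ContinuousLinearMap.apply ℝ ℝ v).comp (fderiv ℝ (fderiv ℝ u) p)) (p + (0 : ℝ) • v) :=
    (ContinuousLinearMap.apply ℝ ℝ v).hasFDerivAt.comp _ h3
  have h5 : HasDerivAt (fun t : ℝ => fderiv ℝ u (p + t • v) v)
      (((ContinuousLinearMap.apply ℝ ℝ v).comp (fderiv ℝ (fderiv ℝ u) p)) v) 0 :=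
    HasFDerivAt.comp_hasDerivAt (f := fun t : ℝ => p + t • v) (0 : ℝ) h4 h2
  rw [h1.deriv_eq, h5.deriv]
  rfl

lemma fderiv_fderiv_nonpos_of_isLocalMax (hu : ContDiffAt ℝ 2 u p) (hm : IsLocalMax u p) (v : E) :
    fderiv ℝ (fderiv ℝ u) p v v ≤ 0 := by
  by_contra! hpos
  rw [← deriv_deriv_line hu v] at hpos
  have hc : ContinuousAt (fun t : ℝ => p + t • v) 0 := by fun_prop
  have hmax : IsLocalMax (fun t : ℝ => u (p + t • v)) 0 := by
    have h1 : ∀ᶠ y in 𝓝 ((fun t : ℝ => p + t • v) 0), u y ≤ u p := by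
      simp only [zero_smul, add_zero]; exact hm
    filter_upwards [hc.eventually h1] with t ht
    simpa using ht
  have hmin := isLocalMin_of_deriv_deriv_pos hpos hmax.deriv_eq_zero
    (eventually_hasDerivAt_line hu v).self_of_nhds.continuousAt
  have hconst : (fun t : ℝ => u (p + t • v)) =ᶠ[𝓝 0] fun _ => u p := by
    filter_upwards [hmax, hmin] with t h1 h2
    simp only [zero_smul, add_zero] at h1 h2
    exact le_antisymm h1 h2
  rw [hconst.deriv.deriv_eq] at hpos
  simp at hpos

end SecondDerivativeAlongLines

section MaximumPrinciple

variable {U : Set ℂ} {w : ℂ → ℝ}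

lemma laplacian_nonpos_of_isLocalMax {p : ℂ} (hu : ContDiffAt ℝ 2 w p) (hm : IsLocalMax w p) :
    Δ w p ≤ 0 := by
  rw [laplacian_apply_eq_fderiv]
  exact add_nonpos (fderiv_fderiv_nonpos_of_isLocalMax hu hm _)
    (fderiv_fderiv_nonpos_of_isLocalMax hu hm _)

lemma laplacian_norm_sq (p : ℂ) : Δ (fun z : ℂ => ‖z‖ ^ 2) p = 4 := by
  have h1 : fderiv ℝ (fun z : ℂ => ‖z‖ ^ 2) = fun z => 2 • innerSL ℝ z := by
    funext z; exact fderiv_norm_sq_apply z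
  rw [laplacian_apply_eq_fderiv, h1]
  have h2 : HasFDerivAt (fun z : ℂ => 2 • innerSL ℝ z) (2 • (innerSL ℝ : ℂ →L[ℝ] ℂ →L[ℝ] ℝ)) p :=
    (2 • (innerSL ℝ : ℂ →L[ℝ] ℂ →L[ℝ] ℝ)).hasFDerivAt
  rw [h2.fderiv]
  change 2 • inner ℝ (1 : ℂ) 1 + 2 • inner ℝ Complex.I Complex.I = (4 : ℝ)
  rw [real_inner_self_eq_norm_sq, real_inner_self_eq_norm_sq]
  norm_num

/-- The classical **weak maximum principle** for subharmonic functions. -/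
theorem nonpos_of_laplacian_nonneg (hU : IsOpen U) (hb : Bornology.IsBounded U)
    (hc : ContinuousOn w (closure U)) (h2 : ∀ z ∈ U, ContDiffAt ℝ 2 w z)
    (hΔ : ∀ z ∈ U, 0 ≤ Δ w z) (hf : ∀ z ∈ frontier U, w z ≤ 0) {z : ℂ} (hz : z ∈ U) :
    w z ≤ 0 := by
  by_contra! hpos
  obtain ⟨R, hR⟩ := hb.closure.subset_ball 0
  have hR0 : 0 < R := pos_of_mem_ball (hR (subset_closure hz))
  set δ := w z / (2 * R ^ 2) with hδ
  have hδ0 : 0 < δ := by positivity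
  set v : ℂ → ℝ := fun x => w x + δ • ‖x‖ ^ 2 with hv
  have hK : IsCompact (closure U) := hb.isCompact_closure
  obtain ⟨p, hp, hmax⟩ := hK.exists_isMaxOn ⟨z, subset_closure hz⟩
    (f := v) (hc.add (by fun_prop))
  have hvz : w z ≤ v z := by simp only [hv, smul_eq_mul]; linarith [mul_nonneg hδ0.le (sq_nonneg ‖z‖)]
  have hpz : w z ≤ v p := hvz.trans (hmax (subset_closure hz))
  have hpU : p ∈ U := by
    by_contra hpU
    have h3 := hf p ⟨hp, by rwa [hU.interior_eq]⟩
    have h4 : ‖p‖ ^ 2 ≤ R ^ 2 := by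
      have : ‖p‖ < R := by simpa using hR hp
      gcongr
    have h5 : δ * R ^ 2 = w z / 2 := by rw [hδ]; field_simp
    have : δ * ‖p‖ ^ 2 ≤ δ * R ^ 2 := by gcongr
    simp only [hv, smul_eq_mul] at hpz
    linarith
  have hsq : ContDiffAt ℝ 2 (fun x : ℂ => ‖x‖ ^ 2) p := (contDiff_norm_sq ℝ).contDiffAt
  have hv2 : ContDiffAt ℝ 2 v p := (h2 p hpU).add (hsq.const_smul δ)
  have hloc : IsLocalMax v p :=
    (hmax.on_subset subset_closure).isLocalMax (hU.mem_nhds hpU)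
  have h6 := laplacian_nonpos_of_isLocalMax hv2 hloc
  have h7 : Δ v p = Δ w p + δ * 4 := by
    have : v = w + δ • fun x : ℂ => ‖x‖ ^ 2 := rfl
    rw [this, (h2 p hpU).laplacian_add (f₂ := δ • fun x : ℂ => ‖x‖ ^ 2) (hsq.const_smul δ), laplacian_smul _ hsq, laplacian_norm_sq,
      smul_eq_mul]
  linarith [hΔ p hpU]

end MaximumPrinciple

section Mollification

variable {k q : ℂ → ℝ}

lemma fderiv_convolution_apply (hk : LocallyIntegrable k) (hq : ContDiff ℝ 1 q)
    (hc : HasCompactSupport q) (a v : ℂ) :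
    fderiv ℝ (convolution k q (ContinuousLinearMap.mul ℝ ℝ) volume) a v =
      convolution k (fun ζ => fderiv ℝ q ζ v) (ContinuousLinearMap.mul ℝ ℝ) volume a := by
  have h := hc.hasFDerivAt_convolution_right (ContinuousLinearMap.mul ℝ ℝ) hk hq a
  rw [h.fderiv, convolution_precompR_apply _ hk (hc.fderiv ℝ) (hq.continuous_fderiv one_ne_zero)]

lemma contDiff_fderiv_apply (hq : ContDiff ℝ 2 q) (v : ℂ) :
    ContDiff ℝ 1 fun ζ => fderiv ℝ q ζ v :=
  (hq.fderiv_right (m := 1) (by norm_num)).clm_apply contDiff_const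

lemma fderiv_fderiv_apply (hq : ContDiff ℝ 2 q) (a v w : ℂ) :
    fderiv ℝ (fun ζ => fderiv ℝ q ζ v) a w = fderiv ℝ (fderiv ℝ q) a w v := by
  have h1 : DifferentiableAt ℝ (fderiv ℝ q) a :=
    (hq.fderiv_right (m := 1) (by norm_num)).differentiable one_ne_zero a
  rw [fderiv_clm_apply h1 (differentiableAt_const v)]
  simp

lemma fderiv_fderiv_convolution (hk : LocallyIntegrable k) (hq : ContDiff ℝ 2 q)
    (hc : HasCompactSupport q) (a v : ℂ) :
    fderiv ℝ (fderiv ℝ (convolution k q (ContinuousLinearMap.mul ℝ ℝ) volume)) a v v =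
      convolution k (fun ζ => fderiv ℝ (fderiv ℝ q) ζ v v) (ContinuousLinearMap.mul ℝ ℝ)
        volume a := by
  have hC : ContDiff ℝ 2 (convolution k q (ContinuousLinearMap.mul ℝ ℝ) volume) :=
    hc.contDiff_convolution_right (n := 2) _ hk hq
  rw [← fderiv_fderiv_apply hC]
  simp_rw [fderiv_convolution_apply hk (hq.of_le (by norm_num)) hc]
  rw [fderiv_convolution_apply hk (contDiff_fderiv_apply hq v) (hc.fderiv_apply ℝ v)]
  simp_rw [fderiv_fderiv_apply hq]

lemma continuous_fderiv_fderiv (hq : ContDiff ℝ 2 q) (v : ℂ) :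
    Continuous fun ζ => fderiv ℝ (fderiv ℝ q) ζ v v := by
  simp_rw [← fderiv_fderiv_apply hq]
  exact ((contDiff_fderiv_apply hq v).continuous_fderiv one_ne_zero).clm_apply continuous_const

lemma hasCompactSupport_fderiv_fderiv (hq : ContDiff ℝ 2 q) (hc : HasCompactSupport q) (v : ℂ) :
    HasCompactSupport fun ζ => fderiv ℝ (fderiv ℝ q) ζ v v := by
  simp_rw [← fderiv_fderiv_apply hq]
  exact (hc.fderiv_apply ℝ v).fderiv_apply ℝ v

lemma laplacian_convolution (hk : LocallyIntegrable k) (hq : ContDiff ℝ 2 q)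
    (hc : HasCompactSupport q) (a : ℂ) :
    Δ (convolution k q (ContinuousLinearMap.mul ℝ ℝ) volume) a = ∫ t, k t * Δ q (a - t) := by
  have hex : ∀ v : ℂ, Integrable fun t => k t * fderiv ℝ (fderiv ℝ q) (a - t) v v := fun v =>
    (hasCompactSupport_fderiv_fderiv hq hc v).convolutionExists_right
      (ContinuousLinearMap.mul ℝ ℝ) hk (continuous_fderiv_fderiv hq v) a
  rw [laplacian_apply_eq_fderiv, fderiv_fderiv_convolution hk hq hc,
    fderiv_fderiv_convolution hk hq hc, convolution_def, convolution_def]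
  simp only [laplacian_apply_eq_fderiv, ContinuousLinearMap.mul_apply', mul_add]
  exact (integral_add (hex 1) (hex Complex.I)).symm

lemma fderiv_comp_const_sub (q : ℂ → ℝ) (a t : ℂ) :
    fderiv ℝ (fun x => q (a - x)) t = -fderiv ℝ q (a - t) := by
  have h : (fun x => q (a - x)) = fun x => (fun y => q (-y)) (x - a) := by
    funext x; simp
  have h1 : ∀ x, fderiv ℝ (fun y => q (-y)) x = -fderiv ℝ q (-x) := fun x => by
    have := (ContinuousLinearEquiv.neg ℝ (M := ℂ)).comp_right_fderiv (f := q) (x := x)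
    refine this.trans ?_
    ext v
    simp
  rw [h, fderiv_comp_sub (f := fun y => q (-y)), h1, neg_sub]

lemma laplacian_comp_const_sub (hq : ContDiff ℝ 2 q) (a t : ℂ) :
    Δ (fun x => q (a - x)) t = Δ q (a - t) := by
  have h2 : ContDiff ℝ 2 fun x => q (a - x) := by fun_prop
  rw [laplacian_apply_eq_fderiv, laplacian_apply_eq_fderiv]
  simp only [← fderiv_fderiv_apply hq, ← fderiv_fderiv_apply h2, fderiv_comp_const_sub,
    neg_apply, fderiv_fun_neg]
  have h : ∀ v, fderiv ℝ (fun ζ => fderiv ℝ q (a - ζ) v) t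
      = -fderiv ℝ (fun ζ => fderiv ℝ q ζ v) (a - t) := fun v =>
    fderiv_comp_const_sub (fun ζ => fderiv ℝ q ζ v) a t
  simp [h]

end Mollification

section WeakMaximumPrinciple

variable {U : Set ℂ} {w : ℂ → ℝ}

/-- The **weak maximum principle** for continuous functions that are subharmonic in the sense of
distributions. -/
theorem nonpos_of_weak_laplacian_nonneg (hU : IsOpen U) (hb : Bornology.IsBounded U)
    (hc : ContinuousOn w (closure U))
    (hw : ∀ φ : ℂ → ℝ, ContDiff ℝ (⊤ : ℕ∞) φ → HasCompactSupport φ → tsupport φ ⊆ U →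
      (∀ z, 0 ≤ φ z) → 0 ≤ ∫ z in U, Δ φ z * w z)
    (hf : ∀ z ∈ frontier U, w z ≤ 0) {z : ℂ} (hz : z ∈ U) : w z ≤ 0 := by
  by_contra! hpos
  set m := w z with hm
  set V : Set ℂ := {x ∈ U | m / 2 < w x} with hV
  have hVU : V ⊆ U := fun x hx => hx.1
  have hVo : IsOpen V := (hc.mono subset_closure).isOpen_inter_preimage hU isOpen_Ioi
  have hVb : Bornology.IsBounded V := hb.subset hVU
  have hVcl : ∀ x ∈ closure V, m / 2 ≤ w x := fun x hx => by
    have h1 : ContinuousWithinAt w V x :=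
      (hc x (closure_mono hVU hx)).mono (hVU.trans subset_closure)
    have : (𝓝[V] x).NeBot := mem_closure_iff_nhdsWithin_neBot.1 hx
    exact ge_of_tendsto h1 (eventually_of_mem self_mem_nhdsWithin fun y hy => hy.2.le)
  have hVclU : closure V ⊆ U := fun x hx => by
    by_contra hxU
    have h1 := hf x ⟨closure_mono hVU hx, by rwa [hU.interior_eq]⟩
    linarith [hVcl x hx]
  have hVf : ∀ x ∈ frontier V, w x ≤ m / 2 := fun x hx => by
    by_contra! hcon
    refine hx.2 ?_
    rw [hVo.interior_eq]
    exact ⟨hVclU hx.1, hcon⟩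
  have hK : IsCompact (closure V) := hVb.isCompact_closure
  obtain ⟨δ, hδ, hδU⟩ := hK.exists_cthickening_subset_open hU hVclU
  have hK' : IsCompact (cthickening δ (closure V)) := hK.cthickening
  have huc := hK'.uniformContinuousOn_of_continuous (hc.mono (hδU.trans subset_closure))
  obtain ⟨δ', hδ', huc⟩ := Metric.uniformContinuousOn_iff.1 huc (m / 8) (by positivity)
  have hmin : 0 < min δ δ' := lt_min hδ hδ'
  let b : ContDiffBump (0 : ℂ) := ⟨min δ δ' / 4, min δ δ' / 2, by positivity, by linarith⟩
  have hbr : b.rOut = min δ δ' / 2 := rfl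
  set q : ℂ → ℝ := b.normed volume with hq
  have hq2 : ContDiff ℝ 2 q := b.contDiff_normed (n := 2)
  have hqc : HasCompactSupport q := b.hasCompactSupport_normed
  set k : ℂ → ℝ := U.indicator w with hk
  have hki : Integrable k := by
    refine (integrable_indicator_iff hU.measurableSet).2 ?_
    exact (hc.integrableOn_compact hb.isCompact_closure).mono_set subset_closure
  set W : ℂ → ℝ := convolution k q (ContinuousLinearMap.mul ℝ ℝ) volume with hW
  have hW2 : ContDiff ℝ 2 W := hqc.contDiff_convolution_right (n := 2) _ hki.locallyIntegrable hq2
  have hclose : ∀ x ∈ closure V, |W x - w x| ≤ m / 8 := fun x hx => by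
    have h1 : W x = convolution q k (ContinuousLinearMap.lsmul ℝ ℝ) volume x := by
      rw [convolution_lsmul_swap, hW, convolution_def]
      simp [mul_comm]
    have h2 : k x = w x := indicator_of_mem (hVclU hx) w
    rw [h1, ← Real.dist_eq, ← h2]
    refine b.dist_normed_convolution_le hki.aestronglyMeasurable fun y hy => ?_
    rw [mem_ball, hbr] at hy
    have hyK : y ∈ cthickening δ (closure V) :=
      mem_cthickening_of_dist_le y x δ _ hx (by linarith [min_le_left δ δ'])
    rw [h2, hk, indicator_of_mem (hδU hyK)]
    exact (huc y hyK x (self_subset_cthickening _ hx) (by linarith [min_le_right δ δ'])).le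
  have hWΔ : ∀ x ∈ V, 0 ≤ Δ W x := fun x hx => by
    rw [laplacian_convolution hki.locallyIntegrable hq2 hqc]
    have hts : tsupport (fun t => q (x - t)) ⊆ U := by
      refine (closure_minimal (fun t ht => ?_) isClosed_closedBall :
        _ ⊆ closedBall x b.rOut).trans fun t ht => hδU ?_
      · have h1 : x - t ∈ Function.support q := ht
        rw [hq, b.support_normed_eq] at h1
        have : ‖x - t‖ < b.rOut := by simpa using h1
        rw [mem_closedBall, dist_comm, dist_eq_norm]
        exact this.le
      · rw [mem_closedBall, hbr] at ht
        exact mem_cthickening_of_dist_le t x δ _ (subset_closure hx)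
          (by linarith [min_le_left δ δ'])
    have hcomp : HasCompactSupport fun t => q (x - t) :=
      hb.isCompact_closure.of_isClosed_subset (isClosed_tsupport _) (hts.trans subset_closure)
    have h1 := hw (fun t => q (x - t))
      ((b.contDiff_normed (n := ⊤)).comp (contDiff_const.sub contDiff_id)) hcomp hts
      (fun t => b.nonneg_normed _)
    rw [← integral_indicator hU.measurableSet] at h1
    refine h1.trans_eq (integral_congr_ae (Eventually.of_forall fun t => ?_))
    by_cases ht : t ∈ U
    · simp only [hk, indicator_of_mem ht, laplacian_comp_const_sub hq2, mul_comm]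
    · simp only [hk, indicator_of_notMem ht, zero_mul]
  have hfin := nonpos_of_laplacian_nonneg (w := fun x => W x - 5 * m / 8) hVo hVb
    (hW2.continuous.sub continuous_const).continuousOn
    (fun x _ => (hW2.sub contDiff_const).contDiffAt)
    (fun x hx => by
      have := hW2.contDiffAt.laplacian_sub (x := x) (f₂ := fun _ => 5 * m / 8) contDiff_const.contDiffAt
      have he : (fun x => W x - 5 * m / 8) = W - fun _ => 5 * m / 8 := rfl
      rw [he, this]
      simpa using hWΔ x hx)
    (fun x hx => by
      have h1 := (abs_le.1 (hclose x (frontier_subset_closure hx))).2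
      have h2 := hVf x hx
      linarith)
    (z := z) ⟨hz, by linarith⟩
  have h1 := (abs_le.1 (hclose z (subset_closure ⟨hz, by linarith⟩))).1
  linarith

end WeakMaximumPrinciple

section WeakFormulation

variable {U : Set ℂ} {f ψ : ℂ → ℂ} {φ g : ℂ → ℝ} {C : ℝ}

lemma tsupport_laplacian_subset (φ : ℂ → ℝ) : tsupport (Δ φ) ⊆ tsupport φ := by
  refine closure_minimal (fun x hx => ?_) (isClosed_tsupport φ)
  by_contra hcon
  refine hx ?_
  have h1 : φ =ᶠ[𝓝 x] fun _ => 0 := by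
    rw [notMem_tsupport_iff_eventuallyEq] at hcon
    exact hcon
  rw [(laplacian_congr_nhds h1).self_of_nhds]
  simp

lemma contDiff_laplacian (hφ : ContDiff ℝ (⊤ : ℕ∞) φ) : ContDiff ℝ 1 (Δ φ) := by
  have : Δ φ = fun a => _ := funext (laplacian_apply_eq_fderiv φ)
  rw [this]
  have h1 : ContDiff ℝ 2 (fderiv ℝ φ) := (contDiff_infty.1 hφ 3).fderiv_right (by norm_num)
  have h2 : ContDiff ℝ 1 (fderiv ℝ (fderiv ℝ φ)) := h1.fderiv_right (by norm_num)
  exact ((h2.clm_apply contDiff_const).clm_apply contDiff_const).add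
    ((h2.clm_apply contDiff_const).clm_apply contDiff_const)

lemma exists_bound_laplacian (hφ : ContDiff ℝ (⊤ : ℕ∞) φ) (hc : HasCompactSupport φ) :
    ∃ C, ∀ z, ‖Δ φ z‖ ≤ C :=
  (contDiff_laplacian hφ).continuous.bounded_above_of_compact_support
    (hc.mono' ((subset_tsupport _).trans (tsupport_laplacian_subset φ)))

lemma greenOp_neg (g : ℂ → ℝ) (z : ℂ) : greenOp U f (fun w => -g w) z = -greenOp U f g z := by
  simp only [greenOp, mul_neg, integral_neg]

/-- A test function is recovered from its Laplacian by the Green operator. -/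
lemma IsRiemannPair.greenOp_laplacian (h : IsRiemannPair U f ψ) (hU : IsOpen U)
    (hb : Bornology.IsBounded U) (hφ : ContDiff ℝ (⊤ : ℕ∞) φ) (hc : HasCompactSupport φ)
    (hs : tsupport φ ⊆ U) (z : ℂ) : greenOp U f (Δ φ) z = -φ z := by
  have hoff : ∀ x, x ∉ U → φ x = 0 := fun x hx =>
    image_eq_zero_of_notMem_tsupport fun hx' => hx (hs hx')
  by_cases hz : z ∈ U
  swap
  · rw [greenOp_of_notMem hz, hoff z hz, neg_zero]
  obtain ⟨C, hC⟩ := exists_bound_laplacian hφ hc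
  have hm := (contDiff_laplacian hφ).continuous.measurable
  have hφ2 : ContDiff ℝ 2 φ := contDiff_infty.1 hφ 2
  have hT := h.continuous_greenOp hU hb hm hC
  have hreg : ∀ x ∈ U, _ := fun x hx =>
    h.laplacian_greenOp hU hb hm hC (contDiff_laplacian hφ).contDiffOn hx
  have hΔ : ∀ x ∈ U, Δ (greenOp U f (Δ φ) + φ) x = 0 := fun x hx => by
    rw [(hreg x hx).1.laplacian_add hφ2.contDiffAt, (hreg x hx).2]
    ring
  have h0 : ∀ x ∈ frontier U, (greenOp U f (Δ φ) + φ) x = 0 := fun x hx => by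
    have hxU : x ∉ U := fun hxU => hx.2 (by rwa [hU.interior_eq])
    rw [Pi.add_apply, greenOp_of_notMem hxU, hoff x hxU, add_zero]
  have hle := nonpos_of_laplacian_nonneg hU hb (hT.add hφ2.continuous).continuousOn
    (fun x hx => (hreg x hx).1.add hφ2.contDiffAt) (fun x hx => (hΔ x hx).ge)
    (fun x hx => (h0 x hx).le) hz
  have hge := nonpos_of_laplacian_nonneg (w := -(greenOp U f (Δ φ) + φ)) hU hb
    (hT.add hφ2.continuous).neg.continuousOn
    (fun x hx => ((hreg x hx).1.add hφ2.contDiffAt).neg)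
    (fun x hx => by rw [laplacian_neg, Pi.neg_apply, hΔ x hx, neg_zero])
    (fun x hx => by rw [Pi.neg_apply, h0 x hx, neg_zero]) hz
  simp only [Pi.neg_apply, Pi.add_apply] at hle hge
  linarith

/-- The Green operator solves `-Δu = g` in the sense of distributions. -/
lemma IsRiemannPair.integral_laplacian_mul_greenOp (h : IsRiemannPair U f ψ) (hU : IsOpen U)
    (hb : Bornology.IsBounded U) (hg : Measurable g) (hC : ∀ w, ‖g w‖ ≤ C)
    (hφ : ContDiff ℝ (⊤ : ℕ∞) φ) (hc : HasCompactSupport φ) (hs : tsupport φ ⊆ U) :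
    ∫ z in U, Δ φ z * greenOp U f g z = -∫ z in U, g z * φ z := by
  have hoff : ∀ x, x ∉ U → φ x = 0 := fun x hx =>
    image_eq_zero_of_notMem_tsupport fun hx' => hx (hs hx')
  rw [setIntegral_eq_integral_of_forall_compl_eq_zero (fun x hx => by
      rw [greenOp_of_notMem hx, mul_zero]),
    setIntegral_eq_integral_of_forall_compl_eq_zero (fun x hx => by rw [hoff x hx, mul_zero])]
  obtain ⟨C', hC'⟩ := exists_bound_laplacian hφ hc
  have hcont := (contDiff_laplacian hφ).continuous
  have hcΔ : HasCompactSupport (Δ φ) :=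
    hc.mono' ((subset_tsupport _).trans (tsupport_laplacian_subset φ))
  obtain ⟨B, hB⟩ := h.exists_integral_greenKernel_le hU hb
  have hGm := h.measurable_greenKernel hU
  have hFm : Measurable fun p : ℂ × ℂ => Δ φ p.1 * (greenKernel U f p.1 p.2 * g p.2) :=
    (hcont.measurable.comp measurable_fst).mul (hGm.mul (hg.comp measurable_snd))
  have hC0 : 0 ≤ C := (norm_nonneg _).trans (hC 0)
  have hF : Integrable (fun p : ℂ × ℂ => Δ φ p.1 * (greenKernel U f p.1 p.2 * g p.2))
      ((volume : Measure ℂ).prod volume) := by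
    rw [integrable_prod_iff hFm.aestronglyMeasurable]
    refine ⟨Eventually.of_forall fun z =>
      (h.integrable_greenKernel_mul hU hb hg hC z).const_mul (Δ φ z), ?_⟩
    refine ((hcont.integrable_of_hasCompactSupport hcΔ).norm.mul_const (C * B)).mono'
      hFm.norm.stronglyMeasurable.integral_prod_right.aestronglyMeasurable
      (Eventually.of_forall fun z => ?_)
    rw [Real.norm_of_nonneg (integral_nonneg fun w => norm_nonneg _)]
    simp_rw [norm_mul, integral_const_mul]
    refine mul_le_mul_of_nonneg_left ?_ (norm_nonneg _)
    have hinteg := h.integrable_greenKernel hU hb z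
    calc ∫ w, ‖greenKernel U f z w‖ * ‖g w‖ ≤ ∫ w, C * greenKernel U f z w := by
          refine integral_mono_of_nonneg (Eventually.of_forall fun w => by positivity)
            (hinteg.const_mul C) (Eventually.of_forall fun w => ?_)
          simp only
          rw [Real.norm_of_nonneg (h.greenKernel_nonneg z w), mul_comm]
          exact mul_le_mul_of_nonneg_right (hC w) (h.greenKernel_nonneg z w)
      _ ≤ C * B := by
          rw [integral_const_mul]
          exact mul_le_mul_of_nonneg_left (hB z) hC0
  calc ∫ z, Δ φ z * greenOp U f g z
      = ∫ z, ∫ w, Δ φ z * (greenKernel U f z w * g w) := by simp_rw [integral_const_mul]; rfl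
    _ = ∫ w, ∫ z, Δ φ z * (greenKernel U f z w * g w) := integral_integral_swap hF
    _ = ∫ w, -(g w * φ w) := by
        congr 1
        funext w
        rw [← mul_neg, ← h.greenOp_laplacian hU hb hφ hc hs w, greenOp, ← integral_const_mul]
        congr 1
        funext z
        rw [greenKernel_comm U f z w]
        ring
    _ = -∫ z, g z * φ z := integral_neg _

/-- Comparison of a weak subsolution with a Green potential. -/
lemma IsRiemannPair.le_greenOp (h : IsRiemannPair U f ψ) (hU : IsOpen U)
    (hb : Bornology.IsBounded U) (hg : Measurable g) (hC : ∀ w, ‖g w‖ ≤ C) {v k : ℂ → ℝ}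
    (hv : ContinuousOn v (closure U)) (hk : ContinuousOn k (closure U))
    (hv0 : ∀ z ∈ frontier U, v z ≤ 0)
    (hsub : ∀ φ : ℂ → ℝ, ContDiff ℝ (⊤ : ℕ∞) φ → HasCompactSupport φ → tsupport φ ⊆ U →
      (∀ z, 0 ≤ φ z) → ∫ z in U, -Δ φ z * v z ≤ ∫ z in U, k z * φ z)
    (hkg : ∀ z ∈ U, k z ≤ g z) {z : ℂ} (hz : z ∈ U) : v z ≤ greenOp U f g z := by
  have hT := h.continuous_greenOp hU hb hg hC
  have hK := hb.isCompact_closure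
  have hon : ∀ {F : ℂ → ℝ}, ContinuousOn F (closure U) → IntegrableOn F U := fun hF =>
    (hF.integrableOn_compact hK).mono_set subset_closure
  have hmain := nonpos_of_weak_laplacian_nonneg (w := fun x => v x - greenOp U f g x) hU hb
    (hv.sub hT.continuousOn) (fun φ hφ hc hs h0 => ?_) (fun x hx => ?_) hz
  · linarith
  · have hcont := (contDiff_laplacian hφ).continuous
    have h1 := hsub φ hφ hc hs h0
    have h2 := h.integral_laplacian_mul_greenOp hU hb hg hC hφ hc hs
    have hgφ : IntegrableOn (fun z => g z * φ z) U :=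
      (hon hφ.continuous.continuousOn).bdd_mul hg.aestronglyMeasurable (Eventually.of_forall hC)
    have h3 : ∫ z in U, k z * φ z ≤ ∫ z in U, g z * φ z :=
      setIntegral_mono_on (hon (hk.mul hφ.continuous.continuousOn)) hgφ hU.measurableSet
        fun x hx => mul_le_mul_of_nonneg_right (hkg x hx) (h0 x)
    simp_rw [mul_sub]
    have hi₁ : IntegrableOn (fun z => Δ φ z * v z) U := hon (hcont.continuousOn.mul hv)
    have hi₂ : IntegrableOn (fun z => Δ φ z * greenOp U f g z) U :=
      hon (hcont.continuousOn.mul hT.continuousOn)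
    rw [integral_sub hi₁ hi₂, h2]
    simp_rw [neg_mul, integral_neg] at h1
    linarith
  · have hxU : x ∉ U := fun hxU => hx.2 (by rwa [hU.interior_eq])
    rw [greenOp_of_notMem hxU, sub_zero]
    exact hv0 x hx

/-- Comparison of a weak supersolution with a Green potential. -/
lemma IsRiemannPair.greenOp_le (h : IsRiemannPair U f ψ) (hU : IsOpen U)
    (hb : Bornology.IsBounded U) (hg : Measurable g) (hC : ∀ w, ‖g w‖ ≤ C) {v k : ℂ → ℝ}
    (hv : ContinuousOn v (closure U)) (hk : ContinuousOn k (closure U))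
    (hv0 : ∀ z ∈ frontier U, 0 ≤ v z)
    (hsup : ∀ φ : ℂ → ℝ, ContDiff ℝ (⊤ : ℕ∞) φ → HasCompactSupport φ → tsupport φ ⊆ U →
      (∀ z, 0 ≤ φ z) → ∫ z in U, k z * φ z ≤ ∫ z in U, -Δ φ z * v z)
    (hkg : ∀ z ∈ U, g z ≤ k z) {z : ℂ} (hz : z ∈ U) : greenOp U f g z ≤ v z := by
  have hmain := h.le_greenOp (v := fun z => -v z) (k := fun z => -k z) hU hb hg.neg
    (fun w => by simpa using hC w) hv.neg hk.neg (fun x hx => by linarith [hv0 x hx])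
    (fun φ hφ hc hs h0 => by
      have := hsup φ hφ hc hs h0
      simp_rw [mul_neg, neg_mul, integral_neg] at this ⊢
      linarith)
    (fun x hx => neg_le_neg (hkg x hx)) hz
  have h2 := greenOp_neg (U := U) (f := f) g z
  have h3 : greenOp U f (-g) z = -greenOp U f g z := h2
  linarith

end WeakFormulation

section MonotoneIteration

variable {U : Set ℂ} {f ψ : ℂ → ℂ} {μ : ℝ}

/-- The source term `μ eᵘ` on `U`. -/
def expSource (U : Set ℂ) (μ : ℝ) (u : ℂ → ℝ) : ℂ → ℝ := U.indicator fun z => μ * Real.exp (u z)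

lemma measurable_expSource (hU : IsOpen U) {u : ℂ → ℝ} (hu : Measurable u) :
    Measurable (expSource U μ u) := (hu.exp.const_mul μ).indicator hU.measurableSet

lemma norm_expSource_le (hμ : 0 < μ) {u : ℂ → ℝ} {M : ℝ} (hM : ∀ z ∈ U, u z ≤ M) (z : ℂ) :
    ‖expSource U μ u z‖ ≤ μ * Real.exp M := by
  by_cases hz : z ∈ U
  · rw [expSource, indicator_of_mem hz, Real.norm_of_nonneg (by positivity)]
    have := hM z hz
    gcongr
  · rw [expSource, indicator_of_notMem hz, norm_zero]
    positivity

lemma expSource_mono (hμ : 0 < μ) {u v : ℂ → ℝ} (huv : ∀ z ∈ U, u z ≤ v z) (z : ℂ) :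
    expSource U μ u z ≤ expSource U μ v z := by
  refine indicator_le_indicator' fun hz => ?_
  have := huv z hz
  gcongr

/-- The monotone iteration `uₙ₊₁ = (-Δ)⁻¹ (μ exp uₙ)` started at `u₀`. -/
def expIterate (U : Set ℂ) (f : ℂ → ℂ) (μ : ℝ) (u₀ : ℂ → ℝ) : ℕ → ℂ → ℝ
  | 0 => U.indicator u₀
  | n + 1 => greenOp U f (expSource U μ (expIterate U f μ u₀ n))

/-- The method of sub- and supersolutions for `-Δu = μ eᵘ` on a bounded simply connected
planar domain. -/
theorem exists_solution_between (hU : IsOpen U) (hb : Bornology.IsBounded U)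
    (hs : IsSimplyConnected U) (hμ : 0 < μ) {v₁ v₂ : ℂ → ℝ}
    (hc₁ : ContinuousOn v₁ (closure U)) (hc₂ : ContinuousOn v₂ (closure U))
    (h₁ : ∀ z ∈ frontier U, v₁ z ≤ 0) (h₂ : ∀ z ∈ frontier U, 0 ≤ v₂ z)
    (hsub : ∀ φ : ℂ → ℝ, ContDiff ℝ (⊤ : ℕ∞) φ → HasCompactSupport φ → tsupport φ ⊆ U →
      (∀ z, 0 ≤ φ z) → ∫ z in U, -Δ φ z * v₁ z ≤ ∫ z in U, μ * Real.exp (v₁ z) * φ z)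
    (hsup : ∀ φ : ℂ → ℝ, ContDiff ℝ (⊤ : ℕ∞) φ → HasCompactSupport φ → tsupport φ ⊆ U →
      (∀ z, 0 ≤ φ z) → ∫ z in U, μ * Real.exp (v₂ z) * φ z ≤ ∫ z in U, -Δ φ z * v₂ z)
    (hle : ∀ z ∈ U, v₁ z ≤ v₂ z) :
    ∃ u : ℂ → ℝ, Continuous u ∧ (∀ z ∉ U, u z = 0) ∧
      (∀ z ∈ U, ContDiffAt ℝ 2 u z ∧ -Δ u z = μ * Real.exp (u z)) ∧
      ∀ z ∈ U, v₁ z ≤ u z ∧ u z ≤ v₂ z := by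
  obtain ⟨f, ψ, h⟩ := exists_isRiemannPair hU hb hs
  obtain ⟨M, hM⟩ := hb.isCompact_closure.exists_bound_of_continuousOn hc₂
  have hM₂ : ∀ z ∈ U, v₂ z ≤ M := fun z hz => (le_abs_self _).trans (hM z (subset_closure hz))
  have hexp : ∀ {v : ℂ → ℝ}, ContinuousOn v (closure U) →
      ContinuousOn (fun z => μ * Real.exp (v z)) (closure U) := fun hv =>
    continuousOn_const.mul hv.rexp
  set F := expIterate U f μ v₁ with hF
  have hbound : ∀ n, Measurable (F n) ∧ ∀ z ∈ U, v₁ z ≤ F n z ∧ F n z ≤ v₂ z := by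
    intro n
    induction n with
    | zero =>
      refine ⟨?_, fun z hz => ?_⟩
      · classical
        have : F 0 = U.piecewise v₁ 0 := (piecewise_eq_indicator (s := U) (f := v₁)).symm
        rw [this]
        exact (hc₁.mono subset_closure).measurable_piecewise continuousOn_const hU.measurableSet
      · have : F 0 z = v₁ z := indicator_of_mem hz v₁
        rw [this]
        exact ⟨le_rfl, hle z hz⟩
    | succ n ih =>
      obtain ⟨hm, hn⟩ := ih
      have hgm := measurable_expSource (μ := μ) hU hm
      have hgb := norm_expSource_le hμ fun z hz => (hn z hz).2.trans (hM₂ z hz)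
      refine ⟨(h.continuous_greenOp hU hb hgm hgb).measurable, fun z hz => ⟨?_, ?_⟩⟩
      · refine h.le_greenOp hU hb hgm hgb hc₁ (hexp hc₁) h₁ hsub (fun x hx => ?_) hz
        rw [expSource, indicator_of_mem hx]
        have := (hn x hx).1
        gcongr
      · refine h.greenOp_le hU hb hgm hgb hc₂ (hexp hc₂) h₂ hsup (fun x hx => ?_) hz
        rw [expSource, indicator_of_mem hx]
        have := (hn x hx).2
        gcongr
  have hgm : ∀ n, Measurable (expSource U μ (F n)) := fun n => measurable_expSource hU (hbound n).1
  have hgb : ∀ n z, ‖expSource U μ (F n) z‖ ≤ μ * Real.exp M := fun n =>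
    norm_expSource_le hμ fun z hz => ((hbound n).2 z hz).2.trans (hM₂ z hz)
  have hoff : ∀ n, ∀ z ∉ U, F n z = 0 := fun n z hz => by
    cases n with
    | zero => exact indicator_of_notMem hz v₁
    | succ n => exact greenOp_of_notMem hz
  have hmono : ∀ z, Monotone fun n => F n z := by
    have hstep : ∀ n, ∀ z ∈ U, F n z ≤ F (n + 1) z := by
      intro n
      induction n with
      | zero =>
        intro z hz
        have : F 0 z = v₁ z := indicator_of_mem hz v₁
        rw [this]
        exact ((hbound 1).2 z hz).1
      | succ n ih =>
        intro z _
        exact h.greenOp_mono hU hb (hgm n) (hgb n) (hgm (n + 1)) (hgb (n + 1))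
          (expSource_mono hμ ih) z
    refine fun z => monotone_nat_of_le_succ fun n => ?_
    by_cases hz : z ∈ U
    · exact hstep n z hz
    · rw [hoff n z hz, hoff (n + 1) z hz]
  have hlim : ∀ z, Tendsto (fun n => F n z) atTop (𝓝 (⨆ n, F n z)) := fun z => by
    refine tendsto_atTop_ciSup (hmono z) ⟨max M 0, ?_⟩
    rintro _ ⟨n, rfl⟩
    by_cases hz : z ∈ U
    · exact (((hbound n).2 z hz).2.trans (hM₂ z hz)).trans (le_max_left _ _)
    · simp only [hoff n z hz]
      exact le_max_right _ _
  set u : ℂ → ℝ := fun z => ⨆ n, F n z with hu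
  have hum : Measurable u := measurable_of_tendsto_metrizable (fun n => (hbound n).1)
    (tendsto_pi_nhds.2 hlim)
  have hub : ∀ z ∈ U, v₁ z ≤ u z ∧ u z ≤ v₂ z := fun z hz =>
    ⟨ge_of_tendsto' (hlim z) fun n => ((hbound n).2 z hz).1,
      le_of_tendsto' (hlim z) fun n => ((hbound n).2 z hz).2⟩
  have hum' := measurable_expSource (μ := μ) hU hum
  have hub' := norm_expSource_le hμ fun z hz => (hub z hz).2.trans (hM₂ z hz)
  have hfix : u = greenOp U f (expSource U μ u) := by
    funext z
    refine tendsto_nhds_unique ((hlim z).comp (tendsto_add_atTop_nat 1)) ?_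
    refine tendsto_integral_of_dominated_convergence
      (F := fun n w => greenKernel U f z w * expSource U μ (F n) w)
      (fun w => greenKernel U f z w * (μ * Real.exp M))
      (fun n => (h.integrable_greenKernel_mul hU hb (hgm n) (hgb n) z).aestronglyMeasurable)
      ((h.integrable_greenKernel hU hb z).mul_const _)
      (fun n => Eventually.of_forall fun w => ?_) (Eventually.of_forall fun w => ?_)
    · rw [norm_mul, Real.norm_of_nonneg (h.greenKernel_nonneg z w)]
      exact mul_le_mul_of_nonneg_left (hgb n w) (h.greenKernel_nonneg z w)
    · refine Tendsto.const_mul _ ?_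
      by_cases hw : w ∈ U
      · simp only [expSource, indicator_of_mem hw]
        exact ((Real.continuous_exp.tendsto _).comp (hlim w)).const_mul μ
      · simp only [expSource, indicator_of_notMem hw]
        exact tendsto_const_nhds
  have hC1 : ContDiffOn ℝ 1 (expSource U μ u) U := by
    have h1 : ContDiffOn ℝ 1 u U := fun z hz => by
      rw [hfix]
      exact (h.contDiffAt_greenOp hU hb hum' hub' hz).contDiffWithinAt
    exact (contDiffOn_const.mul h1.exp).congr fun z hz => indicator_of_mem hz _
  refine ⟨u, ?_, fun z hz => ?_, fun z hz => ?_, hub⟩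
  · rw [hfix]
    exact h.continuous_greenOp hU hb hum' hub'
  · rw [hfix]
    exact greenOp_of_notMem hz
  · have h1 := h.laplacian_greenOp hU hb hum' hub' hC1 hz
    rw [← hfix] at h1
    refine ⟨h1.1, ?_⟩
    rw [h1.2, neg_neg, expSource, indicator_of_mem hz]

end MonotoneIteration

section Transfer

/-- The standard isometric identification of `ℂ` with the Euclidean plane. -/
abbrev planeEquiv : ℂ ≃ₗᵢ[ℝ] R2 := Complex.orthonormalBasisOneI.repr

/-- The coordinate Laplacian of a function on the plane agrees with the Laplacian of the
corresponding function on `ℂ`. -/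
lemma lap_comp_planeEquiv_symm {w : ℂ → ℝ} {z : ℂ} (hw : ContDiffAt ℝ 2 w z) :
    lap (w ∘ planeEquiv.symm) (planeEquiv z) = Δ w z := by
  have h0 : planeEquiv.symm (EuclideanSpace.single (0 : Fin 2) (1 : ℝ)) = 1 := by
    simp
  have h1 : planeEquiv.symm (EuclideanSpace.single (1 : Fin 2) (1 : ℝ)) = Complex.I := by
    simp
  rw [lap, Fin.sum_univ_two, laplacian_apply_eq_fderiv, ← deriv_deriv_line hw,
    ← deriv_deriv_line hw]
  simp only [iteratedDeriv_succ, iteratedDeriv_zero, Function.comp_apply, map_add, map_smul,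
    LinearIsometryEquiv.symm_apply_apply, h0, h1]

lemma isTestFun_comp_planeEquiv_symm {Ω : Set R2} {φ : ℂ → ℝ} (hφ : ContDiff ℝ (⊤ : ℕ∞) φ)
    (hc : HasCompactSupport φ) (hs : tsupport φ ⊆ planeEquiv ⁻¹' Ω) :
    IsTestFun Ω (φ ∘ planeEquiv.symm) := by
  refine ⟨hφ.comp planeEquiv.symm.contDiff,
    hc.comp_homeomorph planeEquiv.symm.toHomeomorph, fun p hp => ?_⟩
  have h := hs (tsupport_comp_subset_preimage φ planeEquiv.symm.continuous hp)
  rwa [mem_preimage, planeEquiv.apply_symm_apply] at h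

lemma setIntegral_planeEquiv (Ω : Set R2) (g : R2 → ℝ) :
    ∫ z in planeEquiv ⁻¹' Ω, g (planeEquiv z) = ∫ p in Ω, g p :=
  planeEquiv.measurePreserving.setIntegral_preimage_emb
    planeEquiv.toHomeomorph.measurableEmbedding g Ω

lemma setIntegral_neg_lap_mul (Ω : Set R2) {φ : ℂ → ℝ} (hφ : ContDiff ℝ (⊤ : ℕ∞) φ)
    (v : R2 → ℝ) :
    ∫ p in Ω, (-lap (φ ∘ planeEquiv.symm) p) * v p =
      ∫ z in planeEquiv ⁻¹' Ω, -Δ φ z * v (planeEquiv z) := by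
  rw [← setIntegral_planeEquiv]
  congr 1 with z
  rw [lap_comp_planeEquiv_symm (contDiff_infty.1 hφ 2).contDiffAt]

lemma mul_setIntegral_exp_mul (Ω : Set R2) (μ : ℝ) (φ : ℂ → ℝ) (v : R2 → ℝ) :
    μ * ∫ p in Ω, Real.exp (v p) * (φ ∘ planeEquiv.symm) p =
      ∫ z in planeEquiv ⁻¹' Ω, μ * Real.exp (v (planeEquiv z)) * φ z := by
  rw [← integral_const_mul, ← setIntegral_planeEquiv]
  congr 1 with z
  simp [mul_assoc]

end Transfer

end Potential

/-- The sub-supersolutions method for `Q(μ,Ω)` on a simple domain: between an ordered pair of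
a (weak, continuous) subsolution and supersolution there is a classical solution of
`−Δu = μ eᵘ`, `u = 0` on `∂Ω`. -/
theorem statement9 (Ω : Set R2) (μ : ℝ) (hΩ : IsSimpleDomain Ω) (hμ : 0 < μ)
    (usub usup : R2 → ℝ)
    (hsubc : ContinuousOn usub (closure Ω)) (hsupc : ContinuousOn usup (closure Ω))
    (hsub0 : ∀ p ∈ frontier Ω, usub p ≤ 0) (hsup0 : ∀ p ∈ frontier Ω, 0 ≤ usup p)
    (hsub : ∀ φ : R2 → ℝ, IsTestFun Ω φ → (∀ p, 0 ≤ φ p) →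
      (∫ p in Ω, (-lap φ p) * usub p) ≤ μ * ∫ p in Ω, Real.exp (usub p) * φ p)
    (hsup : ∀ φ : R2 → ℝ, IsTestFun Ω φ → (∀ p, 0 ≤ φ p) →
      μ * (∫ p in Ω, Real.exp (usup p) * φ p) ≤ ∫ p in Ω, (-lap φ p) * usup p)
    (hle : ∀ p ∈ Ω, usub p ≤ usup p) :
    ∃ u : R2 → ℝ, ContDiffOn ℝ 2 u Ω ∧ ContinuousOn u (closure Ω) ∧
      (∀ p ∈ Ω, -lap u p = μ * Real.exp (u p)) ∧ (∀ p ∈ frontier Ω, u p = 0) ∧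
      ∀ p ∈ Ω, usub p ≤ u p ∧ u p ≤ usup p := by
  obtain ⟨hΩo, hΩb, hΩs, -⟩ := hΩ
  set e := planeEquiv with he
  have hcl : e ⁻¹' closure Ω = closure (e ⁻¹' Ω) := e.toHomeomorph.preimage_closure Ω
  have hfr : e ⁻¹' frontier Ω = frontier (e ⁻¹' Ω) := e.toHomeomorph.preimage_frontier Ω
  have hcont : ∀ v : R2 → ℝ, ContinuousOn v (closure Ω) →
      ContinuousOn (fun z => v (e z)) (closure (e ⁻¹' Ω)) := fun v hv =>
    hv.comp e.continuous.continuousOn fun z hz => by rwa [← hcl] at hz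
  obtain ⟨w, hwc, hw0, hw, hwb⟩ := exists_solution_between (U := e ⁻¹' Ω) (μ := μ)
    (v₁ := fun z => usub (e z)) (v₂ := fun z => usup (e z))
    (hΩo.preimage e.continuous) (e.antilipschitz.isBounded_preimage hΩb)
    ((Homeomorph.isSimplyConnected_preimage (f := e.toHomeomorph)).2 hΩs) hμ
    (hcont _ hsubc) (hcont _ hsupc)
    (fun z hz => hsub0 _ (by rwa [← hfr] at hz)) (fun z hz => hsup0 _ (by rwa [← hfr] at hz))
    (fun φ hφ hc hs hφ0 => by
      have h := hsub _ (isTestFun_comp_planeEquiv_symm hφ hc hs) fun p => hφ0 _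
      rwa [setIntegral_neg_lap_mul Ω hφ, mul_setIntegral_exp_mul] at h)
    (fun φ hφ hc hs hφ0 => by
      have h := hsup _ (isTestFun_comp_planeEquiv_symm hφ hc hs) fun p => hφ0 _
      rwa [setIntegral_neg_lap_mul Ω hφ, mul_setIntegral_exp_mul] at h)
    (fun z hz => hle _ hz)
  have hmem : ∀ p ∈ Ω, e.symm p ∈ e ⁻¹' Ω := fun p hp => by simpa using hp
  refine ⟨w ∘ e.symm, fun p hp => ?_, (hwc.comp e.symm.continuous).continuousOn,
    fun p hp => ?_, fun p hp => hw0 _ ?_, fun p hp => ?_⟩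
  · exact ((hw _ (hmem p hp)).1.comp p e.symm.contDiff.contDiffAt).contDiffWithinAt
  · have h := hw _ (hmem p hp)
    have h' := lap_comp_planeEquiv_symm h.1
    rw [← he, e.apply_symm_apply] at h'
    rw [h', h.2, Function.comp_apply]
  · rw [hΩo.frontier_eq] at hp
    simpa using hp.2
  · simpa using hwb _ (hmem p hp)
end
end

section
/- Let α ∈ (0,1], m ∈ ℝ, and let ψ₀(x,y) = (1 − α²x² − y²)/(2(1+α²)) on the ellipse ω_α. If φ₁ ∈ C²(ω_α) ∩ C¹(cl ω_α) satisfies −Δφ₁ = m ψ₀ in ω_α with φ₁ = 0 on ∂ω_α, then ∫_{ω_α} φ₁ = m ∫_{ω_α} ψ₀² = m π / (12 α (1+α²)²). -/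
open MeasureTheory Real Set Filter

noncomputable section

/-- The open ellipse `ω_α = {α²x² + y² < 1}` with semi-axes `1/α` and `1`. -/
def ellipseO (α : ℝ) : Set R2 := {p | α ^ 2 * p 0 ^ 2 + p 1 ^ 2 < 1}

/-- The second derivative at `0` of a real polynomial of degree at most four. -/
lemma iteratedDeriv_two_quartic (a b c d e : ℝ) :
    iteratedDeriv 2 (fun t : ℝ => a + b * t + c * t ^ 2 + d * t ^ 3 + e * t ^ 4) 0 = 2 * c := by
  have hd : deriv (fun t : ℝ => a + b * t + c * t ^ 2 + d * t ^ 3 + e * t ^ 4) =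
      fun t => b + 2 * c * t + 3 * d * t ^ 2 + 4 * e * t ^ 3 := by
    funext t
    have h := ((((hasDerivAt_const t a).add ((hasDerivAt_id t).const_mul b)).add
      ((hasDerivAt_pow 2 t).const_mul c)).add ((hasDerivAt_pow 3 t).const_mul d)).add
      ((hasDerivAt_pow 4 t).const_mul e)
    refine HasDerivAt.deriv (h.congr_deriv ?_)
    norm_num
    ring
  rw [iteratedDeriv_succ, iteratedDeriv_one, hd]
  have h := (((hasDerivAt_const (0 : ℝ) b).add ((hasDerivAt_id (0 : ℝ)).const_mul (2 * c))).add
    ((hasDerivAt_pow 2 (0 : ℝ)).const_mul (3 * d))).add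
    ((hasDerivAt_pow 3 (0 : ℝ)).const_mul (4 * e))
  refine HasDerivAt.deriv (h.congr_deriv ?_)
  norm_num

/-- At a local maximum the second derivative is nonpositive. -/
lemma IsLocalMax.iteratedDeriv_two_nonpos {g : ℝ → ℝ} {x : ℝ} (hmax : IsLocalMax g x)
    (hc : ContinuousAt g x) : iteratedDeriv 2 g x ≤ 0 := by
  rw [iteratedDeriv_succ, iteratedDeriv_one]
  by_contra! hpos
  have hmin := isLocalMin_of_deriv_deriv_pos hpos hmax.deriv_eq_zero hc
  have hconst : g =ᶠ[nhds x] fun _ => g x := by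
    filter_upwards [hmax, hmin] with y h₁ h₂ using le_antisymm h₁ h₂
  have h0 : deriv g =ᶠ[nhds x] deriv fun _ => g x := hconst.deriv
  rw [h0.deriv_eq] at hpos
  simp at hpos

/-- Restricting a `C²` function to a coordinate line gives a `C²` function. -/
lemma ContDiffAt.comp_coordinate_line {u : R2 → ℝ} {p : R2} (h : ContDiffAt ℝ 2 u p)
    (i : Fin 2) :
    ContDiffAt ℝ 2 (fun t : ℝ => u (p + t • EuclideanSpace.single i (1 : ℝ))) 0 := by
  have hl : ContDiffAt ℝ 2 (fun t : ℝ => p + t • (EuclideanSpace.single i (1 : ℝ) : R2)) 0 := by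
    fun_prop
  have h' : ContDiffAt ℝ 2 u (p + (0 : ℝ) • (EuclideanSpace.single i (1 : ℝ) : R2)) := by
    simpa using h
  exact h'.comp (0 : ℝ) hl

lemma lap_add {u v : R2 → ℝ} {p : R2} (hu : ContDiffAt ℝ 2 u p) (hv : ContDiffAt ℝ 2 v p) :
    lap (fun x => u x + v x) p = lap u p + lap v p := by
  simp only [lap, ← Finset.sum_add_distrib]
  refine Finset.sum_congr rfl fun i _ => ?_
  exact iteratedDeriv_fun_add (hu.comp_coordinate_line i) (hv.comp_coordinate_line i)

lemma lap_neg (u : R2 → ℝ) (p : R2) : lap (fun x => -u x) p = -lap u p := by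
  simp only [lap, ← Finset.sum_neg_distrib]
  refine Finset.sum_congr rfl fun i _ => ?_
  exact iteratedDeriv_fun_neg _ _ _

lemma lap_eq_of_quartic {u : R2 → ℝ} {p : R2} {a b c d e a' b' c' d' e' : ℝ}
    (hx : ∀ t : ℝ, u (p + t • EuclideanSpace.single 0 (1 : ℝ)) =
      a + b * t + c * t ^ 2 + d * t ^ 3 + e * t ^ 4)
    (hy : ∀ t : ℝ, u (p + t • EuclideanSpace.single 1 (1 : ℝ)) =
      a' + b' * t + c' * t ^ 2 + d' * t ^ 3 + e' * t ^ 4) :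
    lap u p = 2 * c + 2 * c' := by
  simp only [lap, Fin.sum_univ_two, funext hx, funext hy, iteratedDeriv_two_quartic]

lemma lap_normSq (ε : ℝ) (p : R2) : lap (fun x => ε * (x 0 ^ 2 + x 1 ^ 2)) p = 4 * ε := by
  rw [lap_eq_of_quartic (a := ε * (p 0 ^ 2 + p 1 ^ 2)) (b := 2 * ε * p 0) (c := ε) (d := 0)
    (e := 0) (a' := ε * (p 0 ^ 2 + p 1 ^ 2)) (b' := 2 * ε * p 1) (c' := ε) (d' := 0) (e' := 0)]
  · ring
  · intro t; simp; ring
  · intro t; simp; ring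

lemma lap_ellipse_quartic (a A B C : ℝ) (p : R2) :
    lap (fun x => (1 - (a * x 0 ^ 2 + x 1 ^ 2)) * (A + B * x 0 ^ 2 + C * x 1 ^ 2)) p =
      -2 * (1 + a) * (A + B * p 0 ^ 2 + C * p 1 ^ 2) - 8 * a * B * p 0 ^ 2 - 8 * C * p 1 ^ 2 +
        2 * (1 - (a * p 0 ^ 2 + p 1 ^ 2)) * (B + C) := by
  rw [lap_eq_of_quartic
    (a := (1 - (a * p 0 ^ 2 + p 1 ^ 2)) * (A + B * p 0 ^ 2 + C * p 1 ^ 2))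
    (b := (1 - (a * p 0 ^ 2 + p 1 ^ 2)) * (2 * B * p 0) -
      2 * a * p 0 * (A + B * p 0 ^ 2 + C * p 1 ^ 2))
    (c := (1 - (a * p 0 ^ 2 + p 1 ^ 2)) * B - 4 * a * B * p 0 ^ 2 -
      a * (A + B * p 0 ^ 2 + C * p 1 ^ 2))
    (d := -(4 * a * B * p 0)) (e := -(a * B))
    (a' := (1 - (a * p 0 ^ 2 + p 1 ^ 2)) * (A + B * p 0 ^ 2 + C * p 1 ^ 2))
    (b' := (1 - (a * p 0 ^ 2 + p 1 ^ 2)) * (2 * C * p 1) -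
      2 * p 1 * (A + B * p 0 ^ 2 + C * p 1 ^ 2))
    (c' := (1 - (a * p 0 ^ 2 + p 1 ^ 2)) * C - 4 * C * p 1 ^ 2 -
      (A + B * p 0 ^ 2 + C * p 1 ^ 2))
    (d' := -(4 * C * p 1)) (e' := -C)]
  · ring
  · intro t; simp; ring
  · intro t; simp; ring

/-- Weak maximum principle for subharmonic functions on a bounded open set. -/
lemma nonpos_of_lap_nonneg {U : Set R2} (hU : IsOpen U) (hb : Bornology.IsBounded U)
    {u : R2 → ℝ} (hc : ContinuousOn u (closure U)) (h2 : ContDiffOn ℝ 2 u U)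
    (hlap : ∀ p ∈ U, 0 ≤ lap u p) (hbd : ∀ p ∈ frontier U, u p ≤ 0) {p : R2} (hp : p ∈ U) :
    u p ≤ 0 := by
  by_contra! hpos
  have hK : IsCompact (closure U) := hb.isCompact_closure
  have hN : ContinuousOn (fun x : R2 => x 0 ^ 2 + x 1 ^ 2) (closure U) := by fun_prop
  obtain ⟨z, -, hz⟩ := hK.exists_isMaxOn ⟨p, subset_closure hp⟩ hN
  set R : ℝ := z 0 ^ 2 + z 1 ^ 2
  have hR : 0 ≤ R := by positivity
  obtain ⟨ε, hε, hεR⟩ : ∃ ε : ℝ, 0 < ε ∧ ε * R < u p := by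
    refine ⟨u p / (R + 1), by positivity, ?_⟩
    rw [div_mul_eq_mul_div, div_lt_iff₀ (by positivity)]
    nlinarith
  obtain ⟨q, hq, hqmax⟩ := hK.exists_isMaxOn ⟨p, subset_closure hp⟩
    (hc.add (hN.const_smul ε))
  have hqp := hqmax (subset_closure hp)
  have hqR := hz hq
  simp only [mem_ofPred_eq, smul_eq_mul, Pi.add_apply, Pi.smul_apply] at hqp hqR
  have hNp : 0 ≤ ε * (p 0 ^ 2 + p 1 ^ 2) := by positivity
  have hqpos : 0 < u q := by
    have := mul_le_mul_of_nonneg_left hqR hε.le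
    linarith
  have hqU : q ∈ U := by
    by_contra hn
    have : q ∈ frontier U := by rw [hU.frontier_eq]; exact ⟨hq, hn⟩
    linarith [hbd q this]
  have hu : ContDiffAt ℝ 2 u q := h2.contDiffAt (hU.mem_nhds hqU)
  have hn2 : ContDiffAt ℝ 2 (fun x : R2 => ε * (x 0 ^ 2 + x 1 ^ 2)) q := by fun_prop
  have hlv := lap_add hu hn2
  rw [lap_normSq] at hlv
  have hmax : IsLocalMax (fun x : R2 => u x + ε * (x 0 ^ 2 + x 1 ^ 2)) q := by
    filter_upwards [hU.mem_nhds hqU] with x hx using hqmax (subset_closure hx)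
  have hle : lap (fun x : R2 => u x + ε * (x 0 ^ 2 + x 1 ^ 2)) q ≤ 0 := by
    refine Finset.sum_nonpos fun i _ => ?_
    have hline : Tendsto (fun t : ℝ => q + t • (EuclideanSpace.single i (1 : ℝ) : R2))
        (nhds 0) (nhds q) := by
      have : Continuous fun t : ℝ => q + t • (EuclideanSpace.single i (1 : ℝ) : R2) := by
        fun_prop
      simpa using this.tendsto 0
    refine IsLocalMax.iteratedDeriv_two_nonpos ?_
      ((hu.add hn2).comp_coordinate_line i).continuousAt
    filter_upwards [hline.eventually hmax] with t ht
    simpa using ht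
  linarith [hlap q hqU]

/-- Functions with the same Laplacian and the same boundary values on a bounded open set agree. -/
lemma eqOn_of_lap_eq {U : Set R2} (hU : IsOpen U) (hb : Bornology.IsBounded U)
    {u v : R2 → ℝ} (huc : ContinuousOn u (closure U)) (hvc : ContinuousOn v (closure U))
    (hu : ContDiffOn ℝ 2 u U) (hv : ContDiffOn ℝ 2 v U)
    (hlap : ∀ p ∈ U, lap u p = lap v p) (hbd : ∀ p ∈ frontier U, u p = v p) :
    EqOn u v U := by
  have key : ∀ {f g : R2 → ℝ}, ContinuousOn f (closure U) → ContinuousOn g (closure U) →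
      ContDiffOn ℝ 2 f U → ContDiffOn ℝ 2 g U → (∀ p ∈ U, lap f p = lap g p) →
      (∀ p ∈ frontier U, f p = g p) → ∀ p ∈ U, f p ≤ g p := by
    intro f g hfc hgc hf hg hl hfg p hp
    have h := nonpos_of_lap_nonneg hU hb (u := fun x => f x + -g x) (hfc.add hgc.neg)
      (hf.add hg.neg) (fun q hq => ?_) (fun q hq => by simp [hfg q hq]) hp
    · linarith
    · have hq' := hU.mem_nhds hq
      rw [lap_add (hf.contDiffAt hq') (hg.contDiffAt hq').neg, lap_neg, hl q hq]
      simp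
  intro p hp
  exact le_antisymm (key huc hvc hu hv hlap hbd p hp)
    (key hvc huc hv hu (fun q hq => (hlap q hq).symm) (fun q hq => (hbd q hq).symm) p hp)

lemma isOpen_ellipseO (α : ℝ) : IsOpen (ellipseO α) :=
  isOpen_lt (by fun_prop) continuous_const

lemma isBounded_ellipseO {α : ℝ} (hα : α ≠ 0) : Bornology.IsBounded (ellipseO α) := by
  refine (isBounded_iff_forall_norm_le).2 ⟨√(1 / α ^ 2 + 1), fun p hp => ?_⟩
  have hp' : α ^ 2 * p 0 ^ 2 + p 1 ^ 2 < 1 := hp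
  rw [EuclideanSpace.norm_eq]
  apply Real.sqrt_le_sqrt
  simp only [Fin.sum_univ_two, Real.norm_eq_abs, sq_abs]
  have h0 : p 0 ^ 2 ≤ 1 / α ^ 2 := by
    rw [le_div_iff₀ (by positivity)]
    nlinarith [sq_nonneg (p 1)]
  nlinarith [mul_nonneg (sq_nonneg α) (sq_nonneg (p 0))]

lemma eq_one_of_mem_frontier_ellipseO {α : ℝ} {p : R2} (hp : p ∈ frontier (ellipseO α)) :
    α ^ 2 * p 0 ^ 2 + p 1 ^ 2 = 1 :=
  frontier_lt_subset_eq (f := fun p : R2 => α ^ 2 * p 0 ^ 2 + p 1 ^ 2) (by fun_prop)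
    continuous_const hp

/-- The integral over the unit disc of `(1 - r²)(A + B x² + C y²)`. -/
lemma integral_disc (A B C : ℝ) :
    ∫ p : ℝ × ℝ, {p : ℝ × ℝ | p.1 ^ 2 + p.2 ^ 2 < 1}.indicator
      (fun p => (1 - (p.1 ^ 2 + p.2 ^ 2)) * (A + B * p.1 ^ 2 + C * p.2 ^ 2)) p =
      π / 2 * A + π / 12 * (B + C) := by
  set F : ℝ × ℝ → ℝ := fun q => q.1 * ((1 - q.1 ^ 2) *
    (A + B * (q.1 * cos q.2) ^ 2 + C * (q.1 * sin q.2) ^ 2)) with hF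
  rw [← integral_comp_polarCoord_symm]
  have hpolar : ∀ q ∈ polarCoord.target, q.1 • {p : ℝ × ℝ | p.1 ^ 2 + p.2 ^ 2 < 1}.indicator
      (fun p => (1 - (p.1 ^ 2 + p.2 ^ 2)) * (A + B * p.1 ^ 2 + C * p.2 ^ 2))
      (polarCoord.symm q) = (Iio 1 ×ˢ univ).indicator F q := by
    rintro ⟨r, θ⟩ ⟨hr, -⟩
    have hr : 0 < r := hr
    have hsq : (r * cos θ) ^ 2 + (r * sin θ) ^ 2 = r ^ 2 := by
      rw [mul_pow, mul_pow, ← mul_add, cos_sq_add_sin_sq, mul_one]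
    by_cases h : r < 1
    · have h' : r ^ 2 < 1 := by nlinarith
      simp [indicator, polarCoord, hsq, h, h', hF]
    · have h' : ¬ r ^ 2 < 1 := by nlinarith
      simp [indicator, polarCoord, hsq, h, h']
  have hset : polarCoord.target ∩ Iio 1 ×ˢ univ = Ioo (0 : ℝ) 1 ×ˢ Ioo (-π) π := by
    ext ⟨r, θ⟩
    simp only [polarCoord_target, mem_inter_iff, mem_prod, mem_Ioi, mem_Ioo, mem_Iio, mem_univ]
    tauto
  have hFc : Continuous F := by fun_prop
  rw [setIntegral_congr_fun polarCoord.open_target.measurableSet hpolar,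
    setIntegral_indicator (measurableSet_Iio.prod MeasurableSet.univ), hset,
    Measure.volume_eq_prod, setIntegral_prod]
  · have hinner : ∀ r : ℝ, ∫ θ in Ioo (-π) π, F (r, θ) =
        2 * π * A * (r - r ^ 3) + π * (B + C) * (r ^ 3 - r ^ 5) := by
      intro r
      rw [← integral_Ioc_eq_integral_Ioo, ← intervalIntegral.integral_of_le (by linarith [pi_pos])]
      have : ∀ θ, F (r, θ) = r * (1 - r ^ 2) * A + r ^ 3 * (1 - r ^ 2) * B * cos θ ^ 2 +
          r ^ 3 * (1 - r ^ 2) * C * sin θ ^ 2 := fun θ => by simp only [hF]; ring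
      simp only [this]
      rw [intervalIntegral.integral_add, intervalIntegral.integral_add,
        intervalIntegral.integral_const,
        intervalIntegral.integral_const_mul, intervalIntegral.integral_const_mul,
        integral_cos_sq, integral_sin_sq]
      · simp; ring
      all_goals exact Continuous.intervalIntegrable (by fun_prop) _ _
    simp only [hinner]
    rw [← integral_Ioc_eq_integral_Ioo, ← intervalIntegral.integral_of_le zero_le_one,
      intervalIntegral.integral_add, intervalIntegral.integral_const_mul,
      intervalIntegral.integral_const_mul, intervalIntegral.integral_sub,
      intervalIntegral.integral_sub]
    · simp only [integral_id, integral_pow]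
      norm_num
      ring
    all_goals exact Continuous.intervalIntegrable (by fun_prop) _ _
  · exact (hFc.continuousOn.integrableOn_compact (isCompact_Icc.prod isCompact_Icc)).mono_set
      (prod_mono Ioo_subset_Icc_self Ioo_subset_Icc_self)

/-- The integral over the ellipse of `(1 - α²x² - y²)(A + B x² + C y²)`. -/
lemma integral_ellipseO {α : ℝ} (hα : 0 < α) (A B C : ℝ) :
    ∫ p in ellipseO α, (1 - (α ^ 2 * p 0 ^ 2 + p 1 ^ 2)) * (A + B * p 0 ^ 2 + C * p 1 ^ 2) =
      α⁻¹ * (π / 2 * A + π / 12 * (B / α ^ 2 + C)) := by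
  set D : Set (ℝ × ℝ) := {p | p.1 ^ 2 + p.2 ^ 2 < 1}
  set G : ℝ × ℝ → ℝ := D.indicator
    (fun p => (1 - (p.1 ^ 2 + p.2 ^ 2)) * (A + B / α ^ 2 * p.1 ^ 2 + C * p.2 ^ 2)) with hG
  have hR2 : MeasurePreserving (fun p : R2 => (p 0, p 1)) :=
    (volume_preserving_finTwoArrow ℝ).comp
      (EuclideanSpace.volume_preserving_symm_measurableEquiv_toLp (Fin 2))
  have hemb : MeasurableEmbedding (fun p : R2 => (p 0, p 1)) :=
    (MeasurableEquiv.measurableEmbedding (MeasurableEquiv.finTwoArrow)).comp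
      (MeasurableEquiv.toLp 2 (Fin 2 → ℝ)).symm.measurableEmbedding
  have hDo : IsOpen D := isOpen_lt (by fun_prop) continuous_const
  have hGT : ∀ c : ℝ, 0 < c → Integrable (fun p : ℝ × ℝ => G (c * p.1, p.2)) := by
    intro c hc
    have hT : Continuous fun p : ℝ × ℝ => (c * p.1, p.2) := by fun_prop
    have hGc : (fun p : ℝ × ℝ => G (c * p.1, p.2)) =
        ((fun p : ℝ × ℝ => (c * p.1, p.2)) ⁻¹' D).indicator (fun p =>
          (1 - ((c * p.1) ^ 2 + p.2 ^ 2)) * (A + B / α ^ 2 * (c * p.1) ^ 2 + C * p.2 ^ 2)) := rfl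
    rw [hGc, integrable_indicator_iff (hDo.preimage hT).measurableSet]
    refine (ContinuousOn.integrableOn_compact
      ((isCompact_Icc (a := -c⁻¹) (b := c⁻¹)).prod (isCompact_Icc (a := (-1 : ℝ)) (b := 1)))
      (by fun_prop)).mono_set ?_
    rintro ⟨x, y⟩ h
    have h : (c * x) ^ 2 + y ^ 2 < 1 := h
    have hx : |c * x| ≤ 1 := abs_le_one_iff_mul_self_le_one.2 (by nlinarith)
    have hy : |y| ≤ 1 := abs_le_one_iff_mul_self_le_one.2 (by nlinarith)
    rw [abs_mul, abs_of_pos hc, mul_comm, ← le_div_iff₀ hc, one_div] at hx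
    exact ⟨abs_le.1 hx, abs_le.1 hy⟩
  have hscale : ∫ p : ℝ × ℝ, G (α * p.1, p.2) = α⁻¹ * ∫ p, G p := by
    have hdet := Measure.integral_comp_mul_left (fun x => ∫ y, G (x, y)) α
    rw [abs_of_pos (inv_pos.2 hα), smul_eq_mul] at hdet
    have hGint : Integrable G := by simpa using hGT 1 one_pos
    rw [Measure.volume_eq_prod, integral_prod _ (hGT α hα), integral_prod _ hGint, ← hdet]
  rw [← integral_disc, ← hscale, ← hR2.integral_comp hemb,
    ← integral_indicator (isOpen_ellipseO α).measurableSet]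
  congr 1
  funext p
  have hmem : p ∈ ellipseO α ↔ (α * p 0, p 1) ∈ D := by
    simp only [ellipseO, D, mem_ofPred_eq, mul_pow]
  by_cases hp : p ∈ ellipseO α
  · rw [indicator_of_mem hp, hG, indicator_of_mem (hmem.1 hp)]
    simp only
    field_simp
  · rw [indicator_of_notMem hp, hG, indicator_of_notMem (fun h => hp (hmem.2 h))]

/-- If `−Δφ₁ = m ψ₀` in `ω_α` with `φ₁ = 0` on `∂ω_α`, where
`ψ₀ = (1 − α²x² − y²)/(2(1+α²))`, then `∫ φ₁ = m ∫ ψ₀² = mπ/(12α(1+α²)²)`. -/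
theorem statement19 (α m : ℝ) (hα : α ∈ Set.Ioc (0 : ℝ) 1) (φ₁ : R2 → ℝ)
    (h2 : ContDiffOn ℝ 2 φ₁ (ellipseO α))
    (h1 : ContDiffOn ℝ 1 φ₁ (closure (ellipseO α)))
    (heq : ∀ p ∈ ellipseO α,
      -lap φ₁ p = m * ((1 - (α ^ 2 * p 0 ^ 2 + p 1 ^ 2)) / (2 * (1 + α ^ 2))))
    (hbd : ∀ p ∈ frontier (ellipseO α), φ₁ p = 0) :
    (∫ p in ellipseO α, φ₁ p) =
        m * (∫ p in ellipseO α,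
          ((1 - (α ^ 2 * p 0 ^ 2 + p 1 ^ 2)) / (2 * (1 + α ^ 2))) ^ 2) ∧
      (∫ p in ellipseO α, φ₁ p) = m * π / (12 * α * (1 + α ^ 2) ^ 2) := by
  obtain ⟨hα0, -⟩ := hα
  set a := α ^ 2 with ha
  have ha0 : 0 < a := by positivity
  set k := m / (2 * (1 + a)) with hk
  set d := 24 * (a ^ 2 + 6 * a + 1) with hd
  have hd0 : 0 < d := by positivity
  set B := -(k * a * (10 + 2 * a)) / d with hB
  set C := -(k * (2 + 10 * a)) / d with hC
  set A := (k + 2 * B + 2 * C) / (2 * (1 + a)) with hA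
  have hx : B * (2 + 12 * a) + 2 * a * C = -(k * a) := by
    rw [hB, hC]; field_simp; rw [hd]; ring
  have hy : 2 * B + C * (12 + 2 * a) = -k := by
    rw [hB, hC]; field_simp; rw [hd]; ring
  have hc : 2 * (1 + a) * A = k + 2 * B + 2 * C := by
    rw [hA]; field_simp
  have hsol : EqOn φ₁
      (fun p => (1 - (a * p 0 ^ 2 + p 1 ^ 2)) * (A + B * p 0 ^ 2 + C * p 1 ^ 2))
      (ellipseO α) := by
    refine eqOn_of_lap_eq (isOpen_ellipseO α) (isBounded_ellipseO hα0.ne') h1.continuousOn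
      (by fun_prop) h2 (by fun_prop) (fun p hp => ?_) (fun p hp => ?_)
    · have h := heq p hp
      have hk' : m * ((1 - (a * p 0 ^ 2 + p 1 ^ 2)) / (2 * (1 + a))) =
          k * (1 - (a * p 0 ^ 2 + p 1 ^ 2)) := by rw [hk]; ring
      rw [lap_ellipse_quartic]
      linear_combination -h - hk' + hc + p 0 ^ 2 * hx + p 1 ^ 2 * hy
    · rw [hbd p hp, ha, eq_one_of_mem_frontier_ellipseO hp]
      simp
  have hφ : ∫ p in ellipseO α, φ₁ p = m * π / (12 * α * (1 + a) ^ 2) := by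
    rw [setIntegral_congr_fun (isOpen_ellipseO α).measurableSet hsol, ha,
      integral_ellipseO hα0, ← ha]
    have hval : 6 * A + (B / a + C) = 2 * k / (1 + a) := by
      rw [hA, hB, hC]; field_simp; rw [hd]; ring
    have hval' : π / 2 * A + π / 12 * (B / a + C) = π / 12 * (2 * k / (1 + a)) := by
      rw [← hval]; ring
    rw [hval', hk]
    field_simp
  have hψ : ∫ p in ellipseO α, ((1 - (a * p 0 ^ 2 + p 1 ^ 2)) / (2 * (1 + a))) ^ 2 =
      π / (12 * α * (1 + a) ^ 2) := by
    have h : ∀ p : R2, ((1 - (a * p 0 ^ 2 + p 1 ^ 2)) / (2 * (1 + a))) ^ 2 =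
        (1 - (α ^ 2 * p 0 ^ 2 + p 1 ^ 2)) * (1 / (4 * (1 + a) ^ 2) +
          -a / (4 * (1 + a) ^ 2) * p 0 ^ 2 + -1 / (4 * (1 + a) ^ 2) * p 1 ^ 2) := by
      intro p
      rw [← ha]
      field_simp
      ring
    simp only [h]
    rw [integral_ellipseO hα0, ← ha]
    field_simp
    ring
  refine ⟨?_, hφ⟩
  rw [hφ, hψ]
  ring
end
end
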